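/- For each fixed delay h ∈ [0, h_*], where h_* > 0 is the unique real solution of 1 = |g'(κ)| h e^{h+1}, there exists a positive number c_* = c_*(h) (the minimal speed of propagation) such that: (a) for every c ≥ c_* the equation u_t = u_xx − u + g(u(t−h,x)) possesses a wavefront of speed c, every wavefront profile of speed c is strictly increasing on ℝ, and the wavefront profile of speed c is unique up to translation; (b) for every c < c_* the equation has no semi-wavefront propagating at velocity c. -/

import Mathlib

open Filter Set

noncomputable section

/-- The wave profile equation `φ'' - cφ' - φ + g(φ(· - ch)) = 0`. -/
def ProfileEq (g : ℝ → ℝ) (c h : ℝ) (φ : ℝ → ℝ) : Prop :=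
  ∀ t : ℝ, deriv (deriv φ) t - c * deriv φ t - φ t + g (φ (t - c * h)) = 0

/-- A wavefront profile of speed `c`: positive, `C²`, solving the profile equation,
with `φ(-∞) = 0` and `φ(+∞) = κ`. -/
def Wavefront (g : ℝ → ℝ) (κ c h : ℝ) (φ : ℝ → ℝ) : Prop :=
  (∀ t, 0 < φ t) ∧ ContDiff ℝ 2 φ ∧ ProfileEq g c h φ ∧
    Tendsto φ atBot (nhds 0) ∧ Tendsto φ atTop (nhds κ)

/-- A semi-wavefront profile of speed `c`: positive, `C²`, solving the profile equation,
with `φ(-∞) = 0` and `liminf_{t→+∞} φ(t) > 0`. -/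
def SemiWavefront (g : ℝ → ℝ) (c h : ℝ) (φ : ℝ → ℝ) : Prop :=
  (∀ t, 0 < φ t) ∧ ContDiff ℝ 2 φ ∧ ProfileEq g c h φ ∧
    Tendsto φ atBot (nhds 0) ∧ 0 < Filter.liminf φ atTop


structure T2 (f f1 f2 : ℝ → ℝ) : Prop where
  d1 : ∀ t, HasDerivAt f (f1 t) t
  d2 : ∀ t, HasDerivAt f1 (f2 t) t

lemma T2.c0 {f f1 f2 : ℝ → ℝ} (H : T2 f f1 f2) : Continuous f :=
  continuous_iff_continuousAt.2 fun t => (H.d1 t).continuousAt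

lemma T2.c1 {f f1 f2 : ℝ → ℝ} (H : T2 f f1 f2) : Continuous f1 :=
  continuous_iff_continuousAt.2 fun t => (H.d2 t).continuousAt

lemma T2.shift {f f1 f2 : ℝ → ℝ} (H : T2 f f1 f2) (s : ℝ) :
    T2 (fun t => f (t + s)) (fun t => f1 (t + s)) (fun t => f2 (t + s)) :=
  ⟨fun t => (H.d1 (t + s)).comp_add_const t s, fun t => (H.d2 (t + s)).comp_add_const t s⟩

lemma T2.sub {f f1 f2 e e1 e2 : ℝ → ℝ} (H : T2 f f1 f2) (K : T2 e e1 e2) :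
    T2 (fun t => f t - e t) (fun t => f1 t - e1 t) (fun t => f2 t - e2 t) :=
  ⟨fun t => (H.d1 t).sub (K.d1 t), fun t => (H.d2 t).sub (K.d2 t)⟩

lemma T2.addc {f f1 f2 : ℝ → ℝ} (H : T2 f f1 f2) (a : ℝ) : T2 (fun t => f t + a) f1 f2 :=
  ⟨fun t => (H.d1 t).add_const a, H.d2⟩

lemma T2.smul {f f1 f2 : ℝ → ℝ} (H : T2 f f1 f2) (a : ℝ) :
    T2 (fun t => a * f t) (fun t => a * f1 t) (fun t => a * f2 t) :=
  ⟨fun t => (H.d1 t).const_mul a, fun t => (H.d2 t).const_mul a⟩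

lemma mvt {f f' : ℝ → ℝ} (hf : ∀ t, HasDerivAt f (f' t) t) {a b : ℝ} (hab : a < b) :
    ∃ s ∈ Ioo a b, f b - f a = f' s * (b - a) := by
  obtain ⟨s, hs, h⟩ := exists_hasDerivAt_eq_slope f f' hab
    (fun t _ => (hf t).continuousAt.continuousWithinAt) (fun t _ => hf t)
  refine ⟨s, hs, ?_⟩
  rw [h]; field_simp [sub_ne_zero.2 hab.ne']

lemma T2.a0 {f f1 f2 : ℝ → ℝ} (H : T2 f f1 f2) (c t : ℝ) :
    ∃ s ∈ Icc t (t+1), ∃ x ∈ Icc t (t+1),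
      |f1 t| ≤ |f (t+1) - f t| + |c| * |f s - f t| + |f2 x - c * f1 x| := by
  obtain ⟨s, hs, e⟩ := mvt H.d1 (show t < t + 1 by linarith)
  obtain ⟨x, hx, e'⟩ := mvt (f := fun t => f1 t - c * f t) (f' := fun t => f2 t - c * f1 t)
    (fun t => (H.d2 t).sub ((H.d1 t).const_mul c)) hs.1
  refine ⟨s, ⟨hs.1.le, hs.2.le⟩, x, ⟨hx.1.le, by linarith [hx.2, hs.2]⟩, ?_⟩
  have h1 : f1 t = (f (t+1) - f t) - c * (f s - f t) - (f2 x - c * f1 x) * (s - t) := by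
    linear_combination -e - e'
  rw [h1]
  have h2 : |(f2 x - c * f1 x) * (s - t)| ≤ |f2 x - c * f1 x| := by
    rw [abs_mul]
    have : |s - t| ≤ 1 := abs_le.2 ⟨by linarith [hs.1], by linarith [hs.2]⟩
    nlinarith [abs_nonneg (f2 x - c * f1 x)]
  have h3 := abs_sub ((f (t+1) - f t) - c * (f s - f t)) ((f2 x - c * f1 x) * (s - t))
  have h4 := abs_sub (f (t+1) - f t) (c * (f s - f t))
  rw [abs_mul] at h4
  linarith

lemma T2.f1bdd {f f1 f2 : ℝ → ℝ} (H : T2 f f1 f2) (c B B' : ℝ) (hf : ∀ t, |f t| ≤ B)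
    (h2 : ∀ t, |f2 t - c * f1 t| ≤ B') (t : ℝ) : |f1 t| ≤ 2 * B + |c| * (2 * B) + B' := by
  obtain ⟨s, -, x, -, h⟩ := H.a0 c t
  have h1 := abs_sub (f (t+1)) (f t)
  have h3 := abs_sub (f s) (f t)
  have : |c| * |f s - f t| ≤ |c| * (2 * B) :=
    mul_le_mul_of_nonneg_left (by linarith [hf s, hf t]) (abs_nonneg c)
  linarith [hf (t+1), hf t, h2 x]

def SL (l : Filter ℝ) : Prop := ∀ x : ℝ → ℝ, (∀ t, t ≤ x t ∧ x t ≤ t + 3) → Tendsto x l l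

lemma SLtop : SL atTop := fun _ hx => tendsto_atTop_mono (fun t => (hx t).1) tendsto_id
lemma SLbot : SL atBot := fun _ hx => tendsto_atBot_mono (fun t => (hx t).2)
  (tendsto_atBot_add_const_right _ 3 tendsto_id)

lemma T2.f1lim {f f1 f2 : ℝ → ℝ} (H : T2 f f1 f2) {c a : ℝ} {l : Filter ℝ} (hl : SL l)
    (hf : Tendsto f l (nhds a)) (h2 : Tendsto (fun t => f2 t - c * f1 t) l (nhds 0)) :
    Tendsto f1 l (nhds 0) := by
  choose s hs x hx h using H.a0 c
  have hs' := hf.comp (hl s fun t => ⟨(hs t).1, by linarith [(hs t).2]⟩)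
  have hx' := h2.comp (hl x fun t => ⟨(hx t).1, by linarith [(hx t).2]⟩)
  have h1 := hf.comp (hl (fun t => t + 1) fun t => ⟨by linarith, by linarith⟩)
  have := (((h1.sub hf).abs).add (((hs'.sub hf).abs).const_mul |c|)).add hx'.abs
  refine squeeze_zero_norm (fun t => h t) ?_
  simpa using this

lemma T2.lim {f f1 f2 : ℝ → ℝ} (H : T2 f f1 f2) {c a m : ℝ} {l : Filter ℝ} [l.NeBot] (hl : SL l)
    (hf : Tendsto f l (nhds a)) (h2 : Tendsto (fun t => f2 t - c * f1 t) l (nhds m)) :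
    m = 0 := by
  have key : ∀ t, ∃ s ∈ Icc t (t+3), ∃ s' ∈ Icc t (t+3), ∃ x ∈ Icc t (t+3),
      |f2 x - c * f1 x| ≤ |f (t+3) - f (t+2)| + |f (t+1) - f t| + |c| * |f s' - f s| := by
    intro t
    obtain ⟨s, hs, e⟩ := mvt H.d1 (show t < t + 1 by linarith)
    obtain ⟨s', hs', e1⟩ := mvt H.d1 (show t + 2 < t + 3 by linarith)
    obtain ⟨x, hx, e'⟩ := mvt (f := fun t => f1 t - c * f t) (f' := fun t => f2 t - c * f1 t)
      (fun t => (H.d2 t).sub ((H.d1 t).const_mul c)) (show s < s' by linarith [hs.2, hs'.1])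
    refine ⟨s, ⟨hs.1.le, by linarith [hs.2]⟩, s', ⟨by linarith [hs'.1], hs'.2.le⟩, x,
      ⟨by linarith [hs.1, hx.1], by linarith [hx.2, hs'.2]⟩, ?_⟩
    have h1 : (f2 x - c * f1 x) * (s' - s) =
        (f (t+3) - f (t+2)) - (f (t+1) - f t) - c * (f s' - f s) := by
        linear_combination e - e1 - e'
    have h2 : |f2 x - c * f1 x| ≤ |(f2 x - c * f1 x) * (s' - s)| := by
      rw [abs_mul]
      have : 1 ≤ |s' - s| := le_trans (by linarith [hs.2, hs'.1]) (le_abs_self _)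
      nlinarith [abs_nonneg (f2 x - c * f1 x)]
    rw [h1] at h2
    have h3 := abs_sub ((f (t+3) - f (t+2)) - (f (t+1) - f t)) (c * (f s' - f s))
    have h4 := abs_sub (f (t+3) - f (t+2)) (f (t+1) - f t)
    rw [abs_mul] at h3
    linarith
  choose s hs s' hs' x hx h using key
  have k1 := hf.comp (hl s hs)
  have k2 := hf.comp (hl s' hs')
  have k3 := h2.comp (hl x hx)
  have k4 := hf.comp (hl (fun t => t + 3) fun t => ⟨by linarith, by linarith⟩)
  have k5 := hf.comp (hl (fun t => t + 2) fun t => ⟨by linarith, by linarith⟩)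
  have k6 := hf.comp (hl (fun t => t + 1) fun t => ⟨by linarith, by linarith⟩)
  have := (((k4.sub k5).abs).add ((k6.sub hf).abs)).add (((k2.sub k1).abs).const_mul |c|)
  have h0 : Tendsto (fun t => f2 (x t) - c * f1 (x t)) l (nhds 0) := by
    refine squeeze_zero_norm (fun t => h t) ?_
    simpa using this
  exact tendsto_nhds_unique k3 h0

lemma hasDerivAt_expmul {f : ℝ → ℝ} {f' t : ℝ} (a : ℝ) (hf : HasDerivAt f f' t) :
    HasDerivAt (fun t => Real.exp (a * t) * f t) (Real.exp (a * t) * (f' + a * f t)) t := by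
  have h1 : HasDerivAt (fun t => Real.exp (a * t)) (Real.exp (a * t) * a) t := by
    simpa using ((hasDerivAt_id t).const_mul a).exp
  refine (h1.mul hf).congr_deriv ?_
  ring

lemma exp_mono {D : Set ℝ} (hD : Convex ℝ D) {f f' : ℝ → ℝ} (a : ℝ)
    (hf : ∀ t ∈ D, HasDerivAt f (f' t) t) (h : ∀ t ∈ D, 0 ≤ f' t + a * f t) :
    MonotoneOn (fun t => Real.exp (a * t) * f t) D :=
  monotoneOn_of_hasDerivWithinAt_nonneg hD
    (fun t ht => (hasDerivAt_expmul a (hf t ht)).continuousAt.continuousWithinAt)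
    (fun t ht => (hasDerivAt_expmul a (hf t (interior_subset ht))).hasDerivWithinAt)
    (fun t ht => mul_nonneg (Real.exp_pos _).le (h t (interior_subset ht)))

lemma exp_anti {D : Set ℝ} (hD : Convex ℝ D) {f f' : ℝ → ℝ} (a : ℝ)
    (hf : ∀ t ∈ D, HasDerivAt f (f' t) t) (h : ∀ t ∈ D, f' t + a * f t ≤ 0) :
    AntitoneOn (fun t => Real.exp (a * t) * f t) D :=
  antitoneOn_of_hasDerivWithinAt_nonpos hD
    (fun t ht => (hasDerivAt_expmul a (hf t ht)).continuousAt.continuousWithinAt)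
    (fun t ht => (hasDerivAt_expmul a (hf t (interior_subset ht))).hasDerivWithinAt)
    (fun t ht => mul_nonpos_of_nonneg_of_nonpos (Real.exp_pos _).le (h t (interior_subset ht)))

lemma tendsto_exp_mul_atBot {a : ℝ} (ha : 0 < a) : Tendsto (fun t => Real.exp (a * t)) atBot (nhds 0) :=
  Real.tendsto_exp_atBot.comp (tendsto_id.const_mul_atBot ha)

lemma tendsto_exp_neg_mul_atTop {a : ℝ} (ha : 0 < a) :
    Tendsto (fun t => Real.exp (-a * t)) atTop (nhds 0) :=
  Real.tendsto_exp_atBot.comp (tendsto_id.const_mul_atTop_of_neg (by linarith))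



structure MU (q c τ μ : ℝ) : Prop where
  hq : 0 < q
  hc : 0 < c
  hτ : 0 ≤ τ
  hμ : 0 < μ
  eq : μ ^ 2 + c * μ - 1 - q * Real.exp (μ * τ) = 0
  hK : q * (Real.exp (μ * τ) - 1) ≤ μ * c

lemma tendsto_zero_mul_bdd {l : Filter ℝ} {e f : ℝ → ℝ} {B : ℝ} (he : Tendsto e l (nhds 0))
    (hf : ∀ t, |f t| ≤ B) : Tendsto (fun t => e t * f t) l (nhds 0) := by
  have : Tendsto (fun t => |e t| * B) l (nhds 0) := by simpa using he.abs.mul_const B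
  refine squeeze_zero_norm (fun t => ?_) this
  rw [Real.norm_eq_abs, abs_mul]
  exact mul_le_mul_of_nonneg_left (hf t) (abs_nonneg _)

lemma exp_mono_shift {f : ℝ → ℝ} {μ τ : ℝ} (hτ : 0 ≤ τ)
    (h : Monotone (fun t => Real.exp (μ * t) * f t)) (t : ℝ) : f (t - τ) ≤ Real.exp (μ * τ) * f t := by
  have h1 := h (show t - τ ≤ t by linarith)
  have e : Real.exp (μ * t) = Real.exp (μ * (t - τ)) * Real.exp (μ * τ) := by
    rw [← Real.exp_add]; ring_nf
  simp only [e, mul_assoc] at h1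
  exact le_of_mul_le_mul_left h1 (Real.exp_pos _)

lemma MU.mp {q c τ μ B B1 : ℝ} (M : MU q c τ μ) {f f1 f2 : ℝ → ℝ} (H : T2 f f1 f2)
    (hf : ∀ t, |f t| ≤ B) (hf1 : ∀ t, |f1 t| ≤ B1)
    (hD : ∀ t, f2 t - c * f1 t - f t - q * f (t - τ) ≤ 0) (t : ℝ) : 0 ≤ f1 t + μ * f t := by
  have hc := M.hc
  have hμ := M.hμ
  have bd : ∀ t, |f1 t + μ * f t| ≤ B1 + μ * B := fun t => by
    refine (abs_add_le _ _).trans ?_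
    rw [abs_mul, abs_of_pos hμ]
    linarith [hf1 t, mul_le_mul_of_nonneg_left (hf t) hμ.le]
  have step : ∀ m ≤ 0, (∀ t, m ≤ f1 t + μ * f t) → ∀ t, c / (μ + c) * m ≤ f1 t + μ * f t := by
    intro m hm h
    have mono : Monotone (fun t => Real.exp (μ * t) * (f t - m / μ)) := by
      rw [← monotoneOn_univ]
      refine exp_mono (f := fun t => f t - m / μ) (f' := f1) convex_univ μ
        (fun t _ => (H.d1 t).sub_const _) (fun t _ => ?_)
      have : μ * (f t - m / μ) = μ * f t - m := by field_simp
      rw [this]; linarith [h t]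
    have h2 := fun t => exp_mono_shift M.hτ mono t
    have anti : Antitone (fun t => Real.exp (-(μ + c) * t) * (f1 t + μ * f t - c / (μ + c) * m)) := by
      rw [← antitoneOn_univ]
      refine exp_anti (f := fun t => f1 t + μ * f t - c / (μ + c) * m)
        (f' := fun t => f2 t + μ * f1 t) convex_univ _
        (fun t _ => ((H.d2 t).add ((H.d1 t).const_mul μ)).sub_const _) (fun t _ => ?_)
      have e1 : -(μ + c) * (f1 t + μ * f t - c / (μ + c) * m) =
        -(μ + c) * (f1 t + μ * f t) + c * m := by field_simp; ring
      have e2 : q * (f (t - τ) - Real.exp (μ * τ) * f t) ≤ -(m / μ) * (q * (Real.exp (μ * τ) - 1)) := by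
        have := mul_le_mul_of_nonneg_left (h2 t) M.hq.le
        nlinarith
      have e3 : -(m / μ) * (q * (Real.exp (μ * τ) - 1)) ≤ -(m/μ) * (μ * c) :=
        mul_le_mul_of_nonneg_left M.hK (by rw [neg_nonneg]; exact div_nonpos_of_nonpos_of_nonneg hm hμ.le)
      have e4 : -(m/μ) * (μ * c) = - (c * m) := by field_simp
      rw [e1]
      have e5 : f2 t + μ * f1 t + (-(μ + c) * (f1 t + μ * f t) + c * m) =
        (f2 t - c * f1 t - f t - q * f (t - τ)) + q * (f (t - τ) - Real.exp (μ * τ) * f t) + c * m := by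
        linear_combination (-f t) * M.eq
      rw [e5]
      linarith [hD t]
    intro t
    have lim : Tendsto (fun t => Real.exp (-(μ + c) * t) * (f1 t + μ * f t - c / (μ + c) * m)) atTop (nhds 0) :=
      tendsto_zero_mul_bdd (B := B1 + μ * B + |c / (μ + c) * m|) (tendsto_exp_neg_mul_atTop (by linarith))
        (fun t => (abs_sub _ _).trans (by linarith [bd t]))
    have h0 := anti.le_of_tendsto lim t
    have := nonneg_of_mul_nonneg_right h0 (Real.exp_pos _)
    linarith
  have bb : BddBelow (range fun t => f1 t + μ * f t) :=
    ⟨-(B1 + μ * B), by rintro _ ⟨t, rfl⟩; exact (abs_le.1 (bd t)).1⟩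
  by_contra hneg
  push Not at hneg
  set m := ⨅ t, (f1 t + μ * f t) with hm
  have hm0 : m < 0 := (ciInf_le bb t).trans_lt hneg
  have := le_ciInf (step m hm0.le (fun t => ciInf_le bb t))
  rw [← hm] at this
  have h1 : c / (μ + c) < 1 := by rw [div_lt_one (by linarith)]; linarith
  nlinarith

lemma mono_of_psi {μ : ℝ} {f f1 : ℝ → ℝ} (H : ∀ t, HasDerivAt f (f1 t) t)
    (h : ∀ t, 0 ≤ f1 t + μ * f t) : Monotone (fun t => Real.exp (μ * t) * f t) := by
  rw [← monotoneOn_univ]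
  exact exp_mono convex_univ μ (fun t _ => H t) (fun t _ => h t)

lemma nonneg_of_psi {μ B : ℝ} (hμ : 0 < μ) {f f1 : ℝ → ℝ} (H : ∀ t, HasDerivAt f (f1 t) t)
    (hf : ∀ t, |f t| ≤ B) (h : ∀ t, 0 ≤ f1 t + μ * f t) (t : ℝ) : 0 ≤ f t := by
  have h1 := (mono_of_psi H h).le_of_tendsto
    (tendsto_zero_mul_bdd (tendsto_exp_mul_atBot hμ) hf) t
  exact nonneg_of_mul_nonneg_right h1 (Real.exp_pos _)

lemma MU.smp {q c τ μ B B1 : ℝ} (M : MU q c τ μ) {f f1 f2 : ℝ → ℝ} (H : T2 f f1 f2)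
    (hf : ∀ t, |f t| ≤ B) (hf1 : ∀ t, |f1 t| ≤ B1)
    (hD : ∀ t, f2 t - c * f1 t - f t - q * f (t - τ) ≤ 0) {t0 : ℝ} (h0 : f t0 = 0) (t : ℝ) :
    f t = 0 := by
  have hψ := M.mp H hf hf1 hD
  have hpos := nonneg_of_psi M.hμ H.d1 hf hψ
  have mono := mono_of_psi H.d1 hψ
  have hleft : ∀ t ≤ t0, f t = 0 := fun t ht => by
    have := mono ht
    simp only [h0, mul_zero] at this
    exact le_antisymm (nonpos_of_mul_nonpos_right this (Real.exp_pos _)) (hpos t)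
  have hf1' : f1 (t0 - 1) = 0 := by
    have : (fun _ => (0:ℝ)) =ᶠ[nhds (t0 - 1)] f := by
      filter_upwards [Iio_mem_nhds (show t0 - 1 < t0 by linarith)] with x hx
      exact (hleft x (le_of_lt hx)).symm
    exact (H.d1 (t0 - 1)).unique ((hasDerivAt_const (t0 - 1) (0:ℝ)).congr_of_eventuallyEq this.symm)
  have anti : Antitone (fun t => Real.exp (-(μ + c) * t) * (f1 t + μ * f t)) := by
    rw [← antitoneOn_univ]
    refine exp_anti (f := fun t => f1 t + μ * f t)
      (f' := fun t => f2 t + μ * f1 t) convex_univ _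
      (fun t _ => ((H.d2 t).add ((H.d1 t).const_mul μ))) (fun t _ => ?_)
    have e5 : f2 t + μ * f1 t + (-(μ + c) * (f1 t + μ * f t)) =
        (f2 t - c * f1 t - f t - q * f (t - τ)) + q * (f (t - τ) - Real.exp (μ * τ) * f t) := by
      linear_combination (-f t) * M.eq
    rw [e5]
    have := exp_mono_shift M.hτ mono t
    nlinarith [hD t, M.hq]
  rcases le_total t t0 with ht | ht
  · exact hleft t ht
  have hz : ∀ s ∈ Ici (t0 - 1), f1 s + μ * f s = 0 := fun s hs => by
    have := anti hs
    simp only [hf1', hleft (t0-1) (by linarith), mul_zero, add_zero] at this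
    exact le_antisymm (nonpos_of_mul_nonpos_right this (Real.exp_pos _)) (hψ s)
  have := exp_anti (convex_Ici (t0 - 1)) μ (fun t _ => H.d1 t) (fun s hs => (hz s hs).le)
    (show t0 ∈ Ici (t0-1) by simp) (show t ∈ Ici (t0-1) by simp; linarith) ht
  simp only [h0, mul_zero] at this
  exact le_antisymm (nonpos_of_mul_nonpos_right this (Real.exp_pos _)) (hpos t)

lemma exists_mu {q c h : ℝ} (hq : 0 < q) (hc : 0 < c) (hh : 0 ≤ h)
    (hqh : q * h * Real.exp (h + 1) ≤ 1) :
    ∃ μ, MU q c (c * h) μ ∧ q * h * Real.exp (μ * (c * h)) < 1 := by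
  have main : ∃ b > 0, 0 < b ^ 2 + c * b - 1 - q * Real.exp (b * (c * h)) ∧
      q * h * Real.exp (b * (c * h)) ≤ 1 := by
    rcases hh.eq_or_lt with rfl | hh
    · refine ⟨1 + q, by linarith, ?_, by simp⟩
      simp; nlinarith [mul_pos hc hq]
    · refine ⟨(h + 1) / (c * h), by positivity, ?_, ?_⟩
      · rw [div_mul_cancel₀ _ (by positivity)]
        have e : c * ((h+1)/(c*h)) = 1 + 1 / h := by field_simp
        rw [e]
        have : q * Real.exp (h+1) ≤ 1 / h := by rw [le_div_iff₀ hh]; linarith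
        have : 0 < ((h + 1) / (c * h))^2 := by positivity
        linarith
      · rwa [div_mul_cancel₀ _ (by positivity)]
  obtain ⟨b, hb, h1, h2⟩ := main
  have hcont : ContinuousOn (fun b => b ^ 2 + c * b - 1 - q * Real.exp (b * (c * h))) (Icc 0 b) := by
    fun_prop
  obtain ⟨μ, hμ, hz⟩ := intermediate_value_Ioo hb.le hcont
    (show (0:ℝ) ∈ Ioo _ _ from ⟨by simp; linarith, h1⟩)
  have hlt : q * h * Real.exp (μ * (c * h)) < 1 := by
    rcases hh.eq_or_lt with rfl | hh
    · simp
    · refine lt_of_lt_of_le ?_ h2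
      refine mul_lt_mul_of_pos_left (Real.exp_lt_exp.2 ?_) (by positivity)
      exact mul_lt_mul_of_pos_right hμ.2 (by positivity)
  refine ⟨μ, ⟨hq, hc, by positivity, hμ.1, hz, ?_⟩, hlt⟩
  have e1 : Real.exp (μ * (c * h)) - 1 ≤ μ * (c*h) * Real.exp (μ * (c*h)) := by
    have := Real.add_one_le_exp (-(μ * (c * h)))
    have h3 : Real.exp (-(μ * (c * h))) * Real.exp (μ * (c * h)) = 1 := by rw [← Real.exp_add]; simp
    nlinarith [Real.exp_pos (μ * (c * h))]
  have := mul_pos hμ.1 hc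
  nlinarith


structure GH (g : ℝ → ℝ) (κ q p L δ A γ ε0 : ℝ) : Prop where
  cont : Continuous g
  hκ : 0 < κ
  hq : 0 < q
  hp : 1 < p
  hL : 1 ≤ L
  g0 : g 0 = 0
  gκ : g κ = κ
  nonneg : ∀ x, 0 ≤ x → 0 ≤ g x
  fixp : ∀ x ∈ Icc 0 κ, g x = x → x = 0 ∨ x = κ
  mono : ∀ u v, 0 ≤ u → u ≤ v → v ≤ κ → g u + q * u ≤ g v + q * v
  big : ∀ u, κ ≤ u → g u ≤ κ
  lip : ∀ u ∈ Icc 0 κ, ∀ v ∈ Icc 0 κ, |g u - g v| ≤ L * |u - v|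
  hδ : 0 < δ
  hδκ : δ < κ
  monoδ : MonotoneOn g (Icc 0 δ)
  geu : ∀ u ∈ Icc 0 δ, u ≤ g u
  hA : 0 < A
  hγ : 0 < γ
  hol : ∀ u ∈ Icc 0 δ, |g u - p * u| ≤ A * u ^ γ * u
  hε : 0 < ε0
  hεκ : ε0 < κ
  kap : ∀ u ∈ Icc (κ - ε0) κ, ∀ v ∈ Icc (κ - ε0) κ,
    |(g u + q * u) - (g v + q * v)| ≤ 1 / 2 * |u - v|

structure SW (g : ℝ → ℝ) (c τ : ℝ) (f f1 f2 : ℝ → ℝ) : Prop where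
  t2 : T2 f f1 f2
  pos : ∀ t, 0 < f t
  eq : ∀ t, f2 t - c * f1 t - f t + g (f (t - τ)) = 0
  lim0 : Tendsto f atBot (nhds 0)
  lb : ∃ ε > 0, ∀ᶠ t in atTop, ε ≤ f t
  ninf : ¬ Tendsto f atTop atTop

lemma exists_prim {f : ℝ → ℝ} (hf : Continuous f) : ∃ F : ℝ → ℝ, ∀ t, HasDerivAt F (f t) t :=
  ⟨fun t => ∫ s in (0:ℝ)..t, f s, fun t =>
    (hf.integral_hasStrictDerivAt 0 t).hasDerivAt⟩

lemma antiOn_bot {F : ℝ → ℝ} {T a : ℝ} (h : AntitoneOn F (Iic T)) (hl : Tendsto F atBot (nhds a))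
    {t : ℝ} (ht : t ≤ T) : F t ≤ a :=
  ge_of_tendsto hl ((eventually_le_atBot t).mono fun _ hs => h (hs.trans ht) ht hs)

lemma monoOn_bot {F : ℝ → ℝ} {T a : ℝ} (h : MonotoneOn F (Iic T)) (hl : Tendsto F atBot (nhds a))
    {t : ℝ} (ht : t ≤ T) : a ≤ F t :=
  le_of_tendsto hl ((eventually_le_atBot t).mono fun _ hs => h (hs.trans ht) ht hs)

lemma first_time {S : Set ℝ} (hS : IsClosed S) (hne : S.Nonempty) (hb : BddBelow S) :
    ∃ t ∈ S, ∀ s < t, s ∉ S :=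
  ⟨sInf S, hS.csInf_mem hne hb, fun _ hs => notMem_of_lt_csInf hs hb⟩

lemma SW.f1lim {g : ℝ → ℝ} {c τ : ℝ} {f f1 f2 : ℝ → ℝ} (hg : Continuous g) (g0 : g 0 = 0)
    (S : SW g c τ f f1 f2) : Tendsto f1 atBot (nhds 0) := by
  refine S.t2.f1lim (c := c) SLbot S.lim0 ?_
  have h1 : Tendsto (fun t => f t - g (f (t - τ))) atBot (nhds (0 - g 0)) :=
    S.lim0.sub ((hg.tendsto 0).comp (S.lim0.comp (tendsto_atBot_add_const_right _ (-τ) tendsto_id)))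
  rw [g0, sub_zero] at h1
  refine h1.congr fun t => ?_
  linarith [S.eq t]

lemma sw_nonpos {g : ℝ → ℝ} {κ q p L δ A γ ε0 c h : ℝ} (G : GH g κ q p L δ A γ ε0) (hc : c ≤ 0)
    (hh : 0 ≤ h) {f f1 f2 : ℝ → ℝ} (S : SW g c (c * h) f f1 f2) : False := by
  set σ := -(c * h) with hσ
  have hσ0 : 0 ≤ σ := by rw [hσ]; nlinarith
  obtain ⟨F, hF⟩ := exists_prim S.t2.c0
  have Fm : Monotone F := monotone_of_hasDerivAt_nonneg hF fun t => (S.pos t).le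
  obtain ⟨T, hT⟩ := eventually_atBot.1
    ((S.lim0.comp (tendsto_atBot_add_const_right _ σ tendsto_id)).eventually (gt_mem_nhds G.hδ))
  have hlimF : Tendsto (fun t => F (t + σ) - F t) atBot (nhds 0) := by
    have : ∀ t, ∃ x ≤ t + σ, F (t + σ) - F t = f x * σ := fun t => by
      rcases hσ0.eq_or_lt with h0 | h0
      · exact ⟨t, by linarith, by simp [← h0]⟩
      · obtain ⟨x, hx, e⟩ := mvt hF (show t < t + σ by linarith)
        exact ⟨x, hx.2.le, by rw [e]; ring⟩
    choose x hx e using this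
    have := (S.lim0.comp (tendsto_atBot_mono hx (tendsto_atBot_add_const_right _ σ tendsto_id))).mul_const σ
    simp only [zero_mul] at this
    exact this.congr fun t => (e t).symm
  have anti : AntitoneOn (fun t => f1 t - c * f t + (F (t + σ) - F t)) (Iic T) := by
    have hd : ∀ t, HasDerivAt (fun t => f1 t - c * f t + (F (t + σ) - F t))
        (f2 t - c * f1 t + (f (t + σ) - f t)) t := fun t =>
      ((S.t2.d2 t).sub ((S.t2.d1 t).const_mul c)).add (((hF (t + σ)).comp_add_const t σ).sub (hF t))
    refine antitoneOn_of_hasDerivWithinAt_nonpos (convex_Iic T)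
      (fun t _ => (hd t).continuousAt.continuousWithinAt) (fun t _ => (hd t).hasDerivWithinAt) ?_
    intro t ht
    have h1 := S.eq t
    rw [show t - c * h = t + σ by rw [hσ]; ring] at h1
    have h2 := G.geu (f (t + σ)) ⟨(S.pos _).le, (hT t (show t ∈ Iic T from interior_subset ht)).le⟩
    linarith
  have lim : Tendsto (fun t => f1 t - c * f t + (F (t + σ) - F t)) atBot (nhds 0) := by
    simpa using ((S.f1lim G.cont G.g0).sub (S.lim0.const_mul c)).add hlimF
  have anti2 : AntitoneOn (fun t => Real.exp (-c * t) * f t) (Iic T) := by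
    refine exp_anti (convex_Iic T) (-c) (fun t _ => S.t2.d1 t) fun t ht => ?_
    have := antiOn_bot anti lim ht
    have := Fm (show t ≤ t + σ by linarith)
    linarith
  have lim2 : Tendsto (fun t => Real.exp (-c * t) * f t) atBot (nhds 0) := by
    refine squeeze_zero' (Eventually.of_forall fun t => (mul_pos (Real.exp_pos _) (S.pos t)).le) ?_ S.lim0
    filter_upwards [eventually_le_atBot 0] with t ht
    have : Real.exp (-c * t) ≤ 1 := Real.exp_le_one_iff.2 (by nlinarith)
    nlinarith [S.pos t]
  have := antiOn_bot anti2 lim2 (le_refl T)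
  exact absurd this (not_le.2 (mul_pos (Real.exp_pos _) (S.pos T)))

lemma SW.lt {g : ℝ → ℝ} {κ q p L δ A γ ε0 c τ μ : ℝ} (G : GH g κ q p L δ A γ ε0) (M : MU q c τ μ)
    {f f1 f2 : ℝ → ℝ} (S : SW g c τ f f1 f2) (t : ℝ) : f t < κ := by
  by_contra hcon
  push Not at hcon
  have hμ := M.hμ
  have hc := M.hc
  obtain ⟨T0, hT0⟩ := eventually_atBot.1 (S.lim0.eventually (gt_mem_nhds G.hκ))
  obtain ⟨t1, ht1, hfirst⟩ := first_time (S := {t | κ ≤ f t}) (isClosed_le continuous_const S.t2.c0)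
    ⟨t, hcon⟩ ⟨T0, fun s hs => by
      by_contra h; push Not at h; exact absurd (hT0 s h.le) (not_lt.2 hs)⟩
  simp only [mem_ofPred_eq, not_le] at ht1 hfirst
  have ht1' : f t1 = κ := le_antisymm (le_of_tendsto
    (S.t2.c0.continuousAt.tendsto.mono_left (nhdsWithin_le_nhds (s := Iio t1)))
    (eventually_mem_nhdsWithin.mono fun s hs => (hfirst s hs).le)) ht1
  set w : ℝ → ℝ := fun t => f t - κ with hw
  have dw : ∀ t, HasDerivAt w (f1 t) t := fun t => (S.t2.d1 t).sub_const κ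
  set ω : ℝ → ℝ := fun t => f1 t + μ * w t with hω
  have cω : Continuous ω := S.t2.c1.add (continuous_const.mul (S.t2.c0.sub continuous_const))
  have limw : Tendsto w atBot (nhds (-κ)) := by simpa using S.lim0.sub_const κ
  have limω : Tendsto ω atBot (nhds (-(μ * κ))) := by
    simpa using (S.f1lim G.cont G.g0).add (limw.const_mul μ)
  have lime : Tendsto (fun t => Real.exp (μ * t) * w t) atBot (nhds 0) := by
    simpa using (tendsto_exp_mul_atBot hμ).mul limw
  obtain ⟨s0, hs0, hs0'⟩ : ∃ s ≤ t1, 0 < ω s := by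
    by_contra h; push Not at h
    have := exp_anti (convex_Iic t1) μ (fun t _ => dw t) (fun t ht => h t ht)
    have h2 := this (show t1 - 1 ∈ Iic t1 by simp) (show t1 ∈ Iic t1 by simp) (by linarith)
    simp only [hw, ht1', sub_self, mul_zero] at h2
    have := nonneg_of_mul_nonneg_right h2 (Real.exp_pos _)
    linarith [hfirst (t1-1) (by linarith)]
  obtain ⟨T1, hT1⟩ := eventually_atBot.1 (limω.eventually
    (gt_mem_nhds (show -(μ*κ) < 0 by have := mul_pos hμ G.hκ; linarith)))
  have key : ∀ t' ∈ Icc t1 (t1 + τ), 0 < f1 t' := by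
    intro t' ht'
    obtain ⟨x, hx, hmax⟩ := isCompact_Icc.exists_isMaxOn (s := Icc T1 t')
      ⟨s0, by by_contra h; push Not at h; linarith [hT1 s0 h.le], hs0.trans ht'.1⟩ cω.continuousOn
    have hms0 : ω s0 ≤ ω x := hmax ⟨by by_contra h; push Not at h; linarith [hT1 s0 h.le], hs0.trans ht'.1⟩
    have hle : ∀ s ≤ t', ω s ≤ ω x := fun s hs => by
      rcases le_total s T1 with h | h
      · linarith [hT1 s h]
      · exact hmax ⟨h, hs⟩
    set m := ω x with hm
    have hm0 : 0 < m := by linarith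
    have anti : AntitoneOn (fun t => Real.exp (μ * t) * (w t - m / μ)) (Iic t') := by
      refine exp_anti (f := fun t => w t - m / μ) (f' := f1) (convex_Iic t') μ
        (fun t _ => (dw t).sub_const _) (fun t ht => ?_)
      have e : μ * (w t - m / μ) = μ * w t - m := by field_simp
      rw [e]; have := hle t ht; simp only [hω] at this ⊢; linarith
    have hxt : x = t' := by
      by_contra hne
      have hxlt : x < t' := lt_of_le_of_ne hx.2 hne
      have dω : HasDerivAt ω (f2 x + μ * f1 x) x := (S.t2.d2 x).add ((dw x).const_mul μ)
      have hz : f2 x + μ * f1 x = 0 := by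
        refine IsLocalMax.hasDerivAt_eq_zero ?_ dω
        filter_upwards [Iio_mem_nhds hxlt] with s hs using hle s (le_of_lt hs)
      have h1 := anti (show x - τ ∈ Iic t' by simp; linarith [M.hτ]) hx.2 (by linarith [M.hτ])
      have e : Real.exp (μ * x) = Real.exp (μ * (x - τ)) * Real.exp (μ * τ) := by
        rw [← Real.exp_add]; ring_nf
      simp only [e, mul_assoc] at h1
      have h2 := le_of_mul_le_mul_left h1 (Real.exp_pos _)
      have h3 := G.mono (f (x - τ)) κ (S.pos _).le (by
        rcases eq_or_lt_of_le (show x - τ ≤ t1 by linarith [ht'.2]) with h | h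
        · rw [h, ht1']
        · exact (hfirst _ h).le) le_rfl
      have h4 := S.eq x
      have e2 : q * (Real.exp (μ * τ) * w x - w (x - τ)) ≤ (m / μ) * (q * (Real.exp (μ * τ) - 1)) := by
        have := mul_le_mul_of_nonneg_left h2 G.hq.le
        nlinarith
      have e3 : (m / μ) * (q * (Real.exp (μ * τ) - 1)) ≤ (m/μ) * (μ * c) :=
        mul_le_mul_of_nonneg_left M.hK (by positivity)
      have e4 : (m/μ) * (μ * c) = c * m := by field_simp
      have e5 : f2 x + μ * f1 x = (μ + c) * m + (f2 x - c * f1 x - w x - q * w (x - τ))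
          - q * (Real.exp (μ * τ) * w x - w (x - τ)) := by
        simp only [hm, hω]
        linear_combination (-w x) * M.eq
      rw [G.gκ] at h3
      have : w x = f x - κ := rfl
      have : w (x - τ) = f (x - τ) - κ := rfl
      nlinarith [mul_pos hμ hm0]
    have h1 := anti (show t1 - 1 ∈ Iic t' by simp; linarith [ht'.1]) (show t' ∈ Iic t' by simp)
      (by linarith [ht'.1])
    have h2 : Real.exp (μ * (t1 - 1)) * (w (t1-1) - m / μ) < 0 := by
      refine mul_neg_of_pos_of_neg (Real.exp_pos _) ?_
      have : 0 < m / μ := by positivity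
      have : w (t1 - 1) < 0 := by simp only [hw]; linarith [hfirst (t1-1) (by linarith)]
      linarith
    have h3 : w t' - m / μ < 0 := by
      by_contra h; push Not at h
      have := mul_nonneg (Real.exp_pos (μ * t')).le h
      simp only at h1
      linarith
    have h4 : m = f1 t' + μ * w t' := by rw [hm, hxt]
    have h5 : μ * (w t' - m / μ) = μ * w t' - m := by field_simp
    nlinarith [mul_neg_of_pos_of_neg hμ h3]
  have hmono : ∀ b, (∀ t ∈ Icc t1 b, 0 ≤ f1 t) → ∀ t ∈ Icc t1 b, κ ≤ f t := by
    intro b hb t ht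
    rw [← ht1']
    exact monotoneOn_of_hasDerivWithinAt_nonneg (convex_Icc t1 b) S.t2.c0.continuousOn
      (fun t _ => (S.t2.d1 t).hasDerivWithinAt) (fun t ht => hb t (interior_subset ht))
      ⟨le_rfl, ht.1.trans ht.2⟩ ht ht.1
  set d := f1 (t1 + τ) with hd
  have hd0 : 0 < d := key _ ⟨by linarith [M.hτ], le_rfl⟩
  have hfar : ∀ t ≥ t1 + τ, d / 2 < f1 t := by
    by_contra h; push Not at h
    obtain ⟨r, hr, hr'⟩ := h
    obtain ⟨t3, ht3, hf3⟩ := first_time (S := {t | t1 + τ ≤ t ∧ f1 t ≤ d / 2})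
      ((isClosed_le continuous_const continuous_id).inter (isClosed_le S.t2.c1 continuous_const))
      ⟨r, hr, hr'⟩ ⟨t1 + τ, fun s hs => hs.1⟩
    have hp : ∀ t ∈ Icc t1 t3, t < t3 → 0 ≤ f1 t := fun t ht h => by
      rcases le_total t (t1 + τ) with h1 | h1
      · exact (key t ⟨ht.1, h1⟩).le
      · by_contra h2; exact hf3 t h ⟨h1, by linarith⟩
    have hk : ∀ t ∈ Icc t1 t3, κ ≤ f t := by
      intro t ht
      rw [← ht1']
      exact monotoneOn_of_hasDerivWithinAt_nonneg (convex_Icc t1 t3) S.t2.c0.continuousOn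
        (fun t _ => (S.t2.d1 t).hasDerivWithinAt)
        (fun t ht => by rw [interior_Icc] at ht; exact hp t ⟨ht.1.le, ht.2.le⟩ ht.2)
        ⟨le_rfl, ht.1.trans ht.2⟩ ht ht.1
    have := monotoneOn_of_hasDerivWithinAt_nonneg (convex_Icc (t1 + τ) t3) S.t2.c1.continuousOn
        (fun t _ => (S.t2.d2 t).hasDerivWithinAt)
        (fun t ht => by
          rw [interior_Icc] at ht
          have h1 := hk t ⟨by linarith [M.hτ, ht.1], ht.2.le⟩
          have h2 := G.big _ (hk (t - τ) ⟨by linarith [ht.1], by linarith [ht.2, M.hτ]⟩)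
          have h3 := hp t ⟨by linarith [M.hτ, ht.1], ht.2.le⟩ ht.2
          nlinarith [S.eq t])
        ⟨le_rfl, ht3.1⟩ ⟨ht3.1, le_rfl⟩ ht3.1
    linarith [ht3.2]
  refine S.ninf (tendsto_atTop_mono' (f₁ := fun t => f (t1 + τ) + d / 2 * (t - (t1 + τ))) atTop ?_ ?_)
  · filter_upwards [eventually_gt_atTop (t1 + τ)] with t ht
    obtain ⟨x, hx, e⟩ := mvt S.t2.d1 ht
    have := hfar x hx.1.le
    nlinarith
  · exact tendsto_atTop_add_const_left _ _ ((tendsto_atTop_add_const_right _ (-(t1+τ)) tendsto_id).const_mul_atTop (by positivity))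


def PP (ν : ℝ) (f : ℝ → ℝ) (t : ℝ) : ℝ := Real.exp (ν * t) * ∫ s in Ioi t, Real.exp (-ν * s) * f s

def JJ (μ : ℝ) (f : ℝ → ℝ) (t : ℝ) : ℝ := PP μ (fun s => f (-s)) (-t)

def BM (B : ℝ) (f : ℝ → ℝ) : Prop := Measurable f ∧ ∀ t, |f t| ≤ B

lemma BM.neg {B : ℝ} {f : ℝ → ℝ} (h : BM B f) : BM B (fun s => f (-s)) :=
  ⟨h.1.comp measurable_neg, fun t => h.2 (-t)⟩

lemma BM.int {B ν : ℝ} (hν : 0 < ν) {f : ℝ → ℝ} (h : BM B f) (t : ℝ) :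
    MeasureTheory.IntegrableOn (fun s => Real.exp (-ν * s) * f s) (Ioi t) := by
  refine MeasureTheory.Integrable.mul_bdd (c := B) (integrableOn_exp_mul_Ioi (by linarith) t)
    h.1.aestronglyMeasurable (Eventually.of_forall h.2)

lemma PP_sub_anti {B B' ν : ℝ} (hν : 0 < ν) {f f' : ℝ → ℝ} (h : BM B f) (h' : BM B' f')
    (hle : ∀ t, f t ≤ f' t) : Antitone (fun t => Real.exp (-ν * t) * (PP ν f' t - PP ν f t)) := by
  have e : ∀ t, Real.exp (-ν * t) * (PP ν f' t - PP ν f t) =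
      ∫ s in Ioi t, (Real.exp (-ν * s) * f' s - Real.exp (-ν * s) * f s) := by
    intro t
    rw [MeasureTheory.integral_sub (h'.int hν t) (h.int hν t)]
    unfold PP
    have : Real.exp (-ν * t) * Real.exp (ν * t) = 1 := by rw [← Real.exp_add]; simp
    linear_combination ((∫ s in Ioi t, Real.exp (-ν * s) * f' s) - ∫ s in Ioi t, Real.exp (-ν * s) * f s) * this
  intro a b hab
  simp only [e]
  refine MeasureTheory.setIntegral_mono_set ((h'.int hν a).sub (h.int hν a))
    (Eventually.of_forall fun s => ?_) (Ioi_subset_Ioi hab).eventuallyLE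
  have := mul_le_mul_of_nonneg_left (hle s) (Real.exp_pos (-ν * s)).le
  simp only [Pi.zero_apply]; linarith

lemma PP_mono {B B' ν : ℝ} (hν : 0 < ν) {f f' : ℝ → ℝ} (h : BM B f) (h' : BM B' f')
    (hle : ∀ t, f t ≤ f' t) (t : ℝ) : PP ν f t ≤ PP ν f' t := by
  refine mul_le_mul_of_nonneg_left ?_ (Real.exp_pos _).le
  exact MeasureTheory.setIntegral_mono (h.int hν t) (h'.int hν t)
    fun s => mul_le_mul_of_nonneg_left (hle s) (Real.exp_pos _).le

lemma PP_const {ν : ℝ} (hν : 0 < ν) (m t : ℝ) : PP ν (fun _ => m) t = m / ν := by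
  unfold PP
  rw [MeasureTheory.integral_mul_const, integral_exp_mul_Ioi (by linarith)]
  have : Real.exp (ν * t) * Real.exp (-ν * t) = 1 := by rw [← Real.exp_add]; simp
  rw [neg_mul] at this ⊢
  field_simp
  linear_combination m * this

lemma PP_shift (ν : ℝ) (f : ℝ → ℝ) (r t : ℝ) : PP ν (fun s => f (s + r)) t = PP ν f (t + r) := by
  unfold PP
  have h1 := (MeasureTheory.measurePreserving_add_right MeasureTheory.volume r).setIntegral_preimage_emb
    (measurableEmbedding_addRight r) (fun s => Real.exp (-ν * s) * f s) (Ioi (t + r))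
  rw [← h1]
  have : (fun x => x + r) ⁻¹' Ioi (t + r) = Ioi t := by ext x; simp
  rw [this, ← MeasureTheory.integral_const_mul, ← MeasureTheory.integral_const_mul]
  congr 1
  ext s
  rw [← mul_assoc, ← mul_assoc, ← Real.exp_add, ← Real.exp_add]
  congr 2; ring

lemma PP_prim {B ν : ℝ} (hν : 0 < ν) {f : ℝ → ℝ} (h : BM B f) : PP ν f = fun t =>
    Real.exp (ν * t) * ((∫ s in Ioi 0, Real.exp (-ν * s) * f s) - ∫ s in (0:ℝ)..t, Real.exp (-ν * s) * f s) := by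
  ext t
  unfold PP
  rw [← intervalIntegral.integral_Ioi_sub_Ioi' (h.int hν 0) (h.int hν t)]
  ring

lemma PP_cont {B ν : ℝ} (hν : 0 < ν) {f : ℝ → ℝ} (h : BM B f) : Continuous (PP ν f) := by
  rw [PP_prim hν h]
  refine Continuous.mul (by fun_prop) (continuous_const.sub
    (intervalIntegral.continuous_primitive (fun a b => ?_) 0))
  rw [intervalIntegrable_iff]
  exact (h.int hν (min a b)).mono_set fun x hx => hx.1

lemma PP_deriv {B ν : ℝ} (hν : 0 < ν) {f : ℝ → ℝ} (h : BM B f) (hc : Continuous f) (t : ℝ) :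
    HasDerivAt (PP ν f) (ν * PP ν f t - f t) t := by
  have hcont : Continuous fun s => Real.exp (-ν * s) * f s := by fun_prop
  have h1 := hasDerivAt_expmul ν ((hcont.integral_hasStrictDerivAt 0 t).hasDerivAt.const_sub
    (∫ s in Ioi 0, Real.exp (-ν * s) * f s))
  rw [PP_prim hν h]
  refine h1.congr_deriv ?_
  have : Real.exp (ν * t) * Real.exp (-ν * t) = 1 := by rw [← Real.exp_add]; simp
  linear_combination -f t * this

lemma PP_mono_t {B ν : ℝ} (hν : 0 < ν) {f : ℝ → ℝ} (h : BM B f) (hm : Monotone f) : Monotone (PP ν f) := by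
  intro a b hab
  have h1 := PP_shift ν f (b - a) a
  rw [show a + (b - a) = b by ring] at h1
  rw [← h1]
  exact PP_mono hν h ⟨h.1.comp (measurable_id.add_const _), fun t => h.2 _⟩
    (fun t => hm (by simp only [id]; linarith)) a

lemma PP_bdd {B ν : ℝ} (hν : 0 < ν) {f : ℝ → ℝ} (h : BM B f) (t : ℝ) : |PP ν f t| ≤ B / ν := by
  have c : ∀ m : ℝ, BM |m| (fun _ => m) := fun m => ⟨measurable_const, fun t => le_rfl⟩
  rw [abs_le, ← neg_div, ← PP_const hν, ← PP_const hν]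
  exact ⟨PP_mono hν (c _) h (fun t => (abs_le.1 (h.2 t)).1) t,
    PP_mono hν h (c _) (fun t => (abs_le.1 (h.2 t)).2) t⟩

lemma JJ_sub_mono {B B' ν : ℝ} (hν : 0 < ν) {f f' : ℝ → ℝ} (h : BM B f) (h' : BM B' f')
    (hle : ∀ t, f t ≤ f' t) : Monotone (fun t => Real.exp (ν * t) * (JJ ν f' t - JJ ν f t)) := by
  intro a b hab
  have := PP_sub_anti hν h.neg h'.neg (fun t => hle (-t)) (neg_le_neg hab)
  simpa [JJ] using this

lemma JJ_mono {B B' ν : ℝ} (hν : 0 < ν) {f f' : ℝ → ℝ} (h : BM B f) (h' : BM B' f')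
    (hle : ∀ t, f t ≤ f' t) (t : ℝ) : JJ ν f t ≤ JJ ν f' t :=
  PP_mono hν h.neg h'.neg (fun t => hle (-t)) (-t)

lemma JJ_const {ν : ℝ} (hν : 0 < ν) (m t : ℝ) : JJ ν (fun _ => m) t = m / ν := PP_const hν m (-t)

lemma JJ_shift (ν : ℝ) (f : ℝ → ℝ) (r t : ℝ) : JJ ν (fun s => f (s + r)) t = JJ ν f (t + r) := by
  unfold JJ
  rw [show -(t + r) = -t + -r by ring, ← PP_shift]
  congr 1; ext s; ring_nf

lemma JJ_cont {B ν : ℝ} (hν : 0 < ν) {f : ℝ → ℝ} (h : BM B f) : Continuous (JJ ν f) :=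
  (PP_cont hν h.neg).comp continuous_neg

lemma JJ_deriv {B ν : ℝ} (hν : 0 < ν) {f : ℝ → ℝ} (h : BM B f) (hc : Continuous f) (t : ℝ) :
    HasDerivAt (JJ ν f) (f t - ν * JJ ν f t) t := by
  have h1 := (PP_deriv hν h.neg (hc.comp continuous_neg) (-t)).scomp t (hasDerivAt_neg t)
  refine h1.congr_deriv ?_
  simp [JJ]

lemma JJ_mono_t {B ν : ℝ} (hν : 0 < ν) {f : ℝ → ℝ} (h : BM B f) (hm : Monotone f) : Monotone (JJ ν f) := by
  intro a b hab
  have h1 := JJ_shift ν f (b - a) a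
  rw [show a + (b - a) = b by ring] at h1
  rw [← h1]
  exact JJ_mono hν h ⟨h.1.comp (measurable_id.add_const _), fun t => h.2 _⟩
    (fun t => hm (by simp only [id]; linarith)) a



def a0 (t : ℝ) : ℝ := max 0 (min t 1)

lemma a0_mono : Monotone a0 := fun _ _ h => max_le_max le_rfl (min_le_min h le_rfl)
lemma a0_cont : Continuous a0 := continuous_const.max (continuous_id.min continuous_const)
lemma a0_rng (t : ℝ) : 0 ≤ a0 t ∧ a0 t ≤ 1 := ⟨le_max_left _ _, max_le zero_le_one (min_le_right _ _)⟩

def KK (μ τ : ℝ) (ψ : ℝ → ℝ) (s : ℝ) : ℝ := Real.exp (μ * τ) * JJ μ ψ s - JJ μ ψ (s - τ)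

def ZZ (μ τ k : ℝ) (ψ : ℝ → ℝ) (s : ℝ) : ℝ := max (k * a0 (s - τ)) (JJ μ ψ (s - τ))

def HH (g : ℝ → ℝ) (q μ τ k : ℝ) (ψ : ℝ → ℝ) (s : ℝ) : ℝ :=
  (g (ZZ μ τ k ψ s) + q * ZZ μ τ k ψ s) + q * KK μ τ ψ s

def Cls (μ κ : ℝ) (χ : ℝ → ℝ) : Prop := Monotone χ ∧ ∀ t, χ t ∈ Icc 0 (μ * κ)

lemma Cls.bm {μ κ : ℝ} {χ : ℝ → ℝ} (h : Cls μ κ χ) : BM (μ * κ) χ :=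
  ⟨h.1.measurable, fun t => by rw [abs_of_nonneg (h.2 t).1]; exact (h.2 t).2⟩

lemma Cls.const {μ κ m : ℝ} (h : m ∈ Icc 0 (μ * κ)) : Cls μ κ (fun _ => m) :=
  ⟨monotone_const, fun _ => h⟩

lemma Cls.jrng {μ κ : ℝ} (hμ : 0 < μ) (hκ : 0 < κ) {χ : ℝ → ℝ} (h : Cls μ κ χ) (t : ℝ) :
    JJ μ χ t ∈ Icc 0 κ := by
  have hk : 0 ≤ μ * κ := by positivity
  have h1 := JJ_mono hμ (Cls.const (μ := μ) (κ := κ) ⟨le_rfl, hk⟩).bm h.bm (fun t => (h.2 t).1) t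
  have h2 := JJ_mono hμ h.bm (Cls.const (μ := μ) (κ := κ) ⟨hk, le_rfl⟩).bm (fun t => (h.2 t).2) t
  rw [JJ_const hμ] at h1 h2
  exact ⟨by simpa using h1, by rwa [mul_div_cancel_left₀ _ hμ.ne'] at h2⟩

lemma KK_mono {μ κ τ : ℝ} (hμ : 0 < μ) (hτ : 0 ≤ τ) {χ χ' : ℝ → ℝ} (h : Cls μ κ χ) (h' : Cls μ κ χ')
    (hle : ∀ t, χ t ≤ χ' t) (s : ℝ) : KK μ τ χ s ≤ KK μ τ χ' s := by
  have := exp_mono_shift hτ (JJ_sub_mono hμ h.bm h'.bm hle) s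
  unfold KK; linarith

lemma KK_shift (μ τ r : ℝ) (χ : ℝ → ℝ) (s : ℝ) : KK μ τ (fun t => χ (t + r)) s = KK μ τ χ (s + r) := by
  unfold KK; rw [JJ_shift, JJ_shift]; ring_nf

lemma Cls.shift {μ κ : ℝ} {χ : ℝ → ℝ} (h : Cls μ κ χ) (r : ℝ) : Cls μ κ (fun t => χ (t + r)) :=
  ⟨fun _ _ hab => h.1 (by linarith), fun t => h.2 _⟩

section
variable {g : ℝ → ℝ} {κ q p L δ A γ ε0 c τ μ k : ℝ}

lemma ZZ_rng (G : GH g κ q p L δ A γ ε0) (M : MU q c τ μ) (hk : k ∈ Icc 0 κ) {χ : ℝ → ℝ}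
    (h : Cls μ κ χ) (s : ℝ) : ZZ μ τ k χ s ∈ Icc 0 κ := by
  have := h.jrng M.hμ G.hκ (s - τ)
  have h2 := a0_rng (s - τ)
  exact ⟨le_max_of_le_right this.1, max_le (by nlinarith [hk.1, hk.2]) this.2⟩

lemma HH_mono (G : GH g κ q p L δ A γ ε0) (M : MU q c τ μ) (hk : k ∈ Icc 0 κ) {χ χ' : ℝ → ℝ}
    (h : Cls μ κ χ) (h' : Cls μ κ χ') (hle : ∀ t, χ t ≤ χ' t) (s : ℝ) :
    HH g q μ τ k χ s ≤ HH g q μ τ k χ' s := by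
  have h1 := G.mono _ _ (ZZ_rng G M hk h s).1
    (max_le_max le_rfl (JJ_mono M.hμ h.bm h'.bm hle (s - τ)) : ZZ μ τ k χ s ≤ ZZ μ τ k χ' s)
    (ZZ_rng G M hk h' s).2
  have h2 := mul_le_mul_of_nonneg_left (KK_mono M.hμ M.hτ h h' hle s) G.hq.le
  unfold HH; unfold ZZ at *; linarith

lemma HH_mono_t (G : GH g κ q p L δ A γ ε0) (M : MU q c τ μ) (hk : k ∈ Icc 0 κ) {χ : ℝ → ℝ}
    (h : Cls μ κ χ) : Monotone (HH g q μ τ k χ) := by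
  intro a b hab
  have h1 := G.mono _ _ (ZZ_rng G M hk h a).1
    (max_le_max (mul_le_mul_of_nonneg_left (a0_mono (by linarith)) hk.1)
      (JJ_mono_t M.hμ h.bm h.1 (by linarith)) : ZZ μ τ k χ a ≤ ZZ μ τ k χ b)
    (ZZ_rng G M hk h b).2
  have h2 := mul_le_mul_of_nonneg_left (KK_mono M.hμ M.hτ h (h.shift (b - a))
    (fun t => h.1 (by linarith)) a) G.hq.le
  rw [KK_shift, show a + (b - a) = b by ring] at h2
  unfold HH; unfold ZZ at *; linarith

lemma HH_cont (G : GH g κ q p L δ A γ ε0) (M : MU q c τ μ) {χ : ℝ → ℝ}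
    (h : Cls μ κ χ) : Continuous (HH g q μ τ k χ) := by
  have h1 := JJ_cont M.hμ h.bm
  have h2 := a0_cont
  have h3 := G.cont
  unfold HH KK ZZ
  fun_prop

lemma HH_rng (G : GH g κ q p L δ A γ ε0) (M : MU q c τ μ) (hk : k ∈ Icc 0 κ) {χ : ℝ → ℝ}
    (h : Cls μ κ χ) (s : ℝ) : HH g q μ τ k χ s ∈ Icc 0 (μ * κ * (μ + c)) := by
  have hμ := M.hμ
  have hκ := G.hκ
  have hm : 0 ≤ μ * κ := by positivity
  have h1 := HH_mono G M hk (Cls.const (μ := μ) (κ := κ) ⟨le_rfl, hm⟩) h (fun t => (h.2 t).1) s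
  have h2 := HH_mono G M hk h (Cls.const (μ := μ) (κ := κ) ⟨hm, le_rfl⟩) (fun t => (h.2 t).2) s
  constructor
  · refine le_trans ?_ h1
    have h3 := G.mono _ _ le_rfl (ZZ_rng G M hk (Cls.const (μ := μ) (κ := κ) ⟨le_rfl, hm⟩) s).1
      (ZZ_rng G M hk (Cls.const (μ := μ) (κ := κ) ⟨le_rfl, hm⟩) s).2
    rw [G.g0] at h3
    unfold HH KK
    rw [JJ_const hμ, JJ_const hμ]
    simp at h3 ⊢
    linarith
  · refine h2.trans (le_of_eq ?_)
    have : ZZ μ τ k (fun _ => μ * κ) s = κ := by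
      unfold ZZ; rw [JJ_const hμ, mul_div_cancel_left₀ _ hμ.ne']
      have := a0_rng (s - τ)
      exact max_eq_right (by nlinarith [hk.1, hk.2])
    unfold HH KK
    rw [this, JJ_const hμ, JJ_const hμ, mul_div_cancel_left₀ _ hμ.ne', G.gκ]
    linear_combination -κ * M.eq

lemma HH_bm (G : GH g κ q p L δ A γ ε0) (M : MU q c τ μ) (hk : k ∈ Icc 0 κ) {χ : ℝ → ℝ}
    (h : Cls μ κ χ) : BM (μ * κ * (μ + c)) (HH g q μ τ k χ) :=
  ⟨(HH_cont G M h).measurable, fun t => by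
    rw [abs_of_nonneg (HH_rng G M hk h t).1]; exact (HH_rng G M hk h t).2⟩

lemma FF_cls (G : GH g κ q p L δ A γ ε0) (M : MU q c τ μ) (hk : k ∈ Icc 0 κ) {χ : ℝ → ℝ}
    (h : Cls μ κ χ) : Cls μ κ (PP (μ + c) (HH g q μ τ k χ)) := by
  have hν : 0 < μ + c := add_pos M.hμ M.hc
  refine ⟨PP_mono_t hν (HH_bm G M hk h) (HH_mono_t G M hk h), fun t => ⟨?_, ?_⟩⟩
  · have := PP_mono hν (f := fun _ => 0) (B := 0) ⟨measurable_const, by simp⟩ (HH_bm G M hk h)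
      (fun t => (HH_rng G M hk h t).1) t
    rw [PP_const hν] at this; simpa using this
  · have := (abs_le.1 (PP_bdd hν (HH_bm G M hk h) t)).2
    rwa [mul_div_cancel_right₀ _ hν.ne'] at this

lemma exists_fix (G : GH g κ q p L δ A γ ε0) (M : MU q c τ μ) (hk : k ∈ Icc 0 κ) :
    ∃ ψ, Cls μ κ ψ ∧ PP (μ + c) (HH g q μ τ k ψ) = ψ ∧
      ∀ χ, Cls μ κ χ → (∀ t, PP (μ + c) (HH g q μ τ k χ) t ≤ χ t) → ∀ t, ψ t ≤ χ t := by
  have hν : 0 < μ + c := add_pos M.hμ M.hc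
  have hm : 0 ≤ μ * κ := mul_nonneg M.hμ.le G.hκ.le
  set F := fun χ => PP (μ + c) (HH g q μ τ k χ) with hF
  set S := {χ : ℝ → ℝ | Cls μ κ χ ∧ ∀ t, F χ t ≤ χ t} with hS
  have hFm : ∀ χ χ', Cls μ κ χ → Cls μ κ χ' → (∀ t, χ t ≤ χ' t) → ∀ t, F χ t ≤ F χ' t :=
    fun χ χ' h h' hle t => PP_mono hν (HH_bm G M hk h) (HH_bm G M hk h') (HH_mono G M hk h h' hle) t
  have hne : (fun _ => μ * κ) ∈ S := ⟨Cls.const ⟨hm, le_rfl⟩, fun t =>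
    ((FF_cls G M hk (Cls.const ⟨hm, le_rfl⟩)).2 t).2⟩
  have : Nonempty S := ⟨⟨_, hne⟩⟩
  set ψ : ℝ → ℝ := fun t => ⨅ χ : S, χ.1 t with hψ
  have bb : ∀ t, BddBelow (range fun χ : S => χ.1 t) := fun t =>
    ⟨0, by rintro _ ⟨χ, rfl⟩; exact (χ.2.1.2 t).1⟩
  have hle : ∀ χ ∈ S, ∀ t, ψ t ≤ χ t := fun χ hχ t => ciInf_le (bb t) ⟨χ, hχ⟩
  have hcls : Cls μ κ ψ := ⟨fun a b hab => le_ciInf fun χ => (hle χ.1 χ.2 a).trans (χ.2.1.1 hab),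
    fun t => ⟨le_ciInf fun χ => (χ.2.1.2 t).1, hle _ hne t⟩⟩
  have h1 : ∀ t, F ψ t ≤ ψ t := fun t => le_ciInf fun χ =>
    (hFm ψ χ.1 hcls χ.2.1 (hle χ.1 χ.2) t).trans (χ.2.2 t)
  have h2 : F ψ ∈ S := ⟨FF_cls G M hk hcls, hFm _ _ (FF_cls G M hk hcls) hcls h1⟩
  exact ⟨ψ, hcls, funext fun t => le_antisymm (h1 t) (hle _ h2 t), fun χ h h' => hle χ ⟨h, h'⟩⟩

lemma dom_aux (G : GH g κ q p L δ A γ ε0) (M : MU q c τ μ) (hk : k ∈ Icc 0 κ)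
    {Φ Φ1 Φ2 : ℝ → ℝ} (H : T2 Φ Φ1 Φ2) (hl : Tendsto Φ atBot (nhds 0))
    (hX : ∀ t, 0 ≤ Φ1 t + μ * Φ t) (ha : ∀ t, k * a0 t ≤ Φ t)
    (hD : ∀ t, Φ2 t - c * Φ1 t - Φ t - q * Φ (t - τ) ≤
      -(g (min (Φ (t - τ)) κ) + q * min (Φ (t - τ)) κ)) :
    ∃ χ, Cls μ κ χ ∧ (∀ t, PP (μ + c) (HH g q μ τ k χ) t ≤ χ t) ∧ ∀ t, JJ μ χ t ≤ Φ t := by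
  have hμ := M.hμ
  have hν : 0 < μ + c := add_pos M.hμ M.hc
  have hm : 0 ≤ μ * κ := mul_nonneg M.hμ.le G.hκ.le
  set Y : ℝ → ℝ := fun t => min (Φ1 t + μ * Φ t) (μ * κ) with hY
  have hY0 : ∀ t, 0 ≤ Y t := fun t => le_min (hX t) hm
  have hYc : Continuous Y := (H.c1.add (continuous_const.mul H.c0)).min continuous_const
  have hYb : BM (μ * κ) Y := ⟨hYc.measurable, fun t => by
    rw [abs_of_nonneg (hY0 t)]; exact min_le_right _ _⟩
  set χ : ℝ → ℝ := fun t => ⨅ s : Ici t, Y s.1 with hχ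
  have bb : ∀ t, BddBelow (range fun s : Ici t => Y s.1) := fun t =>
    ⟨0, by rintro _ ⟨s, rfl⟩; exact hY0 _⟩
  have hle : ∀ t s, t ≤ s → χ t ≤ Y s := fun t s hs => ciInf_le (bb t) ⟨s, hs⟩
  have hcls : Cls μ κ χ := ⟨fun a b hab => le_ciInf fun s => hle a s.1 (hab.trans s.2),
    fun t => ⟨le_ciInf fun s => hY0 _, (hle t t le_rfl).trans (min_le_right _ _)⟩⟩
  have m1 : Monotone (fun t => Real.exp (μ * t) * (Φ t - JJ μ Y t)) := by
    rw [← monotoneOn_univ]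
    refine exp_mono (f := fun t => Φ t - JJ μ Y t) (f' := fun t => Φ1 t - (Y t - μ * JJ μ Y t))
      convex_univ μ (fun t _ => (H.d1 t).sub (JJ_deriv hμ hYb hYc t)) fun t _ => ?_
    have := min_le_left (Φ1 t + μ * Φ t) (μ * κ)
    simp only [hY]; linarith
  have m2 := JJ_sub_mono hμ hcls.bm hYb (fun t => hle t t le_rfl)
  have m3 : Monotone (fun t => Real.exp (μ * t) * (Φ t - JJ μ χ t)) := fun a b hab => by
    have := m1 hab
    have := m2 hab
    simp only at *; linarith
  have hJ : ∀ t, JJ μ χ t ≤ Φ t := by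
    intro t
    have lim : Tendsto (fun t => Real.exp (μ * t) * (Φ t - JJ μ χ t)) atBot (nhds 0) := by
      have l1 := (tendsto_exp_mul_atBot hμ).mul hl
      have l2 := tendsto_zero_mul_bdd (tendsto_exp_mul_atBot hμ) (f := JJ μ χ) (B := κ) (fun t => by
        rw [abs_of_nonneg (hcls.jrng hμ G.hκ t).1]; exact (hcls.jrng hμ G.hκ t).2)
      have := l1.sub l2
      simp only [mul_zero, sub_zero] at this
      exact this.congr fun t => by ring
    have h1 := m3.le_of_tendsto lim t
    linarith [nonneg_of_mul_nonneg_right h1 (Real.exp_pos _)]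
  refine ⟨χ, hcls, ?_, hJ⟩
  have hbm := HH_bm G M hk hcls
  have anti : Antitone (fun t => Real.exp (-(μ + c) * t) *
      ((Φ1 t + μ * Φ t) - PP (μ + c) (HH g q μ τ k χ) t)) := by
    rw [← antitoneOn_univ]
    refine exp_anti (f := fun t => (Φ1 t + μ * Φ t) - PP (μ + c) (HH g q μ τ k χ) t)
      (f' := fun t => (Φ2 t + μ * Φ1 t) -
        ((μ + c) * PP (μ + c) (HH g q μ τ k χ) t - HH g q μ τ k χ t)) convex_univ _
      (fun t _ => ((H.d2 t).add ((H.d1 t).const_mul μ)).sub (PP_deriv hν hbm (HH_cont G M hcls) t))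
      (fun t _ => ?_)
    have e1 := exp_mono_shift M.hτ m3 t
    have hz : ZZ μ τ k χ t ≤ min (Φ (t - τ)) κ :=
      le_min (max_le (ha _) (hJ _)) (ZZ_rng G M hk hcls t).2
    have e2 := G.mono _ _ (ZZ_rng G M hk hcls t).1 hz (min_le_right _ _)
    have e3 := mul_le_mul_of_nonneg_left e1 G.hq.le
    have e4 : Φ2 t + μ * Φ1 t + (-(μ + c) * (Φ1 t + μ * Φ t)) =
        (Φ2 t - c * Φ1 t - Φ t - q * Φ (t - τ)) + q * (Φ (t - τ) - Real.exp (μ * τ) * Φ t) := by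
      linear_combination (-Φ t) * M.eq
    have e5 : HH g q μ τ k χ t = (g (ZZ μ τ k χ t) + q * ZZ μ τ k χ t) +
      q * (Real.exp (μ * τ) * JJ μ χ t - JJ μ χ (t - τ)) := rfl
    nlinarith [hD t]
  have hX' : ∀ t, PP (μ + c) (HH g q μ τ k χ) t ≤ Φ1 t + μ * Φ t := by
    intro t
    by_contra hcon; push Not at hcon
    set d := Real.exp (-(μ + c) * t) * ((Φ1 t + μ * Φ t) - PP (μ + c) (HH g q μ τ k χ) t) with hd
    have hd0 : d < 0 := mul_neg_of_pos_of_neg (Real.exp_pos _) (by linarith)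
    have lim := (tendsto_zero_mul_bdd (tendsto_exp_neg_mul_atTop hν) (PP_bdd hν hbm)).neg
    rw [neg_zero] at lim
    have : (0:ℝ) ≤ d := le_of_tendsto lim ((eventually_ge_atTop t).mono fun s hs => by
      have h1 := anti hs
      have h2 := mul_nonneg (Real.exp_pos (-(μ + c) * s)).le (hX s)
      simp only at h1
      rw [hd]; linarith)
    linarith
  have fcls := FF_cls G M hk hcls
  intro t
  exact le_ciInf fun s => (fcls.1 s.2).trans (le_min (hX' _) (fcls.2 _).2)

lemma exists_phi (G : GH g κ q p L δ A γ ε0) (M : MU q c τ μ) (hk : k ∈ Icc 0 κ) :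
    ∃ φ φ1 φ2 : ℝ → ℝ, T2 φ φ1 φ2 ∧ Monotone φ ∧ (∀ t, φ t ∈ Icc 0 κ) ∧
      (∀ t, φ2 t - c * φ1 t - φ t - q * φ (t - τ) =
        -(g (max (k * a0 (t - τ)) (φ (t - τ))) + q * max (k * a0 (t - τ)) (φ (t - τ)))) ∧
      ∀ Φ Φ1 Φ2 : ℝ → ℝ, T2 Φ Φ1 Φ2 → Tendsto Φ atBot (nhds 0) →
        (∀ t, 0 ≤ Φ1 t + μ * Φ t) → (∀ t, k * a0 t ≤ Φ t) →
        (∀ t, Φ2 t - c * Φ1 t - Φ t - q * Φ (t - τ) ≤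
          -(g (min (Φ (t - τ)) κ) + q * min (Φ (t - τ)) κ)) → ∀ t, φ t ≤ Φ t := by
  have hν : 0 < μ + c := add_pos M.hμ M.hc
  obtain ⟨ψ, hc, hfix, hmin⟩ := exists_fix G M hk
  have hψc : Continuous ψ := by rw [← hfix]; exact PP_cont hν (HH_bm G M hk hc)
  have d0 := JJ_deriv M.hμ hc.bm hψc
  have d1 : ∀ t, HasDerivAt ψ ((μ + c) * ψ t - HH g q μ τ k ψ t) t := fun t => by
    have := PP_deriv hν (HH_bm G M hk hc) (HH_cont G M hc) t
    rwa [hfix] at this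
  refine ⟨JJ μ ψ, fun t => ψ t - μ * JJ μ ψ t, fun t => ((μ + c) * ψ t - HH g q μ τ k ψ t) -
    μ * (ψ t - μ * JJ μ ψ t), ⟨d0, fun t => (d1 t).sub ((d0 t).const_mul μ)⟩,
    JJ_mono_t M.hμ hc.bm hc.1, hc.jrng M.hμ G.hκ, fun t => ?_, ?_⟩
  · unfold HH KK ZZ
    linear_combination JJ μ ψ t * M.eq
  · intro Φ Φ1 Φ2 H hl hX ha hD t
    obtain ⟨χ, h1, h2, h3⟩ := dom_aux G M hk H hl hX ha hD
    exact (JJ_mono M.hμ hc.bm h1.bm (hmin χ h1 h2) t).trans (h3 t)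
end


structure Sol (g : ℝ → ℝ) (κ c τ : ℝ) (f f1 f2 : ℝ → ℝ) : Prop where
  t2 : T2 f f1 f2
  rng : ∀ t, f t ∈ Icc 0 κ
  eq : ∀ t, f2 t - c * f1 t - f t + g (f (t - τ)) = 0

structure Front (g : ℝ → ℝ) (κ c τ : ℝ) (f f1 f2 : ℝ → ℝ) : Prop where
  t2 : T2 f f1 f2
  pos : ∀ t, 0 < f t
  eq : ∀ t, f2 t - c * f1 t - f t + g (f (t - τ)) = 0
  lim0 : Tendsto f atBot (nhds 0)
  limκ : Tendsto f atTop (nhds κ)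

section
variable {g : ℝ → ℝ} {κ q p L δ A γ ε0 c τ μ h : ℝ} {f f1 f2 u u1 u2 v v1 v2 : ℝ → ℝ}

lemma Front.sw (hκ : 0 < κ) (F : Front g κ c τ f f1 f2) : SW g c τ f f1 f2 :=
  ⟨F.t2, F.pos, F.eq, F.lim0, ⟨κ / 2, by linarith, (F.limκ.eventually (lt_mem_nhds
    (show κ / 2 < κ by linarith))).mono fun _ h => h.le⟩, not_tendsto_atTop_of_tendsto_nhds F.limκ⟩

lemma SW.sol (G : GH g κ q p L δ A γ ε0) (M : MU q c τ μ) (F : SW g c τ f f1 f2) :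
    Sol g κ c τ f f1 f2 := ⟨F.t2, fun t => ⟨(F.pos t).le, (F.lt G M t).le⟩, F.eq⟩

lemma Front.sol (G : GH g κ q p L δ A γ ε0) (M : MU q c τ μ) (F : Front g κ c τ f f1 f2) :
    Sol g κ c τ f f1 f2 := (F.sw G.hκ).sol G M

lemma Front.shift (F : Front g κ c τ f f1 f2) (s : ℝ) :
    Front g κ c τ (fun t => f (t + s)) (fun t => f1 (t + s)) (fun t => f2 (t + s)) :=
  ⟨F.t2.shift s, fun t => F.pos _, fun t => by
    have := F.eq (t + s); rwa [show t + s - τ = t - τ + s by ring] at this,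
   F.lim0.comp (tendsto_atBot_add_const_right _ s tendsto_id),
   F.limκ.comp (tendsto_atTop_add_const_right _ s tendsto_id)⟩

lemma GH.gle (G : GH g κ q p L δ A γ ε0) {x : ℝ} (hx : x ∈ Icc 0 κ) : g x ≤ L * x := by
  have := G.lip x hx 0 ⟨le_rfl, G.hκ.le⟩
  rw [G.g0, sub_zero, sub_zero, abs_of_nonneg hx.1] at this
  exact (le_abs_self _).trans this

lemma GH.gb (G : GH g κ q p L δ A γ ε0) {x : ℝ} (hx : x ∈ Icc 0 κ) : |g x| ≤ L * κ := by
  rw [abs_of_nonneg (G.nonneg x hx.1)]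
  exact (G.gle hx).trans (mul_le_mul_of_nonneg_left hx.2 (by linarith [G.hL]))

lemma Sol.f1b (G : GH g κ q p L δ A γ ε0) (S : Sol g κ c τ f f1 f2) (t : ℝ) :
    |f1 t| ≤ 2 * κ + |c| * (2 * κ) + (κ + L * κ) := by
  have hb : ∀ t, |f t| ≤ κ := fun t => by rw [abs_of_nonneg (S.rng t).1]; exact (S.rng t).2
  refine S.t2.f1bdd c κ _ hb (fun t => ?_) t
  have h1 := S.eq t
  rw [show f2 t - c * f1 t = f t - g (f (t - τ)) by linarith]
  exact (abs_sub _ _).trans (add_le_add (hb t) (G.gb (S.rng _)))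

lemma zeroSol (G : GH g κ q p L δ A γ ε0) : Sol g κ c τ (fun _ => 0) (fun _ => 0) (fun _ => 0) :=
  ⟨⟨fun t => hasDerivAt_const _ _, fun t => hasDerivAt_const _ _⟩, fun t => ⟨le_rfl, G.hκ.le⟩,
    fun t => by simp [G.g0]⟩

lemma Sol.mpaux (G : GH g κ q p L δ A γ ε0) (U : Sol g κ c τ u u1 u2)
    (V : Sol g κ c τ v v1 v2) (hle : ∀ t, u t ≤ v t) :
    T2 (fun t => v t - u t) (fun t => v1 t - u1 t) (fun t => v2 t - u2 t) ∧
    (∀ t, |v t - u t| ≤ κ) ∧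
    (∀ t, |v1 t - u1 t| ≤ 2 * (2 * κ + |c| * (2 * κ) + (κ + L * κ))) ∧
    (∀ t, (v2 t - u2 t) - c * (v1 t - u1 t) - (v t - u t) - q * (v (t - τ) - u (t - τ)) ≤ 0) := by
  refine ⟨V.t2.sub U.t2, fun t => ?_, fun t => ?_, fun t => ?_⟩
  · rw [abs_of_nonneg (by linarith [hle t])]; linarith [(V.rng t).2, (U.rng t).1]
  · refine (abs_sub _ _).trans ?_
    linarith [V.f1b G t, U.f1b G t]
  · have := G.mono _ _ (U.rng (t - τ)).1 (hle (t - τ)) (V.rng (t - τ)).2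
    linarith [U.eq t, V.eq t]

lemma Sol.psi (G : GH g κ q p L δ A γ ε0) (M : MU q c τ μ) (U : Sol g κ c τ u u1 u2)
    (V : Sol g κ c τ v v1 v2) (hle : ∀ t, u t ≤ v t) (t : ℝ) :
    0 ≤ (v1 t - u1 t) + μ * (v t - u t) := by
  obtain ⟨h1, h2, h3, h4⟩ := U.mpaux G V hle
  exact M.mp h1 h2 h3 h4 t

lemma Sol.strong (G : GH g κ q p L δ A γ ε0) (M : MU q c τ μ) (U : Sol g κ c τ u u1 u2)
    (V : Sol g κ c τ v v1 v2) (hle : ∀ t, u t ≤ v t) {t0 : ℝ} (h0 : u t0 = v t0) (t : ℝ) :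
    u t = v t := by
  obtain ⟨h1, h2, h3, h4⟩ := U.mpaux G V hle
  have := M.smp h1 h2 h3 h4 (t0 := t0) (by simp [h0]) t
  linarith

lemma Sol.psi0 (G : GH g κ q p L δ A γ ε0) (M : MU q c τ μ) (V : Sol g κ c τ v v1 v2) (t : ℝ) :
    0 ≤ v1 t + μ * v t := by
  have := (zeroSol (c := c) (τ := τ) G).psi G M V (fun t => (V.rng t).1) t
  simpa using this

lemma Sol.flim (G : GH g κ q p L δ A γ ε0) (S : Sol g κ c τ f f1 f2) {l : Filter ℝ} [l.NeBot] (hl : SL l)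
    (hτ : Tendsto (fun t => t - τ) l l) {a : ℝ} (hf : Tendsto f l (nhds a)) : a = 0 ∨ a = κ := by
  have ha : a ∈ Icc 0 κ := isClosed_Icc.mem_of_tendsto hf (Eventually.of_forall S.rng)
  refine G.fixp a ha ?_
  have h1 : Tendsto (fun t => f2 t - c * f1 t) l (nhds (a - g a)) :=
    (hf.sub ((G.cont.tendsto a).comp (hf.comp hτ))).congr fun t => by
      simp only [Function.comp]; linarith [S.eq t]
  linarith [S.t2.lim hl hf h1]

lemma Sol.front (G : GH g κ q p L δ A γ ε0) (M : MU q c τ μ) (S : Sol g κ c τ f f1 f2)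
    (hm : Monotone f) (h0 : f 0 = κ / 2) : Front g κ c τ f f1 f2 := by
  have hκ := G.hκ
  have hb := tendsto_atBot_ciInf hm ⟨0, by rintro _ ⟨t, rfl⟩; exact (S.rng t).1⟩
  have ht := tendsto_atTop_ciSup hm ⟨κ, by rintro _ ⟨t, rfl⟩; exact (S.rng t).2⟩
  have h1 := S.flim G SLbot (tendsto_atBot_add_const_right _ (-τ) tendsto_id) hb
  have h2 := S.flim G SLtop (tendsto_atTop_add_const_right _ (-τ) tendsto_id) ht
  have h3 := hm.le_of_tendsto hb 0
  have h4 := hm.ge_of_tendsto ht 0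
  rw [h0] at h3 h4
  rcases h1 with h1 | h1
  swap
  · linarith
  rcases h2 with h2 | h2
  · linarith
  refine ⟨S.t2, fun t => lt_of_le_of_ne (S.rng t).1 fun h => ?_, S.eq, h1 ▸ hb, h2 ▸ ht⟩
  have := (zeroSol G).strong G M S (fun t => (S.rng t).1) h 0
  rw [h0] at this; linarith

lemma hasDerivAt_of_quad {f : ℝ → ℝ} {f' C t : ℝ} (h : ∀ s, |f (t + s) - f t - s * f'| ≤ C * s ^ 2) :
    HasDerivAt f f' t := by
  rw [hasDerivAt_iff_isLittleO_nhds_zero]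
  have h1 : (fun s => f (t + s) - f t - s • f') =O[nhds 0] fun s : ℝ => s ^ 2 := by
    refine Asymptotics.IsBigO.of_bound C (Eventually.of_forall fun s => ?_)
    simp only [smul_eq_mul, Real.norm_eq_abs, abs_of_nonneg (sq_nonneg s)]
    exact h s
  refine h1.trans_isLittleO ?_
  simpa using Asymptotics.isLittleO_pow_id (one_lt_two)

lemma lip_of_bdd {f f' : ℝ → ℝ} {C : ℝ} (hf : ∀ t, HasDerivAt f (f' t) t) (hC : ∀ t, |f' t| ≤ C)
    (x y : ℝ) : |f x - f y| ≤ C * |x - y| := by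
  have := convex_univ.norm_image_sub_le_of_norm_hasDerivWithin_le (f := f) (f' := f') (C := C)
    (fun t _ => (hf t).hasDerivWithinAt) (fun t _ => hC t) (mem_univ y) (mem_univ x)
  simpa using this

lemma taylor_aux {f f' : ℝ → ℝ} {C D t : ℝ} (hf : ∀ t, HasDerivAt f (f' t) t)
    (hC : ∀ x, |f' x - f' t| ≤ C * |x - t| + D) (s : ℝ) (hC0 : 0 ≤ C) :
    |f (t + s) - f t - s * f' t| ≤ C * s ^ 2 + D * |s| := by
  have : ∃ x, |x - t| ≤ |s| ∧ f (t + s) - f t = f' x * s := by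
    rcases lt_trichotomy s 0 with hs | hs | hs
    · obtain ⟨x, hx, e⟩ := mvt hf (show t + s < t by linarith)
      exact ⟨x, by rw [abs_of_neg hs, abs_le]; constructor <;> linarith [hx.1, hx.2], by linarith⟩
    · exact ⟨t, by simp, by simp [hs]⟩
    · obtain ⟨x, hx, e⟩ := mvt hf (show t < t + s by linarith)
      exact ⟨x, by rw [abs_of_pos hs, abs_le]; constructor <;> linarith [hx.1, hx.2], by linarith⟩
  obtain ⟨x, hx, e⟩ := this
  rw [e, show f' x * s - s * f' t = (f' x - f' t) * s by ring, abs_mul]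
  have h1 := mul_le_mul_of_nonneg_right (hC x) (abs_nonneg s)
  have h2 := mul_le_mul_of_nonneg_left hx hC0
  have h3 := mul_le_mul_of_nonneg_right h2 (abs_nonneg s)
  have : |s| * |s| = s ^ 2 := by rw [← sq, sq_abs]
  nlinarith

lemma compact_lim {b : ℕ → ℝ} {B : ℝ} (hb : ∀ n, |b n| ≤ B) :
    ∃ x, Tendsto b (hyperfilter ℕ) (nhds x) := by
  have hc : IsCompact (Icc (-B) B) := isCompact_Icc
  obtain ⟨x, -, hx⟩ := hc.ultrafilter_le_nhds ((hyperfilter ℕ : Ultrafilter ℕ).map b)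
    (by
      simp only [Ultrafilter.coe_map, le_principal_iff, mem_map]
      exact Eventually.of_forall fun n => abs_le.1 (hb n))
  exact ⟨x, hx⟩

lemma compactness (G : GH g κ q p L δ A γ ε0) (M : MU q c (c * h) μ) {cn r : ℕ → ℝ} {C0 : ℝ}
    (hcn : Tendsto cn atTop (nhds c)) (hC0 : ∀ n, |cn n| ≤ C0) (hr : Tendsto r atTop (nhds 0)) (hr1 : ∀ n, r n ≤ 1)
    {b b1 b2 : ℕ → ℝ → ℝ} (ht : ∀ n, T2 (b n) (b1 n) (b2 n)) (hm : ∀ n, Monotone (b n))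
    (hrng : ∀ n t, b n t ∈ Icc 0 κ) (h0 : ∀ n, b n 0 = κ / 2)
    (heq : ∀ n t, |b2 n t - cn n * b1 n t - b n t + g (b n (t - cn n * h))| ≤ r n) :
    ∃ f f1 f2, Front g κ c (c * h) f f1 f2 ∧ Monotone f := by
  have hκ := G.hκ
  have hL := G.hL
  have hC00 : 0 ≤ C0 := (abs_nonneg _).trans (hC0 0)
  have hb : ∀ n t, |b n t| ≤ κ := fun n t => by rw [abs_of_nonneg (hrng n t).1]; exact (hrng n t).2
  set R := κ + L * κ + 1 with hR
  have hR0 : 0 ≤ R := by positivity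
  have hR' : ∀ n t, |b2 n t - cn n * b1 n t| ≤ R := fun n t => by
    have h1 := heq n t
    have h2 := G.gb (hrng n (t - cn n * h))
    have h3 := hb n t
    have := hr1 n
    rw [abs_le] at *
    constructor <;> linarith
  set C1 := 2 * κ + C0 * (2 * κ) + R with hC1
  have hC10 : 0 ≤ C1 := by positivity
  have hb1 : ∀ n t, |b1 n t| ≤ C1 := fun n t => by
    have := (ht n).f1bdd (cn n) κ R (hb n) (hR' n) t
    nlinarith [hC0 n]
  set C2 := R + C0 * C1 with hC2
  have hC20 : 0 ≤ C2 := by positivity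
  have hb2 : ∀ n t, |b2 n t| ≤ C2 := fun n t => by
    have h1 := abs_add_le (b2 n t - cn n * b1 n t) (cn n * b1 n t)
    rw [sub_add_cancel, abs_mul] at h1
    have := mul_le_mul (hC0 n) (hb1 n t) (abs_nonneg _) hC00
    linarith [hR' n t]
  have l0 : ∀ n x y, |b n x - b n y| ≤ C1 * |x - y| := fun n => lip_of_bdd (ht n).d1 (hb1 n)
  have l1 : ∀ n x y, |b1 n x - b1 n y| ≤ C2 * |x - y| := fun n => lip_of_bdd (ht n).d2 (hb2 n)
  set C3 := C0 * C2 + C1 + L * C1 with hC3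
  have hC30 : 0 ≤ C3 := by positivity
  have l2 : ∀ n x y, |b2 n x - b2 n y| ≤ C3 * |x - y| + 2 * r n := fun n x y => by
    have h1 := abs_le.1 (heq n x)
    have h2 := abs_le.1 (heq n y)
    have h3 := abs_le.1 (l0 n x y)
    have h4 := G.lip _ (hrng n (x - cn n * h)) _ (hrng n (y - cn n * h))
    have h5 := l0 n (x - cn n * h) (y - cn n * h)
    rw [show x - cn n * h - (y - cn n * h) = x - y by ring] at h5
    have h5' := mul_le_mul_of_nonneg_left h5 (show 0 ≤ L by linarith)
    have h6 : |cn n * (b1 n x - b1 n y)| ≤ C0 * (C2 * |x - y|) := by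
      rw [abs_mul]; exact mul_le_mul (hC0 n) (l1 n x y) (abs_nonneg _) hC00
    have h7 := abs_le.1 h6
    have h8 := abs_le.1 (h4.trans h5')
    rw [abs_le]
    constructor <;> nlinarith
  choose f hf using fun t => compact_lim (fun n => hb n t)
  choose f1 hf1 using fun t => compact_lim (fun n => hb1 n t)
  have hU : (hyperfilter ℕ : Filter ℕ) ≤ atTop := Nat.hyperfilter_le_atTop
  have hrU := hr.mono_left hU
  have hcU := hcn.mono_left hU
  have hf2 : ∀ t, Tendsto (fun n => b2 n t) (hyperfilter ℕ) (nhds (c * f1 t + f t - g (f (t - c * h)))) := by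
    intro t
    have e1 : Tendsto (fun n => b n (t - cn n * h)) (hyperfilter ℕ) (nhds (f (t - c * h))) := by
      have : Tendsto (fun n => b n (t - cn n * h) - b n (t - c * h)) (hyperfilter ℕ) (nhds 0) := by
        have e2 : Tendsto (fun n => C1 * |(t - cn n * h) - (t - c * h)|) (hyperfilter ℕ) (nhds 0) := by
          have := (((hcU.mul_const h).const_sub t).sub_const (t - c * h)).abs.const_mul C1
          simpa using this
        exact squeeze_zero_norm (fun n => l0 n _ _) e2
      simpa using this.add (hf (t - c * h))
    have e3 : Tendsto (fun n => b2 n t - (cn n * b1 n t + b n t - g (b n (t - cn n * h))))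
        (hyperfilter ℕ) (nhds 0) := squeeze_zero_norm (fun n => by
          rw [Real.norm_eq_abs]; refine le_trans (le_of_eq ?_) (heq n t); congr 1; ring) hrU
    have e4 := ((hcU.mul (hf1 t)).add (hf t)).sub ((G.cont.tendsto _).comp e1)
    simpa using e3.add e4
  have T : T2 f f1 (fun t => c * f1 t + f t - g (f (t - c * h))) := by
    refine ⟨fun t => hasDerivAt_of_quad (C := C2) fun s => ?_, fun t => hasDerivAt_of_quad (C := C3) fun s => ?_⟩
    · refine le_of_tendsto (((hf (t + s)).sub (hf t)).sub ((hf1 t).const_mul s)).abs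
        (Eventually.of_forall fun n => ?_)
      have := taylor_aux (C := C2) (D := 0) (ht n).d1 (t := t) (fun x => by simpa using l1 n x t) s hC20
      simpa using this
    · have e := (hrU.const_mul 2).mul_const |s| |>.const_add (C3 * s ^ 2)
      simp only [mul_zero, zero_mul, add_zero] at e
      refine le_of_tendsto_of_tendsto (((hf1 (t + s)).sub (hf1 t)).sub ((hf2 t).const_mul s)).abs e
        (Eventually.of_forall fun n => ?_)
      exact taylor_aux (C := C3) (D := 2 * r n) (ht n).d2 (t := t) (fun x => l2 n x t) s hC30
  have S : Sol g κ c (c * h) f f1 (fun t => c * f1 t + f t - g (f (t - c * h))) :=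
    ⟨T, fun t => isClosed_Icc.mem_of_tendsto (hf t) (Eventually.of_forall fun n => hrng n t),
      fun t => by ring⟩
  have hmf : Monotone f := fun x y hxy =>
    le_of_tendsto_of_tendsto (hf x) (hf y) (Eventually.of_forall fun n => hm n hxy)
  have hf0 : f 0 = κ / 2 := tendsto_nhds_unique (hf 0) (by simp [h0])
  exact ⟨_, _, _, S.front G M hmf hf0, hmf⟩

lemma exists_half {φ : ℝ → ℝ} (hc : Continuous φ) (hκ : 0 < κ) (h0 : Tendsto φ atBot (nhds 0))
    (h1 : Tendsto φ atTop (nhds κ)) : ∃ t, φ t = κ / 2 := by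
  obtain ⟨a, ha⟩ := (h0.eventually (gt_mem_nhds (show (0:ℝ) < κ / 2 by linarith))).exists
  obtain ⟨b, hb⟩ := (h1.eventually (lt_mem_nhds (show κ / 2 < κ by linarith))).exists
  exact mem_range_of_exists_le_of_exists_ge hc ⟨a, ha.le⟩ ⟨b, hb.le⟩

def InS (g : ℝ → ℝ) (κ h c : ℝ) : Prop :=
  0 < c ∧ ∃ f f1 f2, Front g κ c (c * h) f f1 f2 ∧ Monotone f

lemma exists_of_super (G : GH g κ q p L δ A γ ε0) (M : MU q c (c * h) μ)
    {Φ Φ1 Φ2 : ℝ → ℝ} (H : T2 Φ Φ1 Φ2) (hl : Tendsto Φ atBot (nhds 0))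
    (hX : ∀ t, 0 ≤ Φ1 t + μ * Φ t) {k0 : ℝ} (hk0 : 0 < k0) (ha : ∀ t, k0 * a0 t ≤ Φ t)
    (hD : ∀ t, Φ2 t - c * Φ1 t - Φ t - q * Φ (t - c * h) ≤
      -(g (min (Φ (t - c * h)) κ) + q * min (Φ (t - c * h)) κ)) : InS g κ h c := by
  refine ⟨M.hc, ?_⟩
  have hκ := G.hκ
  have hL := G.hL
  have hq := G.hq
  have step : ∀ k, 0 < k → k ≤ k0 → k ≤ δ → ∃ φ φ1 φ2 : ℝ → ℝ, T2 φ φ1 φ2 ∧ Monotone φ ∧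
      (∀ t, φ t ∈ Icc 0 κ) ∧ φ 0 = κ / 2 ∧
      ∀ t, |φ2 t - c * φ1 t - φ t + g (φ (t - c * h))| ≤ (L + q) * k := by
    intro k hk h1 h2
    have hkκ : k ∈ Icc 0 κ := ⟨hk.le, h2.trans G.hδκ.le⟩
    obtain ⟨φ, φ1, φ2, ht, hm, hr, he, hdom⟩ := exists_phi G M hkκ
    have hle := hdom Φ Φ1 Φ2 H hl hX (fun t => (mul_le_mul_of_nonneg_right h1 (a0_rng t).1).trans (ha t)) hD
    have lb : Tendsto φ atBot (nhds 0) := squeeze_zero (fun t => (hr t).1) hle hl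
    have hb := tendsto_atTop_ciSup hm ⟨κ, by rintro _ ⟨t, rfl⟩; exact (hr t).2⟩
    set ℓ := ⨆ t, φ t
    have hℓ : ℓ ∈ Icc 0 κ := isClosed_Icc.mem_of_tendsto hb (Eventually.of_forall hr)
    have hs : Tendsto (fun t => t - c * h) atTop atTop := tendsto_atTop_add_const_right _ (-(c*h)) tendsto_id
    have ha0 : Tendsto (fun t => k * a0 (t - c * h)) atTop (nhds k) := by
      refine tendsto_const_nhds.congr' ?_
      filter_upwards [hs.eventually (eventually_ge_atTop 1)] with t ht
      simp [a0, min_eq_right ht]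
    have hmax := ha0.max (hb.comp hs)
    have hlim : Tendsto (fun t => φ2 t - c * φ1 t) atTop
        (nhds (ℓ + q * ℓ - (g (max k ℓ) + q * max k ℓ))) := by
      refine ((hb.add ((hb.comp hs).const_mul q)).sub
        (((G.cont.tendsto _).comp hmax).add (hmax.const_mul q))).congr fun t => ?_
      simp only [Function.comp]; linarith [he t]
    have hz := ht.lim SLtop hb hlim
    have hℓκ : ℓ = κ := by
      rcases lt_or_ge ℓ k with h3 | h3
      · rw [max_eq_left h3.le] at hz
        have := G.geu k ⟨hk.le, h2⟩
        nlinarith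
      · rw [max_eq_right h3] at hz
        rcases G.fixp ℓ hℓ (by linarith) with h4 | h4
        · linarith
        · exact h4
    rw [hℓκ] at hb
    obtain ⟨t0, ht0⟩ := exists_half ht.c0 hκ lb hb
    refine ⟨_, _, _, ht.shift t0, fun x y hxy => hm (by linarith), fun t => hr _, by simpa using ht0, fun t => ?_⟩
    have e := he (t + t0)
    rw [show t + t0 - c * h = t - c * h + t0 by ring] at e
    set x := φ (t - c * h + t0)
    have hx : x ∈ Icc 0 κ := hr _
    set y := k * a0 (t - c * h + t0)
    have hy : 0 ≤ y ∧ y ≤ k := ⟨mul_nonneg hk.le (a0_rng _).1, by nlinarith [(a0_rng (t - c * h + t0)).2]⟩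
    have hmx : max y x ∈ Icc 0 κ := ⟨le_max_of_le_right hx.1, max_le (hy.2.trans hkκ.2) hx.2⟩
    have h5 := G.lip _ hx _ hmx
    have h6 : |x - max y x| ≤ k := by
      rw [abs_sub_comm, abs_of_nonneg (by linarith [le_max_right y x])]
      have : max y x ≤ x + k := max_le (by linarith [hx.1]) (by linarith)
      linarith
    rw [show φ2 (t + t0) - c * φ1 (t + t0) - φ (t + t0) + g x = (g x - g (max y x)) + q * (x - max y x) by linarith]
    refine (abs_add_le _ _).trans ?_
    rw [abs_mul, abs_of_pos hq]
    nlinarith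
  set k1 := min k0 (min δ (1 / (L + q))) with hk1
  have hk1p : 0 < k1 := lt_min hk0 (lt_min G.hδ (by positivity))
  have hkn : ∀ n : ℕ, 0 < k1 / (n + 1) ∧ k1 / (n + 1) ≤ k1 := fun n =>
    ⟨by positivity, div_le_self hk1p.le (by linarith [(Nat.cast_nonneg n : (0:ℝ) ≤ n)])⟩
  choose b b1 b2 ht hm hr h0 he using fun n : ℕ => step (k1 / (n + 1)) (hkn n).1
    ((hkn n).2.trans (min_le_left _ _)) ((hkn n).2.trans ((min_le_right _ _).trans (min_le_left _ _)))
  have hlim : Tendsto (fun n : ℕ => (L + q) * (k1 / (n + 1))) atTop (nhds 0) := by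
    have := (tendsto_one_div_add_atTop_nhds_zero_nat (𝕜 := ℝ)).const_mul ((L + q) * k1)
    rw [mul_zero] at this
    exact this.congr fun n => by ring
  refine compactness G M (cn := fun _ => c) tendsto_const_nhds (fun _ => le_rfl) hlim (fun n => ?_)
    ht hm hr h0 he
  have h1 := (hkn n).2.trans ((min_le_right _ _).trans (min_le_right _ _))
  have : (L + q) * (1 / (L + q)) = 1 := by field_simp
  have := mul_le_mul_of_nonneg_left h1 (show 0 ≤ L + q by linarith)
  linarith
end

section
variable {g : ℝ → ℝ} {κ q p L δ A γ ε0 c τ μ h : ℝ} {f f1 f2 u u1 u2 v v1 v2 : ℝ → ℝ}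

lemma Front.lt (G : GH g κ q p L δ A γ ε0) (M : MU q c τ μ) (F : Front g κ c τ f f1 f2) (t : ℝ) : f t < κ :=
  (F.sw G.hκ).lt G M t

lemma Front.strictMono (G : GH g κ q p L δ A γ ε0) (M : MU q c τ μ) (F : Front g κ c τ f f1 f2)
    (hm : Monotone f) : StrictMono f := by
  intro a b hab
  refine lt_of_le_of_ne (hm hab.le) fun heq => ?_
  have h1 := (F.sol G M).strong G M ((F.shift (b - a)).sol G M) (fun t => hm (by linarith)) (t0 := a)
    (by rw [heq]; ring_nf)
  have h2 : ∀ n : ℕ, f (0 + n * (b - a)) = f 0 := fun n => by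
    induction n with
    | zero => simp
    | succ n ih => rw [← ih, h1 (0 + n * (b - a))]; push_cast; ring_nf
  have h3 : Tendsto (fun n : ℕ => f (0 + n * (b - a))) atTop (nhds κ) := by
    refine F.limκ.comp (tendsto_atTop_add_const_left _ 0 ?_)
    exact tendsto_natCast_atTop_atTop.atTop_mul_const (by linarith)
  simp only [h2] at h3
  have := tendsto_nhds_unique h3 tendsto_const_nhds
  exact absurd this.symm (F.lt G M 0).ne

lemma SW.inS (G : GH g κ q p L δ A γ ε0) (M : MU q c (c * h) μ) (S : SW g c (c * h) f f1 f2) :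
    InS g κ h c := by
  obtain ⟨ε, hε, he⟩ := S.lb
  obtain ⟨T, hT⟩ := eventually_atTop.1 he
  obtain ⟨x, hx, hmin⟩ := isCompact_Icc.exists_isMinOn (s := Icc 0 (max T 0)) ⟨0, le_rfl, le_max_right _ _⟩
    S.t2.c0.continuousOn
  refine exists_of_super G M S.t2 S.lim0 ((S.sol G M).psi0 G M) (k0 := min ε (f x))
    (lt_min hε (S.pos x)) (fun t => ?_) (fun t => ?_)
  · rcases le_total t 0 with h | h
    · have : a0 t = 0 := max_eq_left ((min_le_left _ _).trans h)
      rw [this, mul_zero]; exact (S.pos t).le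
    · have h1 : min ε (f x) ≤ f t := by
        rcases le_total T t with h2 | h2
        · exact (min_le_left _ _).trans (hT t h2)
        · exact (min_le_right _ _).trans (hmin ⟨h, h2.trans (le_max_left _ _)⟩)
      have h2 := a0_rng t
      have h3 := lt_min hε (S.pos x)
      nlinarith
  · rw [min_eq_left (S.lt G M _).le]
    linarith [S.eq t]

lemma inS_large (G : GH g κ q p L δ A γ ε0) (hh : 0 ≤ h)
    (hqh : q * h * Real.exp (h + 1) ≤ 1) (hc : 2 * L ≤ c) : InS g κ h c := by
  have hL := G.hL
  have hc0 : 0 < c := by linarith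
  obtain ⟨μ, M, -⟩ := exists_mu G.hq hc0 hh hqh
  have hd : ∀ a t : ℝ, HasDerivAt (fun t => a * Real.exp (c / 2 * t)) (a * (c / 2) * Real.exp (c / 2 * t)) t := by
    intro a t
    have := (((hasDerivAt_id t).const_mul (c / 2)).exp).const_mul a
    refine this.congr_deriv ?_
    simp; ring
  have T : T2 (fun t => 1 * Real.exp (c / 2 * t)) (fun t => 1 * (c / 2) * Real.exp (c / 2 * t))
    (fun t => 1 * (c / 2) * (c / 2) * Real.exp (c / 2 * t)) := ⟨fun t => hd _ t, fun t => hd _ t⟩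
  refine exists_of_super G M T (by simpa using tendsto_exp_mul_atBot (show 0 < c / 2 by linarith))
    (fun t => ?_) (k0 := 1) one_pos (fun t => ?_) (fun t => ?_)
  · have := M.hμ; positivity
  · rcases le_total t 0 with h | h
    · have : a0 t = 0 := max_eq_left ((min_le_left _ _).trans h)
      rw [this, mul_zero]; positivity
    · have := Real.one_le_exp (show 0 ≤ c / 2 * t by positivity)
      linarith [(a0_rng t).2]
  · have h1 : Real.exp (c / 2 * (t - c * h)) ≤ Real.exp (c / 2 * t) := by
      refine Real.exp_le_exp.2 (mul_le_mul_of_nonneg_left ?_ (by linarith))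
      nlinarith
    simp only [one_mul]
    have hp := Real.exp_pos (c / 2 * (t - c * h))
    set z := Real.exp (c / 2 * (t - c * h))
    set y := Real.exp (c / 2 * t)
    have h2 := G.gle (x := min z κ) ⟨le_min hp.le G.hκ.le, min_le_right _ _⟩
    have h3 := mul_le_mul_of_nonneg_left (min_le_left z κ) (show 0 ≤ L + q by linarith [G.hq])
    have h4 : L * y ≤ (c / 2) * (c / 2) * y := by
      refine mul_le_mul_of_nonneg_right ?_ (Real.exp_pos _).le
      nlinarith
    nlinarith

lemma inS_closed (G : GH g κ q p L δ A γ ε0) (hh : 0 ≤ h) (hqh : q * h * Real.exp (h + 1) ≤ 1)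
    (hc : 0 < c) {cn : ℕ → ℝ} (hcn : Tendsto cn atTop (nhds c)) (hS : ∀ n, InS g κ h (cn n)) :
    InS g κ h c := by
  refine ⟨hc, ?_⟩
  obtain ⟨μ, M, -⟩ := exists_mu G.hq hc hh hqh
  have step : ∀ n, ∃ φ φ1 φ2 : ℝ → ℝ, T2 φ φ1 φ2 ∧ Monotone φ ∧ (∀ t, φ t ∈ Icc 0 κ) ∧ φ 0 = κ / 2 ∧
      ∀ t, |φ2 t - cn n * φ1 t - φ t + g (φ (t - cn n * h))| ≤ 0 := by
    intro n
    obtain ⟨hn, φ, φ1, φ2, F, hm⟩ := hS n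
    obtain ⟨μ', M', -⟩ := exists_mu G.hq hn hh hqh
    obtain ⟨t0, ht0⟩ := exists_half F.t2.c0 G.hκ F.lim0 F.limκ
    have F' := F.shift t0
    exact ⟨_, _, _, F'.t2, fun x y hxy => hm (by linarith), (F'.sol G M').rng, by simpa using ht0,
      fun t => by rw [F'.eq t, abs_zero]⟩
  choose b b1 b2 ht hm hr h0 he using step
  obtain ⟨C, hC⟩ := hcn.abs.bddAbove_range
  exact compactness G M hcn (fun n => hC ⟨n, rfl⟩) (r := fun _ => 0) tendsto_const_nhds
    (fun _ => zero_le_one) ht hm hr h0 he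

lemma Front.expf1 (G : GH g κ q p L δ A γ ε0) (M : MU q c τ μ) (F : Front g κ c τ f f1 f2)
    (hm : Monotone f) : Monotone (fun t => Real.exp (μ * t) * f1 t) := by
  intro a b hab
  have key : ∀ s > 0, Real.exp (μ * a) * (s⁻¹ • (f (a + s) - f a)) ≤
      Real.exp (μ * b) * (s⁻¹ • (f (b + s) - f b)) := by
    intro s hs
    have h1 := (F.sol G M).psi G M ((F.shift s).sol G M) (fun t => hm (by linarith))
    have h2 := mono_of_psi ((F.t2.shift s).sub F.t2).d1 h1 hab
    have := mul_le_mul_of_nonneg_left h2 (inv_pos.2 hs).le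
    simp only [smul_eq_mul] at *
    linarith
  have t1 : ∀ t, Tendsto (fun s => s⁻¹ • (f (t + s) - f t)) (nhdsWithin 0 (Ioi 0)) (nhds (f1 t)) :=
    fun t => (hasDerivAt_iff_tendsto_slope_zero.1 (F.t2.d1 t)).mono_left
      (nhdsWithin_mono 0 (show Ioi (0:ℝ) ⊆ {0}ᶜ from fun x hx => ne_of_gt hx))
  exact le_of_tendsto_of_tendsto ((t1 a).const_mul _) ((t1 b).const_mul _)
    (eventually_mem_nhdsWithin.mono fun s hs => key s hs)

lemma f1_nonneg_of_mono (hm : Monotone f) (H : ∀ t, HasDerivAt f (f1 t) t) (t : ℝ) : 0 ≤ f1 t := by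
  have t1 := ((hasDerivAt_iff_tendsto_slope_zero.1 (H t)).mono_left
    (nhdsWithin_mono 0 (show Ioi (0:ℝ) ⊆ {0}ᶜ from fun x hx => ne_of_gt hx)))
  refine ge_of_tendsto t1 (eventually_mem_nhdsWithin.mono fun s hs => ?_)
  have hs' : 0 < s := hs
  exact smul_nonneg (inv_pos.2 hs').le (sub_nonneg.2 (hm (by linarith)))

lemma inS_incr (G : GH g κ q p L δ A γ ε0) (hh : 0 ≤ h) (hqh : q * h * Real.exp (h + 1) ≤ 1)
    (hS : InS g κ h c) : ∃ η > 0, ∀ c' ∈ Icc c (c + η), InS g κ h c' := by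
  obtain ⟨hc, f, f1, f2, F, hm⟩ := hS
  obtain ⟨μ, M, hlt⟩ := exists_mu G.hq hc hh hqh
  have hcont : Continuous fun c' => q * h * Real.exp (μ * (c' * h)) := by fun_prop
  obtain ⟨η, hη, hη'⟩ := Metric.eventually_nhds_iff.1 (hcont.continuousAt.eventually (gt_mem_nhds hlt))
  refine ⟨η / 2, by linarith, fun c' hc' => ?_⟩
  have hc0 : 0 < c' := by linarith [hc'.1]
  have hlt' := hη' (y := c') (by rw [Real.dist_eq, abs_of_nonneg (by linarith [hc'.1])]; linarith [hc'.2])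
  obtain ⟨μ', M', -⟩ := exists_mu G.hq hc0 hh hqh
  have hf1 : ∀ t, 0 ≤ f1 t := fun t => by
    exact f1_nonneg_of_mono hm F.t2.d1 t
  have hSW := F.sw G.hκ
  obtain ⟨ε, hε, he⟩ := hSW.lb
  refine exists_of_super G M' F.t2 F.lim0 (fun t => ?_) (k0 := f 0) (F.pos 0) (fun t => ?_) (fun t => ?_)
  · exact add_nonneg (hf1 t) (mul_nonneg M'.hμ.le (F.pos t).le)
  · rcases le_total t 0 with h | h
    · have : a0 t = 0 := max_eq_left ((min_le_left _ _).trans h)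
      rw [this, mul_zero]; exact (F.pos t).le
    · have h2 := a0_rng t
      have := hm h
      nlinarith [F.pos 0]
  · rw [min_eq_left (F.lt G M _).le]
    have hxy : t - c' * h ≤ t - c * h := by nlinarith [hc'.1]
    have h1 := G.mono _ _ (F.pos (t - c' * h)).le (hm hxy) (F.lt G M _).le
    have h2 : f (t - c * h) - f (t - c' * h) ≤ Real.exp (μ * (c' * h)) * f1 t * ((c' - c) * h) := by
      rcases eq_or_lt_of_le hxy with h3 | h3
      · have : (c' - c) * h = 0 := by linarith
        rw [h3, this]; simp
      · obtain ⟨x, hx, e⟩ := mvt F.t2.d1 h3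
        rw [e, show t - c * h - (t - c' * h) = (c' - c) * h by ring]
        refine mul_le_mul_of_nonneg_right ?_ (by nlinarith [hc'.1])
        have hxt : x ≤ t := by nlinarith [hx.2]
        have h4 := F.expf1 G M hm hxt
        have h5 : f1 x ≤ Real.exp (μ * (t - x)) * f1 t := by
          have e1 : Real.exp (μ * t) = Real.exp (μ * x) * Real.exp (μ * (t - x)) := by
            rw [← Real.exp_add]; ring_nf
          simp only [e1, mul_assoc] at h4
          exact le_of_mul_le_mul_left h4 (Real.exp_pos _)
        refine h5.trans (mul_le_mul_of_nonneg_right (Real.exp_le_exp.2 ?_) (hf1 t))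
        exact mul_le_mul_of_nonneg_left (by linarith [hx.1]) M.hμ.le
    have h3 := F.eq t
    have h4 := mul_nonneg (sub_nonneg.2 hc'.1) (hf1 t)
    have h5 := mul_le_mul_of_nonneg_left h2 G.hq.le
    have h6 : q * (Real.exp (μ * (c' * h)) * f1 t * ((c' - c) * h)) =
      (q * h * Real.exp (μ * (c' * h))) * ((c' - c) * f1 t) := by ring
    have h7 := mul_le_mul_of_nonneg_right hlt'.le h4
    linarith

lemma inS_up (G : GH g κ q p L δ A γ ε0) (hh : 0 ≤ h) (hqh : q * h * Real.exp (h + 1) ≤ 1)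
    (hS : InS g κ h c) {c' : ℝ} (hc' : c ≤ c') : InS g κ h c' := by
  have hsub : Icc c c' ⊆ {x | InS g κ h x} := by
    refine IsClosed.Icc_subset_of_forall_exists_gt ?_ hS ?_
    · refine IsSeqClosed.isClosed fun x a hx ha => ?_
      have hmem := isClosed_Icc.mem_of_tendsto ha (Eventually.of_forall fun n => (hx n).2)
      exact ⟨inS_closed G hh hqh (hS.1.trans_le hmem.1) ha (fun n => (hx n).1), hmem⟩
    · rintro x ⟨hx, -⟩ y hy
      obtain ⟨η, hη, h1⟩ := inS_incr G hh hqh hx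
      exact ⟨min y (x + η), h1 _ ⟨le_min (le_of_lt hy) (by linarith), min_le_right _ _⟩,
        lt_min hy (by linarith), min_le_left _ _⟩
  exact hsub ⟨hc', le_rfl⟩
end


lemma lim_of_deriv {M M' : ℝ → ℝ} {σ B T : ℝ} (hσ : 0 < σ) (hd : ∀ t, HasDerivAt M (M' t) t)
    (hb : ∀ t ≤ T, |M' t| ≤ B * Real.exp (σ * t)) :
    ∃ M0, ∀ t ≤ T, |M t - M0| ≤ B / σ * Real.exp (σ * t) := by
  have hE : ∀ t, HasDerivAt (fun t => B / σ * Real.exp (σ * t)) (B * Real.exp (σ * t)) t := fun t => by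
    have := (((hasDerivAt_id t).const_mul σ).exp).const_mul (B / σ)
    refine this.congr_deriv ?_
    simp; field_simp
  have hm : MonotoneOn (fun t => M t + B / σ * Real.exp (σ * t)) (Iic T) :=
    monotoneOn_of_hasDerivWithinAt_nonneg (convex_Iic T)
      (fun t _ => ((hd t).add (hE t)).continuousAt.continuousWithinAt)
      (fun t _ => ((hd t).add (hE t)).hasDerivWithinAt)
      (fun t ht => by have := abs_le.1 (hb t (show t ∈ Iic T from interior_subset ht)); linarith)
  have ha : AntitoneOn (fun t => M t - B / σ * Real.exp (σ * t)) (Iic T) :=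
    antitoneOn_of_hasDerivWithinAt_nonpos (convex_Iic T)
      (fun t _ => ((hd t).sub (hE t)).continuousAt.continuousWithinAt)
      (fun t _ => ((hd t).sub (hE t)).hasDerivWithinAt)
      (fun t ht => by have := abs_le.1 (hb t (show t ∈ Iic T from interior_subset ht)); linarith)
  have hB : 0 ≤ B := by
    have := (abs_nonneg _).trans (hb T le_rfl)
    exact nonneg_of_mul_nonneg_left this (Real.exp_pos _)
  have hpos : ∀ t, 0 ≤ B / σ * Real.exp (σ * t) := fun t => by positivity
  have lt : ∀ s ≤ T, ∀ t ≤ T, M s - B / σ * Real.exp (σ * s) ≤ M t + B / σ * Real.exp (σ * t) := by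
    intro s hs t ht
    rcases le_total s t with h | h
    · have := hm (show s ∈ Iic T from hs) (show t ∈ Iic T from ht) h
      simp only at this
      linarith [hpos s]
    · have := ha (show t ∈ Iic T from ht) (show s ∈ Iic T from hs) h
      simp only at this
      linarith [hpos t]
  refine ⟨sSup ((fun t => M t - B / σ * Real.exp (σ * t)) '' Iic T), fun t ht => ?_⟩
  have bd : BddAbove ((fun t => M t - B / σ * Real.exp (σ * t)) '' Iic T) :=
    ⟨M T + B / σ * Real.exp (σ * T), by rintro _ ⟨s, hs, rfl⟩; exact lt s hs T le_rfl⟩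
  have h1 := le_csSup bd ⟨t, ht, rfl⟩
  have h2 : sSup ((fun t => M t - B / σ * Real.exp (σ * t)) '' Iic T) ≤ M t + B / σ * Real.exp (σ * t) :=
    csSup_le ⟨_, T, le_refl T, rfl⟩ (by rintro _ ⟨s, hs, rfl⟩; exact lt s hs t ht)
  simp only at h1
  rw [abs_le]; constructor <;> linarith

lemma DIplus {N N' : ℝ → ℝ} {a σ B T : ℝ} (hσ : σ < a) (hd : ∀ t, HasDerivAt N (N' t) t)
    (hb : ∀ t ≤ T, a * N t - B * Real.exp (σ * t) ≤ N' t) :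
    ∃ C, ∀ t ≤ T, N t ≤ C * Real.exp (σ * t) := by
  have ha : 0 < a - σ := by linarith
  have hE : ∀ t, HasDerivAt (fun t => B / (a - σ) * Real.exp (σ * t))
      (σ * (B / (a - σ)) * Real.exp (σ * t)) t := fun t => by
    have := (((hasDerivAt_id t).const_mul σ).exp).const_mul (B / (a - σ))
    refine this.congr_deriv ?_
    simp; ring
  have hm := exp_mono (f := fun t => N t - B / (a - σ) * Real.exp (σ * t)) (convex_Iic T) (-a) (fun t _ => (hd t).sub (hE t)) (fun t ht => by
    have h1 := hb t ht
    have h2 : σ * (B / (a - σ)) * Real.exp (σ * t) - a * (B / (a - σ)) * Real.exp (σ * t) =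
      - B * Real.exp (σ * t) := by field_simp; ring
    linarith)
  set D := Real.exp (-a * T) * (N T - B / (a - σ) * Real.exp (σ * T)) with hD
  refine ⟨B / (a - σ) + |D| * Real.exp ((a - σ) * T), fun t ht => ?_⟩
  have h1 : Real.exp (-a * t) * (N t - B / (a - σ) * Real.exp (σ * t)) ≤ D :=
    hm (show t ∈ Iic T from ht) (mem_Iic.2 le_rfl) ht
  have h2 : N t - B / (a - σ) * Real.exp (σ * t) ≤ |D| * Real.exp (a * t) := by
    have := mul_le_mul_of_nonneg_left (h1.trans (le_abs_self D)) (Real.exp_pos (a * t)).le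
    rw [← mul_assoc, ← Real.exp_add, show a * t + -a * t = 0 by ring, Real.exp_zero] at this
    linarith
  have h3 : Real.exp (a * t) ≤ Real.exp ((a - σ) * T) * Real.exp (σ * t) := by
    rw [← Real.exp_add]; refine Real.exp_le_exp.2 ?_; nlinarith
  have := mul_le_mul_of_nonneg_left h3 (abs_nonneg D)
  linarith

lemma DIminus {N N' : ℝ → ℝ} {a σ B T : ℝ} (ha : 0 < a) (hσ : 0 ≤ σ) (hd : ∀ t, HasDerivAt N (N' t) t)
    (hb : ∀ t ≤ T, N' t ≤ -a * N t + B * Real.exp (σ * t))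
    (hl : Tendsto (fun t => Real.exp (a * t) * N t) atBot (nhds 0)) :
    ∃ C, ∀ t ≤ T, N t ≤ C * Real.exp (σ * t) := by
  refine ⟨B / (a + σ), fun t ht => ?_⟩
  have hE : ∀ t, HasDerivAt (fun t => B / (a + σ) * Real.exp (σ * t))
      (σ * (B / (a + σ)) * Real.exp (σ * t)) t := fun t => by
    have := (((hasDerivAt_id t).const_mul σ).exp).const_mul (B / (a + σ))
    refine this.congr_deriv ?_
    simp; ring
  have hm := exp_anti (f := fun t => N t - B / (a + σ) * Real.exp (σ * t)) (convex_Iic T) a (fun t _ => (hd t).sub (hE t)) (fun t ht => by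
    have h1 := hb t ht
    have h2 : σ * (B / (a + σ)) * Real.exp (σ * t) + a * (B / (a + σ)) * Real.exp (σ * t) =
      B * Real.exp (σ * t) := by field_simp; ring
    linarith)
  have hl2 : Tendsto (fun t => Real.exp (a * t) * (N t - B / (a + σ) * Real.exp (σ * t))) atBot (nhds 0) := by
    have h1 := (tendsto_exp_mul_atBot (show 0 < a + σ by linarith)).const_mul (B / (a + σ))
    have h2 := hl.sub h1
    rw [mul_zero, sub_zero] at h2
    refine h2.congr fun t => ?_
    rw [add_mul, Real.exp_add]; ring
  have := antiOn_bot hm hl2 ht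
  have := nonpos_of_mul_nonpos_right this (Real.exp_pos _)
  linarith

structure Hk (μ l T : ℝ) (w w1 : ℝ → ℝ) : Prop where
  d : ∀ t, HasDerivAt w (w1 t) t
  nn : ∀ t, 0 ≤ w t
  lo : ∀ t, 0 ≤ w1 t + μ * w t
  up : ∀ t ≤ T, w1 t ≤ l * w t

def yy (ν : ℝ) (w : ℝ → ℝ) (t : ℝ) : ℝ := Real.exp (-ν * t) * w t
def I1 (τ ν : ℝ) (w : ℝ → ℝ) (t : ℝ) : ℝ := ∫ r in (0:ℝ)..τ, yy ν w (t - r)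
def I2 (τ ν : ℝ) (w : ℝ → ℝ) (t : ℝ) : ℝ := ∫ r in (0:ℝ)..τ, (τ - r) * yy ν w (t - r)
def MM (p c τ ν : ℝ) (w w1 : ℝ → ℝ) (t : ℝ) : ℝ :=
  Real.exp (-ν * t) * (w1 t + -ν * w t) - (c - 2 * ν) * yy ν w t - p * Real.exp (-ν * τ) * I1 τ ν w t
def NN (p τ ν : ℝ) (w : ℝ → ℝ) (t : ℝ) : ℝ := yy ν w t + p * Real.exp (-ν * τ) * I2 τ ν w t
def chi (p c τ ν : ℝ) : ℝ := ν ^ 2 - c * ν - 1 + p * Real.exp (-ν * τ)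

section
variable {p c τ ν μ l T : ℝ} {w w1 w2 v v1 : ℝ → ℝ}

lemma yy_cont (hw : Continuous w) : Continuous (yy ν w) := by unfold yy; fun_prop

lemma I1_eq {Y : ℝ → ℝ} (hw : Continuous w) (hY : ∀ t, HasDerivAt Y (yy ν w t) t) (t : ℝ) :
    I1 τ ν w t = Y t - Y (t - τ) := by
  have hc := yy_cont (ν := ν) hw
  unfold I1
  rw [intervalIntegral.integral_eq_sub_of_hasDerivAt (f := fun r => - Y (t - r))]
  · simp; ring
  · intro r _
    refine ((hY (t - r)).comp_const_sub t r).neg.congr_deriv ?_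
    simp
  · exact (hc.comp (continuous_const.sub continuous_id)).intervalIntegrable _ _

lemma I2_eq {Y Z : ℝ → ℝ} (hw : Continuous w) (hY : ∀ t, HasDerivAt Y (yy ν w t) t)
    (hZ : ∀ t, HasDerivAt Z (Y t) t) (t : ℝ) :
    I2 τ ν w t = τ * Y t - Z t + Z (t - τ) := by
  have hc := yy_cont (ν := ν) hw
  unfold I2
  rw [intervalIntegral.integral_eq_sub_of_hasDerivAt (f := fun r => - ((τ - r) * Y (t - r)) + Z (t - r))]
  · simp; ring
  · intro r _
    have h1 := (((hasDerivAt_id r).const_sub τ).mul ((hY (t - r)).comp_const_sub t r)).neg.add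
      ((hZ (t - r)).comp_const_sub t r)
    refine h1.congr_deriv ?_
    simp
  · exact ((continuous_const.sub continuous_id).mul
      (hc.comp (continuous_const.sub continuous_id))).intervalIntegrable _ _

lemma MM_deriv (H : T2 w w1 w2) (t : ℝ) : HasDerivAt (MM p c τ ν w w1)
    (Real.exp (-ν * t) * (w2 t - c * w1 t - w t + p * w (t - τ)) - chi p c τ ν * yy ν w t) t := by
  obtain ⟨Y, hY⟩ := exists_prim (yy_cont (ν := ν) H.c0)
  have e : MM p c τ ν w w1 = fun t => Real.exp (-ν * t) * (w1 t + -ν * w t) - (c - 2 * ν) * yy ν w t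
      - p * Real.exp (-ν * τ) * (Y t - Y (t - τ)) := by
    funext t; simp only [MM, I1_eq H.c0 hY]
  rw [e]
  have h1 := hasDerivAt_expmul (f := fun t => w1 t + -ν * w t) (-ν) ((H.d2 t).add ((H.d1 t).const_mul (-ν)))
  have h2 := (hasDerivAt_expmul (-ν) (H.d1 t)).const_mul (c - 2 * ν)
  have h3 := ((hY t).sub ((hY (t - τ)).comp_sub_const t τ)).const_mul (p * Real.exp (-ν * τ))
  refine ((h1.sub h2).sub h3).congr_deriv ?_
  have e2 : Real.exp (-ν * t) = Real.exp (-ν * τ) * Real.exp (-ν * (t - τ)) := by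
    rw [← Real.exp_add]; ring_nf
  simp only [yy, chi, e2]
  ring

lemma NN_deriv (H : ∀ t, HasDerivAt w (w1 t) t) (t : ℝ) : HasDerivAt (NN p τ ν w)
    ((c - 2 * ν + p * Real.exp (-ν * τ) * τ) * yy ν w t + MM p c τ ν w w1 t) t := by
  have hw : Continuous w := continuous_iff_continuousAt.2 fun t => (H t).continuousAt
  obtain ⟨Y, hY⟩ := exists_prim (yy_cont (ν := ν) hw)
  obtain ⟨Z, hZ⟩ := exists_prim (continuous_iff_continuousAt.2 fun t => (hY t).continuousAt)
  have e : NN p τ ν w = fun t => yy ν w t + p * Real.exp (-ν * τ) * (τ * Y t - Z t + Z (t - τ)) := by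
    funext t; simp only [NN, I2_eq hw hY hZ]
  rw [e]
  have h1 := hasDerivAt_expmul (-ν) (H t)
  have h3 := ((((hY t).const_mul τ).sub (hZ t)).add ((hZ (t - τ)).comp_sub_const t τ)).const_mul
    (p * Real.exp (-ν * τ))
  refine (h1.add h3).congr_deriv ?_
  simp only [MM, yy, I1_eq hw hY]
  ring

lemma MM_sub (hw : Continuous w) (hv : Continuous v) (t : ℝ) :
    MM p c τ ν (fun t => w t - v t) (fun t => w1 t - v1 t) t = MM p c τ ν w w1 t - MM p c τ ν v v1 t := by
  have h1 : I1 τ ν (fun t => w t - v t) t = I1 τ ν w t - I1 τ ν v t := by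
    unfold I1
    rw [← intervalIntegral.integral_sub]
    · simp only [yy, mul_sub]
    · exact ((yy_cont hw).comp (continuous_const.sub continuous_id)).intervalIntegrable _ _
    · exact ((yy_cont hv).comp (continuous_const.sub continuous_id)).intervalIntegrable _ _
  simp only [MM, h1, yy]; ring

lemma NN_sub (hw : Continuous w) (hv : Continuous v) (t : ℝ) :
    NN p τ ν (fun t => w t - v t) t = NN p τ ν w t - NN p τ ν v t := by
  have h1 : I2 τ ν (fun t => w t - v t) t = I2 τ ν w t - I2 τ ν v t := by
    unfold I2
    rw [← intervalIntegral.integral_sub]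
    · simp only [yy, mul_sub]
    · exact ((continuous_const.sub continuous_id).mul
        ((yy_cont hw).comp (continuous_const.sub continuous_id))).intervalIntegrable _ _
    · exact ((continuous_const.sub continuous_id).mul
        ((yy_cont hv).comp (continuous_const.sub continuous_id))).intervalIntegrable _ _
  simp only [NN, h1, yy]; ring

lemma yy_shift (s t : ℝ) : yy ν (fun t => w (t + s)) t = Real.exp (ν * s) * yy ν w (t + s) := by
  simp only [yy]; rw [← mul_assoc, ← Real.exp_add]; ring_nf

lemma MM_shift (s t : ℝ) : MM p c τ ν (fun t => w (t + s)) (fun t => w1 (t + s)) t =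
    Real.exp (ν * s) * MM p c τ ν w w1 (t + s) := by
  have h1 : I1 τ ν (fun t => w (t + s)) t = Real.exp (ν * s) * I1 τ ν w (t + s) := by
    unfold I1
    rw [← intervalIntegral.integral_const_mul]
    simp only [yy_shift]; ring_nf
  have h2 : Real.exp (-ν * t) = Real.exp (ν * s) * Real.exp (-ν * (t + s)) := by
    rw [← Real.exp_add]; ring_nf
  simp only [MM, h1, yy_shift, h2]; ring

lemma NN_shift (s t : ℝ) : NN p τ ν (fun t => w (t + s)) t =
    Real.exp (ν * s) * NN p τ ν w (t + s) := by
  have h1 : I2 τ ν (fun t => w (t + s)) t = Real.exp (ν * s) * I2 τ ν w (t + s) := by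
    unfold I2
    rw [← intervalIntegral.integral_const_mul]
    refine intervalIntegral.integral_congr fun r _ => ?_
    simp only [yy_shift]; rw [show t - r + s = t + s - r by ring]; ring
  simp only [NN, h1, yy_shift]; ring

lemma Hk.yy_lo (H : Hk μ l T w w1) (hν : ν ≤ l) {s t : ℝ} (hst : s ≤ t) :
    yy ν w s ≤ Real.exp ((μ + l) * (t - s)) * yy ν w t := by
  have h1 : Monotone (fun t => Real.exp ((μ + l) * t) * yy ν w t) := by
    refine mono_of_psi (fun t => hasDerivAt_expmul (-ν) (H.d t)) fun t => ?_
    have h2 := H.lo t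
    have h3 := mul_nonneg (sub_nonneg.2 hν) (H.nn t)
    have h4 := mul_nonneg (Real.exp_pos (-ν * t)).le (add_nonneg h2 h3)
    simp only [yy]
    linarith
  have h2 := exp_mono_shift (show 0 ≤ t - s by linarith) h1 t
  simpa using h2

lemma Hk.yy_nn (H : Hk μ l T w w1) (t : ℝ) : 0 ≤ yy ν w t := mul_nonneg (Real.exp_pos _).le (H.nn t)

lemma Hk.MM_le (H : Hk μ l T w w1) (hμ : 0 ≤ μ) (hν0 : 0 ≤ ν) (hν : ν ≤ l) (hp : 0 ≤ p) (hc : 0 ≤ c)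
    (hτ : 0 ≤ τ) {t : ℝ} (ht : t ≤ T) :
    |MM p c τ ν w w1 t| ≤ ((μ + l) + (c + 2 * l) + p * (τ * Real.exp ((μ + l) * τ))) * yy ν w t := by
  have hw : Continuous w := continuous_iff_continuousAt.2 fun t => (H.d t).continuousAt
  obtain ⟨Y, hY⟩ := exists_prim (yy_cont (ν := ν) hw)
  have hy := H.yy_nn (ν := ν) t
  have hI : 0 ≤ I1 τ ν w t ∧ I1 τ ν w t ≤ τ * Real.exp ((μ + l) * τ) * yy ν w t := by
    rw [I1_eq hw hY]
    rcases hτ.eq_or_lt with rfl | h0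
    · simp
    · obtain ⟨x, hx, e⟩ := mvt hY (show t - τ < t by linarith)
      rw [e]
      have h1 := H.yy_lo hν hx.2.le
      have h2 : Real.exp ((μ + l) * (t - x)) ≤ Real.exp ((μ + l) * τ) :=
        Real.exp_le_exp.2 (mul_le_mul_of_nonneg_left (by linarith [hx.1]) (by linarith))
      have h3 := mul_le_mul_of_nonneg_right h2 hy
      rw [show t - (t - τ) = τ by ring]
      exact ⟨mul_nonneg (H.yy_nn x) hτ, by nlinarith⟩
  have h1 : |Real.exp (-ν * t) * (w1 t + -ν * w t)| ≤ (μ + l) * yy ν w t := by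
    rw [abs_mul, abs_of_pos (Real.exp_pos _), yy, mul_left_comm]
    refine mul_le_mul_of_nonneg_left (abs_le.2 ⟨?_, ?_⟩) (Real.exp_pos _).le
    · nlinarith [H.lo t, H.nn t]
    · nlinarith [H.up t ht, H.nn t]
  have h2 : |(c - 2 * ν) * yy ν w t| ≤ (c + 2 * l) * yy ν w t := by
    rw [abs_mul, abs_of_nonneg hy]
    exact mul_le_mul_of_nonneg_right (abs_le.2 ⟨by linarith, by linarith⟩) hy
  have h3 : |p * Real.exp (-ν * τ) * I1 τ ν w t| ≤ p * (τ * Real.exp ((μ + l) * τ)) * yy ν w t := by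
    have : Real.exp (-ν * τ) ≤ 1 := Real.exp_le_one_iff.2 (by nlinarith)
    rw [abs_of_nonneg (mul_nonneg (mul_nonneg hp (Real.exp_pos _).le) hI.1)]
    have h4 : p * Real.exp (-ν * τ) ≤ p := mul_le_of_le_one_right hp this
    calc _ ≤ p * I1 τ ν w t := mul_le_mul_of_nonneg_right h4 hI.1
      _ ≤ p * (τ * Real.exp ((μ + l) * τ) * yy ν w t) := mul_le_mul_of_nonneg_left hI.2 hp
      _ = _ := by ring
  unfold MM
  have h4 := abs_sub (Real.exp (-ν * t) * (w1 t + -ν * w t) - (c - 2 * ν) * yy ν w t)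
    (p * Real.exp (-ν * τ) * I1 τ ν w t)
  have h5 := abs_sub (Real.exp (-ν * t) * (w1 t + -ν * w t)) ((c - 2 * ν) * yy ν w t)
  linarith

lemma Hk.NN_le (H : Hk μ l T w w1) (hμ : 0 ≤ μ) (hν0 : 0 ≤ ν) (hν : ν ≤ l) (hp : 0 ≤ p)
    (hτ : 0 ≤ τ) (t : ℝ) : yy ν w t ≤ NN p τ ν w t ∧
    NN p τ ν w t ≤ (1 + p * (τ * τ * Real.exp ((μ + l) * τ))) * yy ν w t := by
  have hw : Continuous w := continuous_iff_continuousAt.2 fun t => (H.d t).continuousAt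
  obtain ⟨Y, hY⟩ := exists_prim (yy_cont (ν := ν) hw)
  obtain ⟨Z, hZ⟩ := exists_prim (continuous_iff_continuousAt.2 fun t => (hY t).continuousAt)
  have hy := H.yy_nn (ν := ν) t
  have hI : 0 ≤ I2 τ ν w t ∧ I2 τ ν w t ≤ τ * τ * Real.exp ((μ + l) * τ) * yy ν w t := by
    rw [I2_eq hw hY hZ]
    rcases hτ.eq_or_lt with rfl | h0
    · simp
    · obtain ⟨s, hs, e⟩ := mvt hZ (show t - τ < t by linarith)
      obtain ⟨x, hx, e1⟩ := mvt hY hs.2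
      have h1 := H.yy_lo hν hx.2.le
      have h2 : Real.exp ((μ + l) * (t - x)) ≤ Real.exp ((μ + l) * τ) :=
        Real.exp_le_exp.2 (mul_le_mul_of_nonneg_left (by linarith [hs.1, hx.1]) (by linarith))
      have h3 := h1.trans (mul_le_mul_of_nonneg_right h2 hy)
      have e2 : τ * Y t - Z t + Z (t - τ) = τ * (yy ν w x * (t - s)) := by linear_combination τ * e1 - e
      rw [e2]
      have hts : 0 ≤ t - s := by linarith [hs.2]
      refine ⟨mul_nonneg hτ (mul_nonneg (H.yy_nn x) hts), ?_⟩
      rw [mul_assoc, mul_assoc]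
      refine mul_le_mul_of_nonneg_left ?_ hτ
      rw [mul_comm]
      exact mul_le_mul (by linarith [hs.1]) h3 (H.yy_nn x) hτ
  have h4 : p * Real.exp (-ν * τ) ≤ p :=
    mul_le_of_le_one_right hp (Real.exp_le_one_iff.2 (by nlinarith))
  unfold NN
  constructor
  · have := mul_nonneg (mul_nonneg hp (Real.exp_pos (-ν * τ)).le) hI.1
    linarith
  · have h5 := mul_le_mul_of_nonneg_right h4 hI.1
    have h6 := mul_le_mul_of_nonneg_left hI.2 hp
    linarith
end


lemma exists_l {c : ℝ} (hc : 0 < c) : ∃ l > 0, l ^ 2 - c * l - 1 = 0 := by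
  have h := Real.sq_sqrt (show 0 ≤ c ^ 2 + 4 by positivity)
  have h0 := Real.sqrt_nonneg (c ^ 2 + 4)
  exact ⟨(c + Real.sqrt (c ^ 2 + 4)) / 2, by positivity, by nlinarith⟩

section
variable {g : ℝ → ℝ} {κ q p L δ A γ ε0 c τ μ h l T ν : ℝ} {f f1 f2 u u1 u2 v v1 v2 : ℝ → ℝ}

lemma Front.f1lim (G : GH g κ q p L δ A γ ε0) (F : Front g κ c τ f f1 f2) : Tendsto f1 atBot (nhds 0) :=
  (F.sw G.hκ).f1lim G.cont G.g0

lemma Sol.hk (G : GH g κ q p L δ A γ ε0) (M : MU q c τ μ) (U : Sol g κ c τ u u1 u2)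
    (V : Sol g κ c τ v v1 v2) (hle : ∀ t, u t ≤ v t) (hu : Tendsto u atBot (nhds 0))
    (hu1 : Tendsto u1 atBot (nhds 0)) (hv : Tendsto v atBot (nhds 0))
    (hv1 : Tendsto v1 atBot (nhds 0)) (hT : ∀ t ≤ T, v (t - τ) ≤ δ) (hl : 0 < l)
    (hl2 : l ^ 2 - c * l - 1 = 0) : Hk μ l T (fun t => v t - u t) (fun t => v1 t - u1 t) := by
  have W := V.t2.sub U.t2
  refine ⟨W.d1, fun t => sub_nonneg.2 (hle t), U.psi G M V hle, fun t ht => ?_⟩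
  have hlc : 0 < l - c := by
    by_contra hcon
    push Not at hcon
    nlinarith
  have anti := exp_anti (f := fun t => (v1 t - u1 t) - l * (v t - u t)) (convex_Iic T) (l - c)
    (fun t _ => (W.d2 t).sub ((W.d1 t).const_mul l)) (fun t ht => by
      have h1 := G.monoδ ⟨(U.rng (t - τ)).1, (hle _).trans (hT t ht)⟩ ⟨(V.rng (t - τ)).1, hT t ht⟩ (hle _)
      have h2 := U.eq t
      have h3 := V.eq t
      have h4 : (l ^ 2 - c * l - 1) * (v t - u t) = 0 := by rw [hl2, zero_mul]
      nlinarith)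
  have lim : Tendsto (fun t => Real.exp ((l - c) * t) * ((v1 t - u1 t) - l * (v t - u t))) atBot (nhds 0) := by
    simpa using (tendsto_exp_mul_atBot hlc).mul ((hv1.sub hu1).sub ((hv.sub hu).const_mul l))
  have := nonpos_of_mul_nonpos_right (antiOn_bot anti lim ht) (Real.exp_pos _)
  linarith

lemma Front.hk (G : GH g κ q p L δ A γ ε0) (M : MU q c τ μ) (F : Front g κ c τ f f1 f2)
    (hT : ∀ t ≤ T, f (t - τ) ≤ δ) (hl : 0 < l)
    (hl2 : l ^ 2 - c * l - 1 = 0) : Hk μ l T f f1 := by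
  have := (zeroSol G).hk G M (F.sol G M) (fun t => (F.pos t).le) tendsto_const_nhds tendsto_const_nhds
    F.lim0 (F.f1lim G) hT hl hl2
  simpa using this

lemma Front.exT (F : Front g κ c τ f f1 f2) {e : ℝ} (he : 0 < e) : ∃ T, ∀ t ≤ T, f (t - τ) ≤ e := by
  obtain ⟨T, hT⟩ := eventually_atBot.1
    ((F.lim0.comp (tendsto_atBot_add_const_right _ (-τ) tendsto_id)).eventually (gt_mem_nhds he))
  exact ⟨T, fun t ht => (hT t ht).le⟩

lemma small_pow (hA : 0 < A) (hγ : 0 < γ) {e : ℝ} (he : 0 < e) :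
    ∃ d > 0, ∀ u, 0 ≤ u → u ≤ d → A * u ^ γ ≤ e := by
  refine ⟨(e / A) ^ (1 / γ), by positivity, fun u hu hud => ?_⟩
  have h1 := Real.rpow_le_rpow hu hud hγ.le
  rw [← Real.rpow_mul (by positivity), one_div, inv_mul_cancel₀ hγ.ne', Real.rpow_one] at h1
  calc _ ≤ A * (e / A) := mul_le_mul_of_nonneg_left h1 hA.le
    _ = e := by field_simp

lemma inS_lower (G : GH g κ q p L δ A γ ε0) (hh : 0 ≤ h) (hqh : q * h * Real.exp (h + 1) ≤ 1) :
    ∃ c0 > 0, ∀ c, InS g κ h c → c0 ≤ c := by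
  have hp := G.hp
  obtain ⟨d0, hd0, hd⟩ := small_pow G.hA G.hγ (show 0 < (p - 1) / 2 by linarith)
  set P := (1 + p) / 2 with hP
  have hP1 : 1 < P := by linarith
  have hc1 : Continuous fun c' => P * Real.exp (-2 * (c' * h)) - 1 - (P - 1) / 2 - c' ^ 2 / 4 := by fun_prop
  obtain ⟨η, hη, hη'⟩ := Metric.eventually_nhds_iff.1 (hc1.continuousAt.eventually
    (lt_mem_nhds (show 0 < P * Real.exp (-2 * (0 * h)) - 1 - (P - 1) / 2 - 0 ^ 2 / 4 by
      norm_num; linarith)))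
  refine ⟨min η 1, lt_min hη one_pos, fun c hS => ?_⟩
  by_contra hcon
  push Not at hcon
  obtain ⟨hc, f, f1, f2, F, -⟩ := hS
  have hd2 := hη' (y := c) (by rw [Real.dist_eq, sub_zero, abs_of_pos hc]; exact hcon.trans_le (min_le_left _ _))
  have hc1' : c < 1 := hcon.trans_le (min_le_right _ _)
  obtain ⟨μ, M, -⟩ := exists_mu G.hq hc hh hqh
  obtain ⟨l, hl, hl2⟩ := exists_l hc
  have hl3 : l ≤ 2 := by nlinarith
  obtain ⟨T, hT⟩ := F.exT (lt_min G.hδ hd0)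
  have H := F.hk G M (fun t ht => (hT t ht).trans (min_le_left _ _)) hl hl2
  have hanti := exp_anti (convex_Iic T) (-l) (fun t _ => F.t2.d1 t) (fun t ht => by linarith [H.up t ht])
  set d := (P - 1) / 2 with hdd
  have hηη : 0 < d - c ^ 2 / 4 ∨ True := Or.inr trivial
  have key : ∀ t ≤ T, f2 t ≤ c * f1 t - (d + c ^ 2 / 4) * f t := by
    intro t ht
    have hτ := M.hτ
    have h1 : Real.exp (-l * (c * h)) * f t ≤ f (t - c * h) := by
      have h2 : Real.exp (-l * t) * f t ≤ Real.exp (-l * (t - c * h)) * f (t - c * h) :=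
        hanti (mem_Iic.2 (by linarith)) (mem_Iic.2 ht) (by linarith)
      have e : Real.exp (-l * t) = Real.exp (-l * (t - c * h)) * Real.exp (-l * (c * h)) := by
        rw [← Real.exp_add]; ring_nf
      rw [e, mul_assoc] at h2
      exact le_of_mul_le_mul_left h2 (Real.exp_pos _)
    have h3 : Real.exp (-2 * (c * h)) ≤ Real.exp (-l * (c * h)) :=
      Real.exp_le_exp.2 (mul_le_mul_of_nonneg_right (by linarith) hτ)
    have h4 := mul_le_mul_of_nonneg_right h3 (F.pos t).le
    have hx := F.pos (t - c * h)
    have h5 := abs_le.1 (G.hol _ ⟨hx.le, (hT t ht).trans (min_le_left _ _)⟩)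
    have h6 := mul_le_mul_of_nonneg_right (hd _ hx.le ((hT t ht).trans (min_le_right _ _))) hx.le
    have h7 : P * f (t - c * h) ≤ g (f (t - c * h)) := by rw [hP]; linarith
    have h8 : P * (Real.exp (-2 * (c * h)) * f t) ≤ P * f (t - c * h) :=
      mul_le_mul_of_nonneg_left (h4.trans h1) (by linarith)
    have h9 := mul_pos hd2 (F.pos t)
    nlinarith [F.eq t]
  have hρ : ∀ t, HasDerivAt (fun t => f1 t / f t + d * t) ((f2 t * f t - f1 t * f1 t) / f t ^ 2 + d) t := by
    intro t
    refine ((F.t2.d2 t).div (F.t2.d1 t) (F.pos t).ne').add ?_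
    simpa using (hasDerivAt_id t).const_mul d
  have anti : AntitoneOn (fun t => f1 t / f t + d * t) (Iic T) :=
    antitoneOn_of_hasDerivWithinAt_nonpos (convex_Iic T)
      (fun t _ => (hρ t).continuousAt.continuousWithinAt)
      (fun t _ => (hρ t).hasDerivWithinAt)
      (fun t ht => by
        have h1 := key t (show t ∈ Iic T from interior_subset ht)
        have h2 : (f2 t * f t - f1 t * f1 t) / f t ^ 2 ≤ - d := by
          rw [div_le_iff₀ (by have := F.pos t; positivity)]
          have := mul_le_mul_of_nonneg_right h1 (F.pos t).le
          nlinarith [sq_nonneg (c / 2 * f t - f1 t)]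
        linarith)
  have hdpos : 0 < d := by rw [hdd]; linarith
  set t0 := min T ((f1 T / f T + d * T - l - 1) / d) with ht0
  have h1 : f1 T / f T + d * T ≤ f1 t0 / f t0 + d * t0 :=
    anti (mem_Iic.2 (min_le_left _ _)) (mem_Iic.2 le_rfl) (min_le_left _ _)
  have h2 : f1 t0 / f t0 ≤ l := by
    rw [div_le_iff₀ (F.pos _)]; exact H.up t0 (min_le_left _ _)
  have h3 : d * t0 ≤ f1 T / f T + d * T - l - 1 := by
    have := mul_le_mul_of_nonneg_left (min_le_right T ((f1 T / f T + d * T - l - 1) / d)) hdpos.le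
    rwa [mul_div_cancel₀ _ hdpos.ne'] at this
  linarith

def Zp (f : ℝ → ℝ) (ν : ℝ) : Prop := Tendsto (yy ν f) atBot (nhds 0)

lemma yy_add {σ t : ℝ} : yy (ν + σ) f t = Real.exp (-σ * t) * yy ν f t := by
  simp only [yy]; rw [← mul_assoc, ← Real.exp_add]; ring_nf

lemma Zp_mono (hf : ∀ t, 0 ≤ f t) {ν' : ℝ} (hν : ν' ≤ ν) (hz : Zp f ν) : Zp f ν' := by
  refine squeeze_zero' (Eventually.of_forall fun t => mul_nonneg (Real.exp_pos _).le (hf t)) ?_ hz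
  filter_upwards [eventually_le_atBot 0] with t ht
  exact mul_le_mul_of_nonneg_right (Real.exp_le_exp.2 (by nlinarith)) (hf t)

lemma Zp_of_bound (hf : ∀ t, 0 ≤ f t) {B σ σ' : ℝ} (hb : ∀ t ≤ T, yy ν f t ≤ B * Real.exp (σ * t))
    (hσ : σ' < σ) : Zp f (ν + σ') := by
  have h1 : Tendsto (fun t => B * Real.exp ((σ - σ') * t)) atBot (nhds 0) := by
    simpa using (tendsto_exp_mul_atBot (show 0 < σ - σ' by linarith)).const_mul B
  refine squeeze_zero' (Eventually.of_forall fun t => mul_nonneg (Real.exp_pos _).le (hf t)) ?_ h1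
  filter_upwards [eventually_le_atBot T] with t ht
  rw [yy_add]
  calc _ ≤ Real.exp (-σ' * t) * (B * Real.exp (σ * t)) :=
        mul_le_mul_of_nonneg_left (hb t ht) (Real.exp_pos _).le
    _ = B * (Real.exp (-σ' * t) * Real.exp (σ * t)) := by ring
    _ = _ := by rw [← Real.exp_add]; ring_nf

lemma gain_aux {y m m' : ℝ → ℝ} {C1 a C : ℝ} (hC1 : 0 ≤ C1) (ha : 0 < a) (hC : 0 < C)
    (hy : ∀ t, 0 ≤ y t)
    (hlo : ∀ s t, s ≤ t → y s ≤ Real.exp (C1 * (t - s)) * y t) (hd : ∀ t, HasDerivAt m (m' t) t)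
    (hm' : ∀ t ≤ T, a * y t ≤ m' t) (hm : ∀ t ≤ T, |m t| ≤ C * y t) (hm0 : Tendsto m atBot (nhds 0)) :
    ∃ B, ∀ t ≤ T - 1, y t ≤ B * Real.exp (a / C * t) := by
  have mono : MonotoneOn m (Iic T) :=
    monotoneOn_of_hasDerivWithinAt_nonneg (convex_Iic T)
      (fun t _ => (hd t).continuousAt.continuousWithinAt) (fun t _ => (hd t).hasDerivWithinAt)
      (fun t ht => (mul_nonneg ha.le (hy t)).trans (hm' t (show t ∈ Iic T from interior_subset ht)))
  have mn : ∀ t ≤ T, 0 ≤ m t := fun t ht => monoOn_bot mono hm0 ht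
  have em := exp_mono (convex_Iic T) (-(a / C)) (fun t _ => hd t) (fun t ht => by
    have h1 := hm' t ht
    have h2 : a / C * m t ≤ a / C * (C * y t) :=
      mul_le_mul_of_nonneg_left ((le_abs_self _).trans (hm t ht)) (by positivity)
    rw [← mul_assoc, div_mul_cancel₀ _ hC.ne'] at h2
    linarith)
  set D := Real.exp (-(a / C) * T) * m T
  have hD : ∀ t ≤ T, m t ≤ D * Real.exp (a / C * t) := fun t ht => by
    have h1 : Real.exp (-(a / C) * t) * m t ≤ D := em (mem_Iic.2 ht) (mem_Iic.2 le_rfl) ht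
    have := mul_le_mul_of_nonneg_left h1 (Real.exp_pos (a / C * t)).le
    rw [← mul_assoc, ← Real.exp_add, show a / C * t + -(a / C) * t = 0 by ring, Real.exp_zero] at this
    linarith
  refine ⟨Real.exp C1 / a * D * Real.exp (a / C), fun t ht => ?_⟩
  obtain ⟨s, hs, e⟩ := mvt hd (show t < t + 1 by linarith)
  have h1 := hm' s (by linarith [hs.2])
  have h2 := hlo t s hs.1.le
  have h3 : Real.exp (C1 * (s - t)) ≤ Real.exp C1 := Real.exp_le_exp.2 (by nlinarith [hs.2])
  have h4 := mul_le_mul_of_nonneg_right h3 (hy s)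
  have h5 := hD (t + 1) (by linarith)
  have h6 := mn t (by linarith)
  have h7 : y s ≤ D * Real.exp (a / C * (t + 1)) / a := by
    rw [le_div_iff₀ ha]; nlinarith
  calc y t ≤ Real.exp C1 * y s := h2.trans h4
    _ ≤ Real.exp C1 * (D * Real.exp (a / C * (t + 1)) / a) := mul_le_mul_of_nonneg_left h7 (Real.exp_pos _).le
    _ = _ := by rw [mul_add, mul_one, Real.exp_add]; ring

lemma Front.Rb (G : GH g κ q p L δ A γ ε0) (F : Front g κ c τ f f1 f2)
    (H : Hk μ l T f f1) (hν : ν ≤ l) (hν0 : 0 ≤ ν) (hτ : 0 ≤ τ) {t : ℝ} (ht : f (t - τ) ≤ δ) :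
    |Real.exp (-ν * t) * (f2 t - c * f1 t - f t + p * f (t - τ))| ≤
      Real.exp ((μ + l) * τ) * (A * f (t - τ) ^ γ) * yy ν f t := by
  have hx := F.pos (t - τ)
  have h1 := G.hol _ ⟨hx.le, ht⟩
  have h2 := F.eq t
  have h0 : 0 ≤ A * f (t - τ) ^ γ := mul_nonneg G.hA.le (Real.rpow_nonneg hx.le _)
  rw [show f2 t - c * f1 t - f t + p * f (t - τ) = -(g (f (t - τ)) - p * f (t - τ)) by linarith,
    abs_mul, abs_neg, abs_of_pos (Real.exp_pos _)]
  have h3 := H.yy_lo hν (show t - τ ≤ t by linarith)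
  rw [sub_sub_cancel] at h3
  have h4 : Real.exp (-ν * t) * f (t - τ) ≤ yy ν f (t - τ) :=
    mul_le_mul_of_nonneg_right (Real.exp_le_exp.2 (by nlinarith)) hx.le
  calc _ ≤ Real.exp (-ν * t) * (A * f (t - τ) ^ γ * f (t - τ)) := mul_le_mul_of_nonneg_left h1 (Real.exp_pos _).le
    _ = (A * f (t - τ) ^ γ) * (Real.exp (-ν * t) * f (t - τ)) := by ring
    _ ≤ (A * f (t - τ) ^ γ) * (Real.exp ((μ + l) * τ) * yy ν f t) := mul_le_mul_of_nonneg_left (h4.trans h3) h0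
    _ = _ := by ring

lemma Front.gain (G : GH g κ q p L δ A γ ε0) (M : MU q c τ μ) (F : Front g κ c τ f f1 f2)
    (hl : 0 < l) (hl2 : l ^ 2 - c * l - 1 = 0) : ∃ C > 0, ∀ ν, 0 ≤ ν → ν ≤ l → chi p c τ ν ≠ 0 → Zp f ν →
      Zp f (ν + |chi p c τ ν| / C) := by
  have hp := G.hp
  have hc := M.hc
  have hτ := M.hτ
  have hμ := M.hμ
  set CM := (μ + l) + (c + 2 * l) + p * (τ * Real.exp ((μ + l) * τ)) with hCM
  have hCM0 : 0 < CM := by positivity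
  refine ⟨4 * CM, by positivity, fun ν hν0 hν hχ hz => ?_⟩
  have ha : 0 < |chi p c τ ν| / 2 := by have := abs_pos.2 hχ; linarith
  obtain ⟨d, hd, hdp⟩ := small_pow G.hA G.hγ
    (show 0 < |chi p c τ ν| / 2 / Real.exp ((μ + l) * τ) by positivity)
  obtain ⟨T, hT⟩ := F.exT (lt_min G.hδ hd)
  have H := F.hk G M (fun t ht => (hT t ht).trans (min_le_left _ _)) hl hl2
  have hR : ∀ t ≤ T, |Real.exp (-ν * t) * (f2 t - c * f1 t - f t + p * f (t - τ))| ≤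
      |chi p c τ ν| / 2 * yy ν f t := fun t ht => by
    refine (F.Rb G H hν hν0 hτ ((hT t ht).trans (min_le_left _ _))).trans ?_
    refine mul_le_mul_of_nonneg_right ?_ (H.yy_nn t)
    have := hdp _ (F.pos (t - τ)).le ((hT t ht).trans (min_le_right _ _))
    rw [le_div_iff₀ (Real.exp_pos _)] at this
    linarith
  have hM : ∀ t ≤ T, |MM p c τ ν f f1 t| ≤ CM * yy ν f t := fun t ht =>
    H.MM_le hμ.le hν0 hν (by linarith) hc.le hτ ht
  have hM0 : Tendsto (MM p c τ ν f f1) atBot (nhds 0) := by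
    refine squeeze_zero_norm' ((eventually_le_atBot T).mono fun t ht => hM t ht) ?_
    have := Tendsto.const_mul CM hz
    rwa [mul_zero] at this
  have : ∃ B, ∀ t ≤ T - 1, yy ν f t ≤ B * Real.exp (|chi p c τ ν| / 2 / CM * t) := by
    rcases lt_or_gt_of_ne hχ with hneg | hpos
    · refine gain_aux (show 0 ≤ μ + l by linarith) ha hCM0 (H.yy_nn (ν := ν)) (fun s t hst => H.yy_lo hν hst)
        (fun t => MM_deriv F.t2 t) (fun t ht => ?_) hM hM0
      have := abs_le.1 (hR t ht)
      rw [abs_of_neg hneg] at this ⊢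
      linarith
    · refine gain_aux (show 0 ≤ μ + l by linarith) ha hCM0 (H.yy_nn (ν := ν)) (fun s t hst => H.yy_lo hν hst)
        (fun t => (MM_deriv (p := p) (c := c) (τ := τ) (ν := ν) F.t2 t).neg) (fun t ht => ?_) (fun t ht => ?_) ?_
      · have := abs_le.1 (hR t ht)
        rw [abs_of_pos hpos] at this ⊢
        linarith
      · rw [Pi.neg_apply, abs_neg]; exact hM t ht
      · have := hM0.neg; rwa [neg_zero] at this
  obtain ⟨B, hB⟩ := this
  refine Zp_of_bound (fun t => (F.pos t).le) hB ?_
  rw [div_div]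
  exact div_lt_div_of_pos_left (abs_pos.2 hχ) (by positivity) (by linarith)

lemma Front.exists_lam (G : GH g κ q p L δ A γ ε0) (M : MU q c τ μ) (F : Front g κ c τ f f1 f2)
    (hl : 0 < l) (hl2 : l ^ 2 - c * l - 1 = 0) : ∃ lam, 0 < lam ∧ lam ≤ l ∧ chi p c τ lam = 0 ∧
      (∀ ν < lam, Zp f ν) ∧ ∀ ν > lam, ¬ Zp f ν := by
  have hnn : ∀ t, 0 ≤ f t := fun t => (F.pos t).le
  obtain ⟨C, hC, hgain⟩ := F.gain G M hl hl2
  have h0 : Zp f 0 := by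
    have : yy 0 f = f := by funext t; simp [yy]
    unfold Zp; rw [this]; exact F.lim0
  have hb : ∀ ν, Zp f ν → ν ≤ l := by
    intro ν hz
    by_contra hcon
    push Not at hcon
    have hz' := Zp_mono hnn hcon.le hz
    obtain ⟨T, hT⟩ := F.exT G.hδ
    have H := F.hk G M hT hl hl2
    have hanti := exp_anti (convex_Iic T) (-l) (fun t _ => F.t2.d1 t) (fun t ht => by linarith [H.up t ht])
    have := antiOn_bot hanti hz' (le_refl T)
    have h2 := mul_pos (Real.exp_pos (-l * T)) (F.pos T)
    linarith
  have hbdd : BddAbove {ν | Zp f ν} := ⟨l, fun ν hν => hb ν hν⟩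
  set lam := sSup {ν | Zp f ν} with hlam
  have hl0 : 0 ≤ lam := le_csSup hbdd h0
  have hll : lam ≤ l := csSup_le ⟨0, h0⟩ fun ν hν => hb ν hν
  have hχ : chi p c τ lam = 0 := by
    by_contra hne
    have hcont : Continuous fun ν => ν + |chi p c τ ν| / C := by unfold chi; fun_prop
    have hgt : lam < lam + |chi p c τ lam| / C := by have := abs_pos.2 hne; linarith [div_pos this hC]
    have hcont2 : Continuous fun ν => |chi p c τ ν| := by unfold chi; fun_prop
    obtain ⟨e, he, h1⟩ := Metric.eventually_nhds_iff.1 ((hcont.continuousAt.eventually (lt_mem_nhds hgt)).and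
      (hcont2.continuousAt.eventually (lt_mem_nhds (abs_pos.2 hne))))
    obtain ⟨ν, hν, hνl⟩ := exists_lt_of_lt_csSup (s := {ν | Zp f ν}) ⟨0, h0⟩ (show lam - e < lam by linarith)
    have hmem : Zp f (max ν 0) := by
      rcases max_choice ν 0 with h | h <;> rw [h]
      · exact hν
      · exact h0
    have hle : max ν 0 ≤ lam := le_csSup hbdd hmem
    have h2 := h1 (y := max ν 0) (by
      rw [Real.dist_eq, abs_lt]; constructor <;> linarith [le_max_left ν 0])
    have := hgain _ (le_max_right _ _) (hle.trans hll) (abs_pos.1 h2.2) hmem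
    have := le_csSup hbdd this
    linarith [h2.1]
  refine ⟨lam, lt_of_le_of_ne hl0 fun h => ?_, hll, hχ, fun ν hν => ?_, fun ν hν hz => ?_⟩
  · rw [← h] at hχ
    have : chi p c τ 0 = p - 1 := by simp [chi]; ring
    linarith [G.hp]
  · obtain ⟨ν', hν', hlt⟩ := exists_lt_of_lt_csSup (s := {ν | Zp f ν}) ⟨0, h0⟩ hν
    exact Zp_mono hnn hlt.le hν'
  · have := le_csSup hbdd hz
    linarith
end


section
variable {g : ℝ → ℝ} {κ q p L δ A γ ε0 c τ μ h l T ν lam : ℝ} {f f1 f2 u u1 u2 v v1 v2 : ℝ → ℝ}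

lemma Front.Mlim (G : GH g κ q p L δ A γ ε0) (M : MU q c τ μ) (F : Front g κ c τ f f1 f2)
    (hl : 0 < l) (hl2 : l ^ 2 - c * l - 1 = 0) (h0 : 0 < lam) (hll : lam ≤ l) (hχ : chi p c τ lam = 0)
    (hz : ∀ ν < lam, Zp f ν) : ∃ T M0 B σ, T ≤ 0 ∧ 0 < σ ∧ Hk μ l T f f1 ∧
      ∀ t ≤ T, |MM p c τ lam f f1 t - M0| ≤ B * Real.exp (σ * t) := by
  have hγ := G.hγ
  have hτ := M.hτ
  set ε := γ * lam / (2 * (1 + γ)) with hε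
  have hε0 : 0 < ε := by positivity
  have hεl : ε < lam := by
    rw [hε, div_lt_iff₀ (by positivity)]; nlinarith [mul_pos hγ h0]
  have hεe : ε * (1 + γ) = γ * lam / 2 := by rw [hε]; field_simp
  obtain ⟨T1, hT1⟩ := F.exT (τ := τ) G.hδ
  obtain ⟨T2, hT2⟩ := eventually_atBot.1 ((hz (lam - ε) (by linarith)).eventually (gt_mem_nhds (zero_lt_one' ℝ)))
  set T := min (min T1 T2) 0
  have hTT1 : T ≤ T1 := (min_le_left _ _).trans (min_le_left _ _)
  have hTT2 : T ≤ T2 := (min_le_left _ _).trans (min_le_right _ _)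
  have H := F.hk G M (fun t ht => hT1 t (ht.trans hTT1)) hl hl2
  have hf : ∀ t ≤ T2, f t ≤ Real.exp ((lam - ε) * t) := fun t ht => by
    have h1 := hT2 t ht
    have h2 : yy (lam - ε) f t * Real.exp ((lam - ε) * t) = f t := by
      rw [yy, mul_right_comm, ← Real.exp_add, show -(lam - ε) * t + (lam - ε) * t = 0 by ring]; simp
    have := Real.exp_pos ((lam - ε) * t)
    nlinarith
  obtain ⟨M0, hM0⟩ := lim_of_deriv (M := MM p c τ lam f f1) (σ := γ * lam / 2) (T := T)
    (B := Real.exp ((μ + l) * τ) * A) (by positivity) (fun t => MM_deriv F.t2 t) (fun t ht => by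
      rw [hχ, zero_mul, sub_zero]
      refine (F.Rb G H hll h0.le hτ (hT1 t (ht.trans hTT1))).trans ?_
      have h1 : f (t - τ) ^ γ ≤ Real.exp (γ * (lam - ε) * t) := by
        have h2 : f (t - τ) ≤ Real.exp ((lam - ε) * t) :=
          (hf (t - τ) (by linarith)).trans (Real.exp_le_exp.2 (by nlinarith))
        have h3 := Real.rpow_le_rpow (F.pos _).le h2 hγ.le
        rw [← Real.exp_mul] at h3
        rwa [show γ * (lam - ε) * t = (lam - ε) * t * γ by ring]
      have h2 : yy lam f t ≤ Real.exp (-ε * t) := by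
        have h3 : yy lam f t = Real.exp (-ε * t) * yy (lam - ε) f t := by
          rw [← yy_add]; ring_nf
        have h4 := hT2 t (ht.trans hTT2)
        have := Real.exp_pos (-ε * t)
        rw [h3]; nlinarith
      have h5 : f (t - τ) ^ γ * yy lam f t ≤ Real.exp (γ * lam / 2 * t) := by
        refine (mul_le_mul h1 h2 (H.yy_nn t) (Real.exp_pos _).le).trans (le_of_eq ?_)
        rw [← Real.exp_add]; congr 1
        linear_combination -t * hεe
      have hA : 0 ≤ Real.exp ((μ + l) * τ) * A := mul_nonneg (Real.exp_pos _).le G.hA.le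
      calc _ = Real.exp ((μ + l) * τ) * A * (f (t - τ) ^ γ * yy lam f t) := by ring
        _ ≤ _ := mul_le_mul_of_nonneg_left h5 hA)
  exact ⟨T, M0, _, γ * lam / 2, min_le_right _ _, by positivity, H, hM0⟩

def bet (p c τ ν : ℝ) : ℝ := c - 2 * ν + p * Real.exp (-ν * τ) * τ

lemma Nbound (hp : 0 < p) (hτ : 0 ≤ τ) (hμ : 0 ≤ μ) (hl : 0 < l) (h0 : 0 < lam) (hll : lam ≤ l)
    (H : Hk μ l T f f1) (hb : bet p c τ lam ≠ 0) (hz : ∀ ν < lam, Zp f ν) :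
    ∃ a > 0, ∀ σ B, 0 ≤ σ → σ < a → (∀ t ≤ T, |MM p c τ lam f f1 t| ≤ B * Real.exp (σ * t)) →
      ∃ C, ∀ t ≤ T, NN p τ lam f t ≤ C * Real.exp (σ * t) := by
  set CN := 1 + p * (τ * τ * Real.exp ((μ + l) * τ)) with hCN
  have hCN0 : 0 < CN := by positivity
  have hN := H.NN_le hμ h0.le hll hp.le hτ (p := p)
  refine ⟨|bet p c τ lam| / CN, div_pos (abs_pos.2 hb) hCN0, fun σ B hσ hσa hM => ?_⟩
  have hy : ∀ t, |bet p c τ lam| / CN * NN p τ lam f t ≤ |bet p c τ lam| * yy lam f t := fun t => by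
    have := mul_le_mul_of_nonneg_left (hN t).2 (show 0 ≤ |bet p c τ lam| / CN by positivity)
    rwa [← mul_assoc, div_mul_cancel₀ _ hCN0.ne'] at this
  have hd := fun t => NN_deriv (p := p) (c := c) (τ := τ) (ν := lam) H.d t
  rcases lt_or_gt_of_ne hb with hneg | hpos
  · refine DIminus (B := B) (div_pos (abs_pos.2 hb) hCN0) hσ hd (fun t ht => ?_) ?_
    · have h1 := hy t
      have h2 := (abs_le.1 (hM t ht)).2
      rw [abs_of_neg hneg] at h1 ⊢
      change bet p c τ lam * _ + _ ≤ _
      linarith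
    · set a := |bet p c τ lam| / CN
      have ha : 0 < a := div_pos (abs_pos.2 hb) hCN0
      have hz' := (hz (lam - a) (by linarith)).const_mul CN
      rw [mul_zero] at hz'
      refine squeeze_zero (fun t => mul_nonneg (Real.exp_pos _).le ((H.yy_nn t).trans (hN t).1)) (fun t => ?_) hz'
      have e : yy (lam - a) f t = Real.exp (a * t) * yy lam f t := by
        rw [sub_eq_add_neg, yy_add, neg_neg]
      rw [e]
      have := mul_le_mul_of_nonneg_left (hN t).2 (Real.exp_pos (a * t)).le
      linarith
  · refine DIplus (B := B) hσa hd (fun t ht => ?_)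
    have h1 := hy t
    have h2 := (abs_le.1 (hM t ht)).1
    rw [abs_of_pos hpos] at h1 ⊢
    change _ ≤ bet p c τ lam * _ + _
    linarith

def lB (p τ lam : ℝ) (w : ℝ → ℝ) (_ : ℝ → ℝ) (t : ℝ) : ℝ := NN p τ lam w t / (-t)
def lC (p τ lam : ℝ) (w : ℝ → ℝ) (_ : ℝ → ℝ) (t : ℝ) : ℝ := NN p τ lam w t

def Ty (p c τ lam : ℝ) (ll : (ℝ → ℝ) → (ℝ → ℝ) → ℝ → ℝ) (E : ℝ → ℝ) : Prop :=
  (bet p c τ lam ≠ 0 ∧ ll = MM p c τ lam ∧ E = fun t => Real.exp (lam * t)) ∨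
  (bet p c τ lam = 0 ∧ ll = lB p τ lam ∧ E = fun t => -t * Real.exp (lam * t)) ∨
  (bet p c τ lam = 0 ∧ ll = lC p τ lam ∧ E = fun t => Real.exp (lam * t))

def Has (ll : (ℝ → ℝ) → (ℝ → ℝ) → ℝ → ℝ) (E : ℝ → ℝ) (f f1 : ℝ → ℝ) : Prop :=
  ∃ a, a ≠ 0 ∧ Tendsto (ll f f1) atBot (nhds a) ∧ ∃ C, 0 < C ∧ ∀ᶠ t in atBot, f t ≤ C * E t

lemma f_of_yy (t : ℝ) : f t = Real.exp (lam * t) * yy lam f t := by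
  rw [yy, ← mul_assoc, ← Real.exp_add, show lam * t + -lam * t = 0 by ring]; simp

lemma tendsto_of_expb {m : ℝ → ℝ} {a B σ : ℝ} (hσ : 0 < σ) (h : ∀ t ≤ T, |m t - a| ≤ B * Real.exp (σ * t)) :
    Tendsto m atBot (nhds a) := by
  rw [tendsto_iff_norm_sub_tendsto_zero]
  have h1 : Tendsto (fun t => B * Real.exp (σ * t)) atBot (nhds 0) := by
    simpa using (tendsto_exp_mul_atBot hσ).const_mul B
  exact squeeze_zero' (Eventually.of_forall fun t => norm_nonneg _)
    ((eventually_le_atBot T).mono fun t ht => h t ht) h1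

lemma Front.has (G : GH g κ q p L δ A γ ε0) (M : MU q c τ μ) (F : Front g κ c τ f f1 f2)
    (hl : 0 < l) (hl2 : l ^ 2 - c * l - 1 = 0) : ∃ lam ll E, 0 < lam ∧ lam ≤ l ∧ Ty p c τ lam ll E ∧
      Has ll E f f1 := by
  obtain ⟨lam, h0, hll, hχ, hz, hnz⟩ := F.exists_lam G M hl hl2
  obtain ⟨T, M0, B, σ, hT0, hσ, H, hM⟩ := F.Mlim G M hl hl2 h0 hll hχ hz
  have hp : 0 < p := by linarith [G.hp]
  have hfn : ∀ t, 0 ≤ f t := fun t => (F.pos t).le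
  have hN := H.NN_le M.hμ.le h0.le hll hp.le M.hτ (p := p)
  have hNf : ∀ t, f t ≤ NN p τ lam f t * Real.exp (lam * t) := fun t => by
    rw [f_of_yy (f := f) (lam := lam) t, mul_comm]
    exact mul_le_mul_of_nonneg_right (hN t).1 (Real.exp_pos _).le
  have key : ∀ C s, 0 < s → (∀ t ≤ T, NN p τ lam f t ≤ C * Real.exp (s * t)) → False := by
    intro C s hs hb
    refine hnz (lam + s / 2) (by linarith) (Zp_of_bound hfn (B := C) (σ := s) (T := T) (fun t ht => ?_) (by linarith))
    exact (hN t).1.trans (hb t ht)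
  have hMl : Tendsto (MM p c τ lam f f1) atBot (nhds M0) := tendsto_of_expb hσ hM
  have hB0 : 0 ≤ B := by
    have := (abs_nonneg _).trans (hM T le_rfl)
    exact nonneg_of_mul_nonneg_left this (Real.exp_pos _)
  by_cases hb : bet p c τ lam = 0
  · have hd : ∀ t, HasDerivAt (NN p τ lam f) (MM p c τ lam f f1 t) t := fun t => by
      refine (NN_deriv (c := c) H.d t).congr_deriv ?_
      have : c - 2 * lam + p * Real.exp (-lam * τ) * τ = 0 := hb
      rw [this]; ring
    by_cases hM0 : M0 = 0
    · subst hM0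
      simp only [sub_zero] at hM
      obtain ⟨N0, hN0⟩ := lim_of_deriv hσ hd hM
      have hlim : Tendsto (NN p τ lam f) atBot (nhds N0) := tendsto_of_expb hσ hN0
      refine ⟨lam, lC p τ lam, fun t => Real.exp (lam * t), h0, hll, Or.inr (Or.inr ⟨hb, rfl, rfl⟩), N0, ?_, hlim,
        |N0| + 1, by positivity, ?_⟩
      · rintro rfl
        simp only [sub_zero] at hN0
        exact key _ σ hσ fun t ht => (le_abs_self _).trans (hN0 t ht)
      · filter_upwards [hlim.eventually (gt_mem_nhds (show N0 < |N0| + 1 by linarith [le_abs_self N0]))] with t ht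
        exact (hNf t).trans (mul_le_mul_of_nonneg_right ht.le (Real.exp_pos _).le)
    · obtain ⟨N0, hN0⟩ := lim_of_deriv (M := fun t => NN p τ lam f t - t * M0) hσ
        (fun t => (hd t).sub ((hasDerivAt_id t).mul_const M0)) (fun t ht => by simpa using hM t ht)
      have hl1 : Tendsto (fun t => NN p τ lam f t - t * M0) atBot (nhds N0) := tendsto_of_expb hσ hN0
      have hl2 : Tendsto (lB p τ lam f f1) atBot (nhds (-M0)) := by
        have h1 := (hl1.mul (tendsto_inv_atBot_zero (𝕜 := ℝ))).neg.add_const (-M0)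
        rw [mul_zero, neg_zero, zero_add] at h1
        refine h1.congr' ?_
        filter_upwards [eventually_lt_atBot 0] with t ht
        have := ht.ne
        unfold lB
        field_simp
        ring
      refine ⟨lam, lB p τ lam, _, h0, hll, Or.inr (Or.inl ⟨hb, rfl, rfl⟩), -M0, neg_ne_zero.2 hM0, hl2,
        |M0| + 1, by positivity, ?_⟩
      filter_upwards [hl2.eventually (gt_mem_nhds (show -M0 < |M0| + 1 by linarith [neg_le_abs M0])),
        eventually_lt_atBot 0] with t ht ht0
      unfold lB at ht
      rw [div_lt_iff₀ (by linarith)] at ht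
      refine (hNf t).trans ?_
      have := mul_le_mul_of_nonneg_right ht.le (Real.exp_pos (lam * t)).le
      linarith
  · obtain ⟨a, ha, hNb⟩ := Nbound hp M.hτ M.hμ.le hl h0 hll H hb hz
    obtain ⟨C, hC⟩ := hNb 0 (|M0| + B) le_rfl ha (fun t ht => by
      have h1 := hM t ht
      have h2 : Real.exp (σ * t) ≤ 1 := Real.exp_le_one_iff.2 (by nlinarith)
      have h3 := abs_sub_abs_le_abs_sub (MM p c τ lam f f1 t) M0
      simp
      nlinarith)
    refine ⟨lam, MM p c τ lam, _, h0, hll, Or.inl ⟨hb, rfl, rfl⟩, M0, ?_, hMl, |C| + 1, by positivity, ?_⟩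
    · rintro rfl
      simp only [sub_zero] at hM
      have hs : 0 < min σ (a / 2) := lt_min hσ (by linarith)
      obtain ⟨C', hC'⟩ := hNb (min σ (a / 2)) B hs.le (lt_of_le_of_lt (min_le_right _ _) (by linarith))
        (fun t ht => (hM t ht).trans (mul_le_mul_of_nonneg_left
          (Real.exp_le_exp.2 (mul_le_mul_of_nonpos_right (min_le_left _ _) (by linarith))) hB0))
      exact key C' _ hs hC'
    · filter_upwards [eventually_le_atBot T] with t ht
      have h1 := hC t ht
      simp at h1
      exact (hNf t).trans (mul_le_mul_of_nonneg_right (by linarith [le_abs_self C]) (Real.exp_pos _).le)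
end


structure Fn (μ l lam : ℝ) (ll : (ℝ → ℝ) → (ℝ → ℝ) → ℝ → ℝ) (E : ℝ → ℝ) : Prop where
  sub : ∀ w v w1 v1 : ℝ → ℝ, Continuous w → Continuous v → ∀ t,
    ll (fun t => w t - v t) (fun t => w1 t - v1 t) t = ll w w1 t - ll v v1 t
  shift : ∀ (w w1 : ℝ → ℝ) (a s : ℝ), Tendsto (ll w w1) atBot (nhds a) →
    Tendsto (ll (fun t => w (t + s)) (fun t => w1 (t + s))) atBot (nhds (Real.exp (lam * s) * a))
  bd : ∃ C > 0, ∀ T w w1, Hk μ l T w w1 → ∀ᶠ t in atBot, |ll w w1 t| * E t ≤ C * w t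
  pos : ∀ᶠ t in atBot, 0 < E t
  sh : ∀ s, ∀ᶠ t in atBot, E (t + s) ≤ 2 * Real.exp (lam * s) * E t

def Oo (E E' : ℝ → ℝ) : Prop := ∀ η > 0, ∀ᶠ t in atBot, E t ≤ η * E' t

section
variable {g : ℝ → ℝ} {κ q p L δ A γ ε0 c τ μ h l T ν lam lam' : ℝ} {f f1 f2 u u1 u2 v v1 v2 E E' : ℝ → ℝ}
  {ll ll' : (ℝ → ℝ) → (ℝ → ℝ) → ℝ → ℝ}

lemma exp_sh (s t : ℝ) : Real.exp (lam * (t + s)) = Real.exp (lam * s) * Real.exp (lam * t) := by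
  rw [← Real.exp_add]; ring_nf

lemma Ty.fn (hp : 0 < p) (hc : 0 < c) (hτ : 0 ≤ τ) (hμ : 0 ≤ μ) (hl : 0 < l) (h0 : 0 < lam) (hll : lam ≤ l)
    (H : Ty p c τ lam ll E) : Fn μ l lam ll E := by
  have tsh : ∀ s : ℝ, Tendsto (fun t : ℝ => t + s) atBot atBot := fun s =>
    tendsto_atBot_add_const_right _ s tendsto_id
  have hexp : ∀ s, ∀ᶠ t : ℝ in atBot, Real.exp (lam * (t + s)) ≤ 2 * Real.exp (lam * s) * Real.exp (lam * t) :=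
    fun s => Eventually.of_forall fun t => by
      rw [exp_sh]; have := mul_pos (Real.exp_pos (lam * s)) (Real.exp_pos (lam * t)); linarith
  have hNb : ∀ T w w1, Hk μ l T w w1 → ∀ t, |NN p τ lam w t| * Real.exp (lam * t) ≤
      (1 + p * (τ * τ * Real.exp ((μ + l) * τ))) * w t := fun T w w1 H t => by
    have h1 := H.NN_le hμ h0.le hll hp.le hτ t (p := p)
    rw [abs_of_nonneg ((H.yy_nn t).trans h1.1), f_of_yy (f := w) (lam := lam) t]
    have := mul_le_mul_of_nonneg_right h1.2 (Real.exp_pos (lam * t)).le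
    linarith
  rcases H with ⟨-, rfl, rfl⟩ | ⟨-, rfl, rfl⟩ | ⟨-, rfl, rfl⟩
  · refine ⟨fun w v w1 v1 hw hv t => MM_sub hw hv t, fun w w1 a s hL => ?_,
      ⟨(μ + l) + (c + 2 * l) + p * (τ * Real.exp ((μ + l) * τ)), by positivity, fun T w w1 H => ?_⟩,
      Eventually.of_forall fun t => Real.exp_pos _, hexp⟩
    · refine ((hL.comp (tsh s)).const_mul (Real.exp (lam * s))).congr fun t => ?_
      exact (MM_shift s t).symm
    · filter_upwards [eventually_le_atBot T] with t ht
      have h1 := H.MM_le hμ h0.le hll hp.le hc.le hτ ht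
      rw [f_of_yy (f := w) (lam := lam) t]
      have := mul_le_mul_of_nonneg_right h1 (Real.exp_pos (lam * t)).le
      linarith
  · refine ⟨fun w v w1 v1 hw hv t => ?_, fun w w1 a s hL => ?_,
      ⟨(1 + p * (τ * τ * Real.exp ((μ + l) * τ))), by positivity, fun T w w1 H => ?_⟩, ?_, fun s => ?_⟩
    · simp only [lB]; rw [NN_sub hw hv, sub_div]
    · have h1 : Tendsto (fun t : ℝ => 1 + s * t⁻¹) atBot (nhds 1) := by
        simpa using ((tendsto_inv_atBot_zero (𝕜 := ℝ)).const_mul s).const_add 1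
      have h2 := ((hL.comp (tsh s)).mul h1).const_mul (Real.exp (lam * s))
      rw [mul_one] at h2
      refine h2.congr' ?_
      filter_upwards [eventually_lt_atBot 0, eventually_lt_atBot (-s)] with t ht hts
      have := ht.ne
      have : t + s ≠ 0 := by linarith
      simp only [lB, Function.comp, NN_shift]
      field_simp
    · filter_upwards [eventually_lt_atBot 0] with t ht
      have h1 := hNb T w w1 H t
      have h2 : |lB p τ lam w w1 t| * (-t * Real.exp (lam * t)) = |NN p τ lam w t| * Real.exp (lam * t) := by
        rw [lB, abs_div, abs_of_pos (show 0 < -t by linarith)]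
        have := ht.ne
        field_simp
      rw [h2]; exact h1
    · filter_upwards [eventually_lt_atBot 0] with t ht
      exact mul_pos (by linarith) (Real.exp_pos _)
    · filter_upwards [eventually_lt_atBot s] with t ht
      rw [exp_sh]
      have := mul_pos (Real.exp_pos (lam * s)) (Real.exp_pos (lam * t))
      nlinarith
  · refine ⟨fun w v w1 v1 hw hv t => NN_sub hw hv t, fun w w1 a s hL => ?_,
      ⟨(1 + p * (τ * τ * Real.exp ((μ + l) * τ))), by positivity, fun T w w1 H => ?_⟩,
      Eventually.of_forall fun t => Real.exp_pos _, hexp⟩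
    · refine ((hL.comp (tsh s)).const_mul (Real.exp (lam * s))).congr fun t => ?_
      exact (NN_shift s t).symm
    · exact Eventually.of_forall fun t => hNb T w w1 H t

lemma negt_exp {a : ℝ} (ha : 0 < a) : Tendsto (fun t : ℝ => -t * Real.exp (a * t)) atBot (nhds 0) := by
  have h := (Real.tendsto_pow_mul_exp_neg_atTop_nhds_zero 1).comp
    (tendsto_neg_atBot_atTop.const_mul_atTop ha)
  have h2 := h.const_mul (1 / a)
  rw [mul_zero] at h2
  refine h2.congr fun t => ?_
  simp only [Function.comp, pow_one]
  rw [show -(a * -t) = a * t by ring]; field_simp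

lemma Oo_exp (hlt : lam' < lam) (h1 : ∀ᶠ t in atBot, E t ≤ -t * Real.exp (lam * t))
    (h2 : ∀ᶠ t in atBot, Real.exp (lam' * t) ≤ E' t) : Oo E E' := by
  intro η hη
  filter_upwards [h1, h2, (negt_exp (show 0 < lam - lam' by linarith)).eventually (gt_mem_nhds hη)] with t h1 h2 h3
  calc E t ≤ -t * Real.exp (lam * t) := h1
    _ = -t * Real.exp ((lam - lam') * t) * Real.exp (lam' * t) := by
      rw [mul_assoc, ← Real.exp_add]; ring_nf
    _ ≤ η * Real.exp (lam' * t) := mul_le_mul_of_nonneg_right h3.le (Real.exp_pos _).le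
    _ ≤ η * E' t := mul_le_mul_of_nonneg_left h2 hη.le

lemma Ty.le (H : Ty p c τ lam ll E) : (∀ᶠ t in atBot, E t ≤ -t * Real.exp (lam * t)) ∧
    ∀ᶠ t in atBot, Real.exp (lam * t) ≤ E t := by
  have h : ∀ᶠ t : ℝ in atBot, Real.exp (lam * t) ≤ -t * Real.exp (lam * t) := by
    filter_upwards [eventually_lt_atBot (-1)] with t ht
    have := Real.exp_pos (lam * t); nlinarith
  rcases H with ⟨-, rfl, rfl⟩ | ⟨-, rfl, rfl⟩ | ⟨-, rfl, rfl⟩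
  · exact ⟨h, Eventually.of_forall fun t => le_rfl⟩
  · exact ⟨Eventually.of_forall fun t => le_rfl, h⟩
  · exact ⟨h, Eventually.of_forall fun t => le_rfl⟩

lemma Ty.trich (H : Ty p c τ lam ll E) (H' : Ty p c τ lam' ll' E') :
    (lam = lam' ∧ ll = ll' ∧ E = E') ∨ Oo E E' ∨ Oo E' E := by
  rcases lt_trichotomy lam lam' with h | h | h
  · exact Or.inr (Or.inr (Oo_exp h H'.le.1 H.le.2))
  · subst h
    have key : Oo (fun t => Real.exp (lam * t)) (fun t => -t * Real.exp (lam * t)) := by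
      intro η hη
      filter_upwards [eventually_lt_atBot (-(1 / η))] with t ht
      have h2 : 1 ≤ η * -t := by
        rw [mul_comm, ← div_le_iff₀ hη]; linarith
      have := Real.exp_pos (lam * t)
      nlinarith
    rcases H with ⟨h, rfl, rfl⟩ | ⟨h, rfl, rfl⟩ | ⟨h, rfl, rfl⟩ <;>
    rcases H' with ⟨h', rfl, rfl⟩ | ⟨h', rfl, rfl⟩ | ⟨h', rfl, rfl⟩
    · exact Or.inl ⟨rfl, rfl, rfl⟩
    · exact absurd h' h
    · exact absurd h' h
    · exact absurd h h'
    · exact Or.inl ⟨rfl, rfl, rfl⟩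
    · exact Or.inr (Or.inr key)
    · exact absurd h h'
    · exact Or.inr (Or.inl key)
    · exact Or.inl ⟨rfl, rfl, rfl⟩
  · exact Or.inr (Or.inl (Oo_exp h H.le.1 H'.le.2))

lemma Has.lower (N : Fn μ l lam ll E) (S : Has ll E f f1) (H : Hk μ l T f f1) :
    ∃ C > 0, ∀ᶠ t in atBot, E t ≤ C * f t := by
  obtain ⟨a, ha, hL, -⟩ := S
  obtain ⟨C, hC, hb⟩ := N.bd
  have ha' := abs_pos.2 ha
  refine ⟨C / (|a| / 2), by positivity, ?_⟩
  filter_upwards [hb T f f1 H, N.pos, hL.abs.eventually (lt_mem_nhds (show |a| / 2 < |a| by linarith))] with t h1 h2 h3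
  rw [div_mul_eq_mul_div, le_div_iff₀ (by positivity)]
  nlinarith
end


section
variable {g : ℝ → ℝ} {κ q p L δ A γ ε0 c τ μ h l T ν lam lam' : ℝ} {f f1 f2 u u1 u2 v v1 v2 E E' : ℝ → ℝ}
  {ll ll' : (ℝ → ℝ) → (ℝ → ℝ) → ℝ → ℝ}

lemma CL_half (G : GH g κ q p L δ A γ ε0) (M : MU q c τ μ) (U : Sol g κ c τ u u1 u2)
    (V : Sol g κ c τ v v1 v2) (h1 : ∀ t ≤ T, u t ≤ v t) (h2 : ∀ t, T ≤ t → κ - ε0 ≤ v t)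
    {m : ℝ} (hm : 0 ≤ m) (hb : ∀ t, u t - v t ≤ m) (t : ℝ) : u t - v t ≤ m / 2 := by
  have hq := M.hq
  set k := m / (2 * (1 + q)) with hk
  have hk0 : 0 ≤ k := by positivity
  have hk1 : k * (1 + q) = m / 2 := by rw [hk]; field_simp
  have hw : ∀ t, |v t - u t| ≤ κ := fun t => by
    rw [abs_le]; constructor <;> linarith [(V.rng t).1, (V.rng t).2, (U.rng t).1, (U.rng t).2]
  have hz : ∀ t, |v t - u t + k| ≤ κ + k := fun t => (abs_add_le _ _).trans (by
    rw [abs_of_nonneg hk0]; linarith [hw t])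
  have H := (V.t2.sub U.t2).addc k
  have hψ := M.mp H hz (B1 := 2 * (2 * κ + |c| * (2 * κ) + (κ + L * κ)))
    (fun t => (abs_sub _ _).trans (by linarith [V.f1b G t, U.f1b G t])) (fun t => by
      have e1 := U.eq t
      have e2 := V.eq t
      have key : (g (u (t - τ)) + q * u (t - τ)) - (g (v (t - τ)) + q * v (t - τ)) ≤ m / 2 := by
        rcases le_total (u (t - τ)) (v (t - τ)) with hle | hle
        · have := G.mono _ _ (U.rng (t - τ)).1 hle (V.rng (t - τ)).2
          linarith
        · rcases le_total (t - τ) T with ht | ht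
          · have : u (t - τ) = v (t - τ) := le_antisymm (h1 _ ht) hle
            rw [this]; linarith
          · have hv := h2 _ ht
            have := G.kap _ ⟨hv.trans hle, (U.rng (t - τ)).2⟩ _ ⟨hv, (V.rng (t - τ)).2⟩
            rw [abs_of_nonneg (sub_nonneg.2 hle)] at this
            have := (le_abs_self _).trans this
            linarith [hb (t - τ)]
      nlinarith)
  have h3 := nonneg_of_psi M.hμ H.d1 hz hψ t
  have : k ≤ m / 2 := by nlinarith
  linarith

lemma CL (G : GH g κ q p L δ A γ ε0) (M : MU q c τ μ) (U : Sol g κ c τ u u1 u2)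
    (V : Sol g κ c τ v v1 v2) (h1 : ∀ t ≤ T, u t ≤ v t) (h2 : ∀ t, T ≤ t → κ - ε0 ≤ v t) (t : ℝ) :
    u t ≤ v t := by
  have hκ := G.hκ
  have h : ∀ n : ℕ, ∀ t, u t - v t ≤ κ * (1 / 2) ^ n := by
    intro n
    induction n with
    | zero => intro t; simp; linarith [(U.rng t).2, (V.rng t).1]
    | succ n ih =>
      intro t
      have := CL_half G M U V h1 h2 (by positivity) ih t
      rw [pow_succ]; linarith
  have hl : Tendsto (fun n : ℕ => κ * (1 / 2 : ℝ) ^ n) atTop (nhds 0) := by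
    simpa using (tendsto_pow_atTop_nhds_zero_of_lt_one (by norm_num : (0:ℝ) ≤ 1 / 2) (by norm_num)).const_mul κ
  have := ge_of_tendsto' hl (fun n => h n t)
  linarith

lemma slide (G : GH g κ q p L δ A γ ε0) (M : MU q c τ μ) (hu : Continuous u) (hv : Continuous v)
    (hlt : ∀ t, u t < v t) (hv1 : Tendsto v atTop (nhds κ)) (T0 : ℝ) :
    ∃ m > 0, ∀ x x1 x2 y y1 y2, Sol g κ c τ x x1 x2 → Sol g κ c τ y y1 y2 → (∀ t, x t ≤ u t + m) →
      (∀ t, v t - m ≤ y t) → (∀ t ≤ T0, x t ≤ y t) → ∀ t, x t ≤ y t := by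
  have hε := G.hε
  obtain ⟨T1, hT1⟩ := eventually_atTop.1 (hv1.eventually (lt_mem_nhds (show κ - ε0 / 2 < κ by linarith)))
  set T2 := max T0 T1
  obtain ⟨t0, ht0, hmin⟩ := (isCompact_Icc (a := T0) (b := T2)).exists_isMinOn
    ⟨T0, le_rfl, le_max_left _ _⟩ (hv.sub hu).continuousOn
  have hd : 0 < v t0 - u t0 := sub_pos.2 (hlt t0)
  refine ⟨min ((v t0 - u t0) / 2) (ε0 / 2), lt_min (by linarith) (by linarith), ?_⟩
  intro x x1 x2 y y1 y2 X Y hx hy h0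
  refine CL G M X Y (T := T2) (fun t ht => ?_) (fun t ht => ?_)
  · rcases le_total t T0 with h | h
    · exact h0 t h
    · have h1 : v t0 - u t0 ≤ v t - u t := hmin ⟨h, ht⟩
      have := hx t; have := hy t
      have := min_le_left ((v t0 - u t0) / 2) (ε0 / 2)
      linarith
  · have := hT1 t ((le_max_right _ _).trans ht)
    have := hy t
    have := min_le_right ((v t0 - u t0) / 2) (ε0 / 2)
    linarith

lemma min_fam (G : GH g κ q p L δ A γ ε0) (M : MU q c τ μ) {X Y : ℝ → ℝ → ℝ} {K : ℝ}
    (hX : ∀ s, ∃ x1 x2, Sol g κ c τ (X s) x1 x2) (hY : ∀ s, ∃ x1 x2, Sol g κ c τ (Y s) x1 x2)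
    (hYκ : ∀ s, Tendsto (Y s) atTop (nhds κ))
    (hmono : ∀ s s' t, s ≤ s' → Y s t - X s t ≤ Y s' t - X s' t)
    (hXl : ∀ s s' t, |X s t - X s' t| ≤ K * |s - s'|) (hYl : ∀ s s' t, |Y s t - Y s' t| ≤ K * |s - s'|)
    (hne : ∃ s, ∀ t, X s t ≤ Y s t) (hbd : ∃ s, ¬ ∀ t, X s t ≤ Y s t) :
    ∃ s0, (∀ t, X s0 t ≤ Y s0 t) ∧ ((∀ t, X s0 t = Y s0 t) ∨ ∀ s < s0, ∃ᶠ t in atBot, Y s t < X s t) := by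
  set S := {s | ∀ t, X s t ≤ Y s t} with hS
  have hbb : BddBelow S := by
    obtain ⟨s, hs⟩ := hbd
    refine ⟨s, fun s' hs' => ?_⟩
    by_contra hcon
    push Not at hcon
    exact hs fun t => by have := hmono s' s t hcon.le; have := hs' t; linarith
  have hK : 0 ≤ K := by have := (abs_nonneg _).trans (hXl 1 0 0); simpa using this
  have hcl : IsClosed S := by
    have : S = ⋂ t, {s | X s t ≤ Y s t} := by ext s; simp [hS]
    rw [this]
    have hc : ∀ Z : ℝ → ℝ → ℝ, (∀ s s' t, |Z s t - Z s' t| ≤ K * |s - s'|) → ∀ t, Continuous fun s => Z s t :=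
      fun Z hZ t => (LipschitzWith.of_dist_le_mul (K := ⟨K, hK⟩) fun s s' => by
        rw [Real.dist_eq, Real.dist_eq]; exact hZ s s' t).continuous
    exact isClosed_iInter fun t => isClosed_le (hc X hXl t) (hc Y hYl t)
  have hmem : sInf S ∈ S := hcl.csInf_mem hne hbb
  refine ⟨sInf S, hmem, ?_⟩
  set s0 := sInf S
  by_cases heq : ∃ t, X s0 t = Y s0 t
  · left
    obtain ⟨t0, ht0⟩ := heq
    obtain ⟨x1, x2, hx⟩ := hX s0
    obtain ⟨y1, y2, hy⟩ := hY s0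
    exact hx.strong G M hy hmem ht0
  · right
    push Not at heq
    intro s hs
    by_contra hcon
    rw [not_frequently] at hcon
    obtain ⟨T0, hT0⟩ := eventually_atBot.1 hcon
    obtain ⟨x1, x2, hx⟩ := hX s0
    obtain ⟨y1, y2, hy⟩ := hY s0
    obtain ⟨m, hm, hsl⟩ := slide G M hx.t2.c0 hy.t2.c0 (fun t => lt_of_le_of_ne (hmem t) (heq t)) (hYκ s0) T0
    set r := min (s0 - s) (m / (K + 1)) with hr
    have hr0 : 0 < r := lt_min (by linarith) (by positivity)
    have hr1 : K * r ≤ m := by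
      have h1 : r ≤ m / (K + 1) := min_le_right _ _
      rw [le_div_iff₀ (by positivity)] at h1
      linarith
    have hr2 : r ≤ s0 - s := min_le_left _ _
    obtain ⟨x1', x2', hx'⟩ := hX (s0 - r)
    obtain ⟨y1', y2', hy'⟩ := hY (s0 - r)
    have : s0 - r ∈ S := hsl _ _ _ _ _ _ hx' hy' (fun t => by
        have := hXl (s0 - r) s0 t
        rw [show s0 - r - s0 = -r by ring, abs_neg, abs_of_pos hr0] at this
        linarith [(abs_le.1 this).2]) (fun t => by
        have := hYl (s0 - r) s0 t
        rw [show s0 - r - s0 = -r by ring, abs_neg, abs_of_pos hr0] at this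
        linarith [(abs_le.1 this).1]) (fun t ht => by
        have h1 := hT0 t ht
        have := hmono s (s0 - r) t (by linarith)
        linarith)
    have := csInf_le hbb this
    linarith
end


section
variable {g : ℝ → ℝ} {κ q p L δ A γ ε0 c τ μ h l T ν lam lam' : ℝ} {f f1 f2 b b1 b2 u u1 u2 v v1 v2 E E' : ℝ → ℝ}
  {ll ll' : (ℝ → ℝ) → (ℝ → ℝ) → ℝ → ℝ}

lemma tsh (s : ℝ) : Tendsto (fun t : ℝ => t + s) atBot atBot := tendsto_atBot_add_const_right _ s tendsto_id

lemma ev_le_o (N : Fn μ l lam ll E) (hu : ∃ C, 0 < C ∧ ∀ᶠ t in atBot, u t ≤ C * E t)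
    (hv : ∃ C > 0, ∀ᶠ t in atBot, E' t ≤ C * v t) (ho : Oo E E') (s : ℝ) :
    ∀ᶠ t in atBot, u (t + s) ≤ v t := by
  obtain ⟨C, hC, hu⟩ := hu
  obtain ⟨C', hC', hv⟩ := hv
  have he := Real.exp_pos (lam * s)
  set η := 1 / (C * (2 * Real.exp (lam * s)) * C') with hη
  have hη0 : 0 < η := by positivity
  filter_upwards [(tsh s).eventually hu, hv, ho η hη0, N.sh s] with t h1 h2 h3 h4
  calc u (t + s) ≤ C * E (t + s) := h1
    _ ≤ C * (2 * Real.exp (lam * s) * E t) := mul_le_mul_of_nonneg_left h4 hC.le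
    _ = C * (2 * Real.exp (lam * s)) * E t := by ring
    _ ≤ C * (2 * Real.exp (lam * s)) * (η * (C' * v t)) :=
      mul_le_mul_of_nonneg_left (h3.trans (mul_le_mul_of_nonneg_left h2 hη0.le)) (by positivity)
    _ = v t := by rw [hη]; field_simp

lemma ev_le_s (N : Fn μ l lam ll E) (h0 : 0 < lam) (hv0 : ∀ t, 0 < v t)
    (hu : ∃ C, 0 < C ∧ ∀ᶠ t in atBot, u t ≤ C * E t)
    (hv : ∃ C > 0, ∀ᶠ t in atBot, E t ≤ C * v t) : ∃ s, ∀ᶠ t in atBot, u (t + s) ≤ v t := by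
  obtain ⟨C, hC, hu⟩ := hu
  obtain ⟨C', hC', hv⟩ := hv
  obtain ⟨s, hs⟩ := ((tendsto_exp_mul_atBot h0).eventually
    (gt_mem_nhds (show 0 < 1 / (2 * C * C') by positivity))).exists
  have he := Real.exp_pos (lam * s)
  rw [lt_div_iff₀ (by positivity)] at hs
  refine ⟨s, ?_⟩
  filter_upwards [(tsh s).eventually hu, hv, N.sh s] with t h1 h2 h4
  calc u (t + s) ≤ C * E (t + s) := h1
    _ ≤ C * (2 * Real.exp (lam * s) * E t) := mul_le_mul_of_nonneg_left h4 hC.le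
    _ = C * (2 * Real.exp (lam * s)) * E t := by ring
    _ ≤ C * (2 * Real.exp (lam * s)) * (C' * v t) := mul_le_mul_of_nonneg_left h2 (by positivity)
    _ = (Real.exp (lam * s) * (2 * C * C')) * v t := by ring
    _ ≤ v t := by have := hv0 t; nlinarith

lemma glob1 (G : GH g κ q p L δ A γ ε0) (M : MU q c τ μ) (B : Front g κ c τ b b1 b2) (hm : Monotone b)
    (F : Front g κ c τ f f1 f2) {s : ℝ} (hs : ∀ᶠ t in atBot, b (t + s) ≤ f t) :
    ∃ s', ∀ t, b (t + -s') ≤ f t := by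
  have hε := G.hε
  obtain ⟨T, hT⟩ := eventually_atBot.1 hs
  obtain ⟨T1, hT1⟩ := eventually_atTop.1 (F.limκ.eventually (lt_mem_nhds (show κ - ε0 < κ by linarith)))
  set T2 := max T T1
  obtain ⟨t0, -, hmin⟩ := (isCompact_Icc (a := T) (b := T2)).exists_isMinOn
    ⟨T, le_rfl, le_max_left _ _⟩ F.t2.c0.continuousOn
  obtain ⟨R, hR⟩ := eventually_atBot.1 (B.lim0.eventually (gt_mem_nhds (F.pos t0)))
  refine ⟨max (-s) (T2 - R), CL G M ((B.shift _).sol G M) (F.sol G M) (T := T2) (fun t ht => ?_) fun t ht => ?_⟩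
  · rcases le_total t T with h | h
    · exact (hm (by linarith [le_max_left (-s) (T2 - R)])).trans (hT t h)
    · have h1 : f t0 ≤ f t := hmin ⟨h, ht⟩
      exact (hR _ (by linarith [le_max_right (-s) (T2 - R)])).le.trans h1
  · exact (hT1 t ((le_max_right _ _).trans ht)).le

lemma glob2 (G : GH g κ q p L δ A γ ε0) (M : MU q c τ μ) (B : Front g κ c τ b b1 b2) (hm : Monotone b)
    (F : Front g κ c τ f f1 f2) {s : ℝ} (hs : ∀ᶠ t in atBot, f t ≤ b (t + s)) :
    ∃ s', ∀ t, f t ≤ b (t + s') := by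
  have hε := G.hε
  obtain ⟨T, hT⟩ := eventually_atBot.1 hs
  obtain ⟨R, hR⟩ := eventually_atTop.1 (B.limκ.eventually (lt_mem_nhds (show κ - ε0 < κ by linarith)))
  refine ⟨max s (R - T), CL G M (F.sol G M) ((B.shift _).sol G M) (T := T) (fun t ht => ?_) fun t ht => ?_⟩
  · exact (hT t ht).trans (hm (by linarith [le_max_left s (R - T)]))
  · exact (hR _ (by linarith [le_max_right s (R - T)])).le

lemma asy_eq (N : Fn μ l lam ll E) (hu : Continuous u) (hv : Continuous v)
    (H : Hk μ l T (fun t => v t - u t) (fun t => v1 t - u1 t)) {a a' K : ℝ}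
    (ha : Tendsto (ll u u1) atBot (nhds a)) (ha' : Tendsto (ll v v1) atBot (nhds a'))
    (hf : ∀ r, 0 < r → ∃ᶠ t in atBot, v t - u t ≤ K * r * E t) : a = a' := by
  by_contra hne
  obtain ⟨C, hC, hb⟩ := N.bd
  have hd : 0 < |a' - a| := abs_pos.2 (sub_ne_zero.2 (Ne.symm hne))
  have hw : Tendsto (ll (fun t => v t - u t) (fun t => v1 t - u1 t)) atBot (nhds (a' - a)) :=
    (ha'.sub ha).congr fun t => (N.sub v u v1 u1 hv hu t).symm
  set r := |a' - a| / 4 / (C * |K| + 1) with hr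
  have hr0 : 0 < r := by positivity
  have hr1 : C * |K| * r ≤ |a' - a| / 4 := by
    have : r * (C * |K| + 1) = |a' - a| / 4 := by rw [hr]; field_simp
    linarith
  obtain ⟨t, h1, h2, h3, h4⟩ := ((hf r hr0).and_eventually ((hb T _ _ H).and (N.pos.and
    (hw.abs.eventually (lt_mem_nhds (show |a' - a| / 2 < |a' - a| by linarith)))))).exists
  have h5 : |a' - a| / 2 * E t ≤ |a' - a| / 4 * E t := by
    calc _ ≤ _ := mul_le_mul_of_nonneg_right h4.le h3.le
      _ ≤ C * (v t - u t) := h2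
      _ ≤ C * (K * r * E t) := mul_le_mul_of_nonneg_left h1 hC.le
      _ = C * r * E t * K := by ring
      _ ≤ C * r * E t * |K| := mul_le_mul_of_nonneg_left (le_abs_self K) (by positivity)
      _ = C * |K| * r * E t := by ring
      _ ≤ _ := mul_le_mul_of_nonneg_right hr1 h3.le
  have := le_of_mul_le_mul_right h5 h3
  linarith

lemma bdiff (N : Fn μ l lam ll E) (hl : 0 < l) (H : Hk μ l T b b1) (hm : Monotone b)
    (hu : ∃ C, 0 < C ∧ ∀ᶠ t in atBot, b t ≤ C * E t) (Y : ℝ) :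
    ∃ K, ∀ r, 0 < r → ∀ x ≤ Y, ∀ᶠ t in atBot, b (t + x) - b (t + (x - r)) ≤ K * r * E t := by
  obtain ⟨C, hC, hu⟩ := hu
  refine ⟨l * (C * (2 * Real.exp (lam * Y))), fun r hr x hx => ?_⟩
  filter_upwards [(tsh Y).eventually hu, N.sh Y, eventually_le_atBot (T - x)] with t h1 h2 h3
  obtain ⟨s, hs, e⟩ := mvt H.d (show t + (x - r) < t + x by linarith)
  rw [e, show t + x - (t + (x - r)) = r by ring]
  have h4 := H.up s (by linarith [hs.2])
  have h5 : b s ≤ b (t + Y) := hm (by linarith [hs.2])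
  have h6 : b s ≤ C * (2 * Real.exp (lam * Y) * E t) := (h5.trans h1).trans (mul_le_mul_of_nonneg_left h2 hC.le)
  have h7 := mul_le_mul_of_nonneg_left h6 hl.le
  have h8 := mul_le_mul_of_nonneg_right (h4.trans h7) hr.le
  linarith

lemma Front.hk' (G : GH g κ q p L δ A γ ε0) (M : MU q c τ μ) (U : Front g κ c τ u u1 u2)
    (V : Front g κ c τ v v1 v2) (hle : ∀ t, u t ≤ v t) (hl : 0 < l)
    (hl2 : l ^ 2 - c * l - 1 = 0) : ∃ T, Hk μ l T (fun t => v t - u t) (fun t => v1 t - u1 t) := by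
  obtain ⟨T, hT⟩ := V.exT (τ := τ) G.hδ
  exact ⟨T, (U.sol G M).hk G M (V.sol G M) hle U.lim0 (U.f1lim G) V.lim0 (V.f1lim G) hT hl hl2⟩

lemma unique_aux (G : GH g κ q p L δ A γ ε0) (M : MU q c τ μ) (B : Front g κ c τ b b1 b2) (hm : Monotone b)
    (F : Front g κ c τ f f1 f2) : ∃ s, ∀ t, f t = b (t + s) := by
  obtain ⟨l, hl, hl2⟩ := exists_l M.hc
  have hp : 0 < p := by linarith [G.hp]
  obtain ⟨lam, ll, E, h0, hll, ty, S⟩ := B.has G M hl hl2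
  obtain ⟨lam', ll', E', h0', hll', ty', S'⟩ := F.has G M hl hl2
  have N := ty.fn hp M.hc M.hτ M.hμ.le hl h0 hll
  have N' := ty'.fn hp M.hc M.hτ M.hμ.le hl h0' hll'
  obtain ⟨TB, hTB⟩ := B.exT (τ := τ) G.hδ
  have HB := B.hk G M hTB hl hl2
  obtain ⟨TF, hTF⟩ := F.exT (τ := τ) G.hδ
  have HF := F.hk G M hTF hl hl2
  have loB := S.lower N HB
  have loF := S'.lower N' HF
  obtain ⟨a, ha, hL, upB⟩ := S
  obtain ⟨a', ha', hL', upF⟩ := S'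
  have hlip := lip_of_bdd B.t2.d1 ((B.sol G M).f1b G)
  set K := 2 * κ + |c| * (2 * κ) + (κ + L * κ) with hKd
  have hK : 0 ≤ K := (abs_nonneg _).trans ((B.sol G M).f1b G 0)
  have bF : ∀ s s' t : ℝ, |f t - f t| ≤ K * |s - s'| := fun s s' t => by
    rw [sub_self, abs_zero]; positivity
  have fam1 : (∃ s, ∀ᶠ t in atBot, b (t + s) ≤ f t) → ∃ s0, (∀ t, b (t + -s0) ≤ f t) ∧
      ((∀ t, b (t + -s0) = f t) ∨ ∀ s < s0, ∃ᶠ t in atBot, f t < b (t + -s)) := by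
    rintro ⟨s, hs⟩
    refine min_fam (X := fun s t => b (t + -s)) (Y := fun _ t => f t) (K := K) G M (fun s => ⟨_, _, (B.shift (-s)).sol G M⟩)
      (fun s => ⟨_, _, F.sol G M⟩) (fun _ => F.limκ) (fun s s' t hss => ?_) (fun s s' t => ?_) bF
      (glob1 G M B hm F hs) ?_
    · have : b (t + -s') ≤ b (t + -s) := hm (by linarith)
      linarith
    · refine (hlip _ _).trans (le_of_eq ?_)
      rw [show t + -s - (t + -s') = -(s - s') by ring, abs_neg]
    · obtain ⟨r, hr⟩ := (B.limκ.eventually (lt_mem_nhds (F.lt G M 0))).exists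
      refine ⟨-r, fun hcon => ?_⟩
      have := hcon 0
      simp only [neg_neg, zero_add] at this
      linarith
  have fam2 : (∃ s, ∀ᶠ t in atBot, f t ≤ b (t + s)) → ∃ s0, (∀ t, f t ≤ b (t + s0)) ∧
      ((∀ t, f t = b (t + s0)) ∨ ∀ s < s0, ∃ᶠ t in atBot, b (t + s) < f t) := by
    rintro ⟨s, hs⟩
    refine min_fam (X := fun _ t => f t) (Y := fun s t => b (t + s)) (K := K) G M
      (fun s => ⟨_, _, F.sol G M⟩) (fun s => ⟨_, _, (B.shift s).sol G M⟩)
      (fun s => (B.shift s).limκ) (fun s s' t hss => ?_) bF (fun s s' t => ?_)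
      (glob2 G M B hm F hs) ?_
    · have : b (t + s) ≤ b (t + s') := hm (by linarith)
      linarith
    · refine (hlip _ _).trans (le_of_eq ?_)
      rw [show t + s - (t + s') = s - s' by ring]
    · obtain ⟨r, hr⟩ := (B.lim0.eventually (gt_mem_nhds (F.pos 0))).exists
      refine ⟨r, fun hcon => ?_⟩
      have := hcon 0
      simp only [zero_add] at this
      linarith
  have sh' : (∃ s, ∀ᶠ t in atBot, f (t + s) ≤ b t) → ∃ s, ∀ᶠ t in atBot, f t ≤ b (t + s) := by
    rintro ⟨s, hs⟩
    refine ⟨-s, ?_⟩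
    filter_upwards [(tsh (-s)).eventually hs] with t ht
    simpa using ht
  rcases ty.trich ty' with ⟨rfl, rfl, rfl⟩ | ho | ho
  · obtain ⟨s0, hs0, h | h⟩ := fam1 (ev_le_s N h0 F.pos upB loF)
    · exact ⟨-s0, fun t => (h t).symm⟩
    obtain ⟨s1, hs1, h' | h'⟩ := fam2 (sh' (ev_le_s N h0 B.pos upF loB))
    · exact ⟨s1, h'⟩
    have e1 : Real.exp (lam * -s0) * a = a' := by
      obtain ⟨T, H⟩ := (B.shift (-s0)).hk' G M F hs0 hl hl2
      obtain ⟨K, hK⟩ := bdiff N hl HB hm upB (-s0 + 1)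
      have key : ∀ r, 0 < r → r ≤ 1 → ∃ᶠ t in atBot, f t - b (t + -s0) ≤ K * r * E t := by
        intro r hr hr1
        refine ((h (s0 - r) (by linarith)).and_eventually (hK r hr (-(s0 - r)) (by linarith))).mono ?_
        rintro t ⟨h1, h2⟩
        rw [show -(s0 - r) - r = -s0 by ring] at h2
        linarith
      refine asy_eq (K := |K|) N (B.shift (-s0)).t2.c0 F.t2.c0 H (N.shift _ _ _ _ hL) hL' (fun r hr => ?_)
      refine ((key (min r 1) (by positivity) (min_le_right _ _)).and_eventually N.pos).mono ?_
      rintro t ⟨h1, h2⟩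
      refine h1.trans (mul_le_mul_of_nonneg_right ?_ h2.le)
      exact mul_le_mul (le_abs_self K) (min_le_left _ _) (by positivity) (abs_nonneg K)
    have e2 : a' = Real.exp (lam * s1) * a := by
      obtain ⟨T, H⟩ := F.hk' G M (B.shift s1) hs1 hl hl2
      obtain ⟨K, hK⟩ := bdiff N hl HB hm upB s1
      refine asy_eq (K := K) N F.t2.c0 (B.shift s1).t2.c0 H hL' (N.shift _ _ _ _ hL) (fun r hr => ?_)
      refine ((h' (s1 - r) (by linarith)).and_eventually (hK r hr s1 le_rfl)).mono ?_
      rintro t ⟨h1, h2⟩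
      linarith
    have e3 : s1 = -s0 := by
      have := mul_right_cancel₀ ha (e1.trans e2)
      exact (mul_left_cancel₀ h0.ne' (Real.exp_injective this)).symm
    rw [e3] at hs1
    exact ⟨-s0, fun t => le_antisymm (hs1 t) (hs0 t)⟩
  · have hall := ev_le_o N upB loF ho
    obtain ⟨s0, hs0, h | h⟩ := fam1 ⟨0, hall 0⟩
    · exact ⟨-s0, fun t => (h t).symm⟩
    · obtain ⟨t, h1, h2⟩ := ((h (s0 - 1) (by linarith)).and_eventually (hall (-(s0 - 1)))).exists
      linarith
  · have hall := ev_le_o N' upF loB ho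
    have hall' : ∀ s, ∀ᶠ t in atBot, f t ≤ b (t + s) := fun s => by
      filter_upwards [(tsh s).eventually (hall (-s))] with t ht
      simpa using ht
    obtain ⟨s0, hs0, h | h⟩ := fam2 ⟨0, hall' 0⟩
    · exact ⟨s0, h⟩
    · obtain ⟨t, h1, h2⟩ := ((h (s0 - 1) (by linarith)).and_eventually (hall' (s0 - 1))).exists
      linarith
end

section
variable {g : ℝ → ℝ} {κ q p L δ A γ ε0 c τ μ h : ℝ} {f f1 f2 φ ψ : ℝ → ℝ}

lemma t2_of_contDiff (h : ContDiff ℝ 2 φ) : T2 φ (deriv φ) (deriv (deriv φ)) := by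
  have h1 : ContDiff ℝ 1 (deriv φ) := by
    have : ContDiff ℝ (1 + 1) φ := by norm_num; exact h
    exact (contDiff_succ_iff_deriv.1 this).2.2
  exact ⟨fun t => (h.differentiable (by norm_num) t).hasDerivAt, fun t => (h1.differentiable (by norm_num) t).hasDerivAt⟩

lemma front_of_wavefront (W : Wavefront g κ c h φ) : Front g κ c (c * h) φ (deriv φ) (deriv (deriv φ)) :=
  ⟨t2_of_contDiff W.2.1, W.1, W.2.2.1, W.2.2.2.1, W.2.2.2.2⟩

lemma wavefront_of_front (hg : Continuous g) (F : Front g κ c (c * h) f f1 f2) : Wavefront g κ c h f := by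
  have e1 : deriv f = f1 := funext fun t => (F.t2.d1 t).deriv
  have e2 : deriv f1 = f2 := funext fun t => (F.t2.d2 t).deriv
  have h0 := F.t2.c0
  have h1 := F.t2.c1
  have h2 : Continuous f2 := by
    have : f2 = fun t => c * f1 t + f t - g (f (t - c * h)) := by funext t; linarith [F.eq t]
    rw [this]; fun_prop
  refine ⟨F.pos, ?_, fun t => ?_, F.lim0, F.limκ⟩
  · have h3 : ContDiff ℝ 1 f1 := contDiff_one_iff_deriv.2 ⟨fun t => (F.t2.d2 t).differentiableAt, by rw [e2]; exact h2⟩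
    have : ContDiff ℝ (1 + 1) f := contDiff_succ_iff_deriv.2
      ⟨fun t => (F.t2.d1 t).differentiableAt, by simp, by rw [e1]; exact h3⟩
    norm_num at this; exact this
  · rw [e1, e2]; exact F.eq t

lemma sw_of_semi (W : SemiWavefront g c h φ) : SW g c (c * h) φ (deriv φ) (deriv (deriv φ)) := by
  obtain ⟨hpos, hC, heq, hl0, hinf⟩ := W
  refine ⟨t2_of_contDiff hC, hpos, heq, hl0, ?_, fun ht => ?_⟩
  · refine ⟨Filter.liminf φ atTop / 2, by linarith, ?_⟩
    exact (eventually_lt_of_lt_liminf (show Filter.liminf φ atTop / 2 < Filter.liminf φ atTop by linarith)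
      ⟨0, eventually_map.2 (Eventually.of_forall fun t => (hpos t).le)⟩).mono fun _ h => h.le
  · rw [liminf_eq] at hinf
    have : {a | ∀ᶠ n in atTop, a ≤ φ n} = univ := by
      ext a; simp only [mem_ofPred_eq, mem_univ, iff_true]; exact ht.eventually_ge_atTop a
    rw [this, Real.sSup_univ] at hinf
    exact lt_irrefl _ hinf

lemma exists_GH {θ : ℝ} (hg_nonneg : ∀ x : ℝ, 0 ≤ x → 0 ≤ g x)
    (hg_C1 : ContDiff ℝ 1 g) (hg0 : g 0 = 0) (hg'0 : 1 < deriv g 0) (hκ : 0 < κ)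
    (hfix : ∀ x : ℝ, 0 ≤ x → (g x = x ↔ x = 0 ∨ x = κ)) (hθ2 : θ < κ)
    (hUinc : StrictMonoOn g (Ico 0 θ)) (hUdec : StrictAntiOn g (Ici θ))
    (hmin : ∀ u ∈ Icc 0 κ, deriv g κ ≤ deriv g u) (hgκ : deriv g κ < 0)
    (hA : 0 < A) (hδ1 : 0 < δ) (hδ2 : δ < θ) (hγ1 : 0 < γ)
    (hHolder : ∀ u ∈ Icc 0 δ, |deriv g u - deriv g 0| ≤ A * u ^ γ) :
    ∃ L δ' ε0, GH g κ (-deriv g κ) (deriv g 0) L δ' A γ ε0 := by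
  have hd : ∀ t, HasDerivAt g (deriv g t) t := fun t => (hg_C1.differentiable (by norm_num) t).hasDerivAt
  have hdc : Continuous (deriv g) := hg_C1.continuous_deriv (by norm_num)
  have hd2 : ∀ t, HasDerivAt (fun t => g t + -deriv g κ * t) (deriv g t + -deriv g κ) t := fun t =>
    ((hd t).add ((hasDerivAt_id t).const_mul (-deriv g κ))).congr_deriv (by simp)
  obtain ⟨L0, hL0⟩ := (isCompact_Icc (a := (0:ℝ)) (b := κ)).exists_bound_of_continuousOn hdc.continuousOn
  obtain ⟨d, hd0, hdp⟩ := small_pow hA hγ1 (show 0 < deriv g 0 - 1 by linarith)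
  obtain ⟨e, he, hke⟩ := Metric.continuousAt_iff.1 (hdc.continuousAt (x := κ)) (1 / 2) (by norm_num)
  have gκ : g κ = κ := (hfix κ hκ.le).2 (Or.inr rfl)
  have hol : ∀ u ∈ Icc 0 (min δ d), |g u - deriv g 0 * u| ≤ A * u ^ γ * u := by
    intro u hu
    rcases hu.1.eq_or_lt with h0 | h0
    · rw [← h0, hg0]; simp
    · obtain ⟨s, hs, e⟩ := mvt hd h0
      rw [hg0, sub_zero, sub_zero] at e
      have h1 := hHolder s ⟨hs.1.le, hs.2.le.trans (hu.2.trans (min_le_left _ _))⟩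
      have h2 := Real.rpow_le_rpow hs.1.le hs.2.le hγ1.le
      rw [e, ← sub_mul, abs_mul, abs_of_pos h0]
      exact mul_le_mul_of_nonneg_right (h1.trans (mul_le_mul_of_nonneg_left h2 hA.le)) h0.le
  refine ⟨max L0 1, min δ d, min (e / 2) (κ / 2), ?_⟩
  refine ⟨hg_C1.continuous, hκ, by linarith, hg'0, le_max_right _ _, hg0, gκ, hg_nonneg,
    fun x hx h => (hfix x hx.1).1 h, ?_, ?_, ?_, lt_min hδ1 hd0, lt_of_le_of_lt (min_le_left _ _) (by linarith),
    ?_, ?_, hA, hγ1, hol, lt_min (by linarith) (by linarith), lt_of_le_of_lt (min_le_right _ _) (by linarith), ?_⟩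
  · intro u v hu huv hv
    have hm : MonotoneOn (fun t => g t + -deriv g κ * t) (Icc 0 κ) :=
      monotoneOn_of_hasDerivWithinAt_nonneg (f' := fun t => deriv g t + -deriv g κ) (convex_Icc 0 κ)
        (by have := hg_C1.continuous; fun_prop)
        (fun t _ => (hd2 t).hasDerivWithinAt)
        (fun t ht => by have := hmin t (interior_subset ht); linarith)
    exact hm ⟨hu, huv.trans hv⟩ ⟨hu.trans huv, hv⟩ huv
  · intro u hu
    have := hUdec.antitoneOn (mem_Ici.2 hθ2.le) (mem_Ici.2 (hθ2.le.trans hu)) hu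
    linarith
  · intro u hu v hv
    have := (convex_Icc (0:ℝ) κ).norm_image_sub_le_of_norm_hasDerivWithin_le (f := g) (f' := deriv g) (C := max L0 1)
      (fun t _ => (hd t).hasDerivWithinAt) (fun t ht => (hL0 t ht).trans (le_max_left _ _)) hv hu
    simpa using this
  · intro u hu v hv huv
    have : ∀ x ∈ Icc 0 (min δ d), x ∈ Ico 0 θ := fun x hx => ⟨hx.1, lt_of_le_of_lt (hx.2.trans (min_le_left _ _)) hδ2⟩
    exact hUinc.monotoneOn (this u hu) (this v hv) huv
  · intro u hu
    have h1 := (abs_le.1 (hol u hu)).1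
    have h2 := hdp u hu.1 (hu.2.trans (min_le_right _ _))
    have h3 := mul_le_mul_of_nonneg_right h2 hu.1
    linarith
  · intro u hu v hv
    have := (convex_Icc (κ - min (e / 2) (κ / 2)) κ).norm_image_sub_le_of_norm_hasDerivWithin_le
      (f := fun t => g t + -deriv g κ * t) (f' := fun t => deriv g t + -deriv g κ) (C := 1 / 2)
      (fun t _ => (hd2 t).hasDerivWithinAt)
      (fun t ht => by
        have := hke (x := t) (by
          rw [Real.dist_eq, abs_lt]
          constructor <;> linarith [ht.1, ht.2, min_le_left (e / 2) (κ / 2)])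
        rw [Real.dist_eq] at this
        rw [Real.norm_eq_abs, ← sub_eq_add_neg]; exact this.le) hv hu
    simpa only [Real.norm_eq_abs] using this
end

/-- For every delay `h ∈ [0, h_*]`, where `h_*` is the unique real solution of
`1 = |g'(κ)| h e^{h+1}`, there is a minimal speed `c_* > 0` such that: (a) for every
`c ≥ c_*` a wavefront of speed `c` exists, every wavefront profile of speed `c` is strictly
increasing, and the wavefront profile of speed `c` is unique up to translation; and
(b) for every `c < c_*` there is no semi-wavefront of speed `c`. -/
theorem small_delay_minimal_speed
    (g : ℝ → ℝ) (κ θ A δ γ : ℝ)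
    (hg_nonneg : ∀ x : ℝ, 0 ≤ x → 0 ≤ g x)
    (hg_C1 : ContDiff ℝ 1 g)
    (hg0 : g 0 = 0)
    (hg'0 : 1 < deriv g 0)
    (hκ : 0 < κ)
    (hfix : ∀ x : ℝ, 0 ≤ x → (g x = x ↔ x = 0 ∨ x = κ))
    (hθ1 : 0 < θ) (hθ2 : θ < κ)
    (hUinc : StrictMonoOn g (Ico 0 θ))
    (hUdec : StrictAntiOn g (Ici θ))
    (hmin : ∀ u ∈ Icc 0 κ, deriv g κ ≤ deriv g u)
    (hgκ : deriv g κ < 0)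
    (hA : 0 < A) (hδ1 : 0 < δ) (hδ2 : δ < θ) (hγ1 : 0 < γ) (hγ2 : γ ≤ 1)
    (hHolder : ∀ u ∈ Icc 0 δ, |deriv g u - deriv g 0| ≤ A * u ^ γ)
    (hs : ℝ) (hs_pos : 0 < hs)
    (hs_eq : 1 = |deriv g κ| * hs * Real.exp (hs + 1))
    (hs_unique : ∀ h' : ℝ, 1 = |deriv g κ| * h' * Real.exp (h' + 1) → h' = hs)
    (h : ℝ) (hh : h ∈ Icc 0 hs) :
    ∃ cstar : ℝ, 0 < cstar ∧
      (∀ c : ℝ, cstar ≤ c →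
        (∃ φ : ℝ → ℝ, Wavefront g κ c h φ) ∧
        (∀ φ : ℝ → ℝ, Wavefront g κ c h φ → StrictMono φ) ∧
        (∀ φ ψ : ℝ → ℝ, Wavefront g κ c h φ → Wavefront g κ c h ψ →
          ∃ s : ℝ, ∀ t : ℝ, ψ t = φ (t + s))) ∧
      (∀ c : ℝ, c < cstar → ¬ ∃ φ : ℝ → ℝ, SemiWavefront g c h φ) := by
  
  obtain ⟨L, δ', ε0, G⟩ := exists_GH hg_nonneg hg_C1 hg0 hg'0 hκ hfix hθ2 hUinc hUdec hmin hgκ hA hδ1 hδ2 hγ1 hHolder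
  have hh0 := hh.1
  have hq := G.hq
  have hqh : -deriv g κ * h * Real.exp (h + 1) ≤ 1 := by
    refine le_trans ?_ hs_eq.ge
    rw [abs_of_neg hgκ]
    have h1 : Real.exp (h + 1) ≤ Real.exp (hs + 1) := Real.exp_le_exp.2 (by linarith [hh.2])
    exact mul_le_mul (mul_le_mul_of_nonneg_left hh.2 hq.le) h1 (Real.exp_pos _).le (mul_nonneg hq.le hs_pos.le)
  obtain ⟨c0, hc0, hlow⟩ := inS_lower G hh0 hqh
  have hbb : BddBelow {c | InS g κ h c} := ⟨c0, fun c hc => hlow c hc⟩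
  have hne : {c | InS g κ h c}.Nonempty := ⟨2 * L, inS_large G hh0 hqh le_rfl⟩
  have hpos : 0 < sInf {c | InS g κ h c} := lt_of_lt_of_le hc0 (le_csInf hne fun c hc => hlow c hc)
  obtain ⟨cn, -, hcn, hcS⟩ := exists_seq_tendsto_sInf hne hbb
  have hmem : InS g κ h (sInf {c | InS g κ h c}) := inS_closed G hh0 hqh hpos hcn hcS
  refine ⟨sInf {c | InS g κ h c}, hpos, fun c hc => ?_, fun c hc => ?_⟩
  · obtain ⟨hcp, b, b1, b2, B, hm⟩ := inS_up G hh0 hqh hmem hc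
    obtain ⟨μ, M, -⟩ := exists_mu hq hcp hh0 hqh
    have uni : ∀ φ : ℝ → ℝ, Wavefront g κ c h φ → ∃ s, ∀ t, φ t = b (t + s) := fun φ W =>
      unique_aux G M B hm (front_of_wavefront W)
    refine ⟨⟨b, wavefront_of_front G.cont B⟩, fun φ W => ?_, fun φ ψ W W' => ?_⟩
    · obtain ⟨s, hs⟩ := uni φ W
      intro x y hxy
      rw [hs, hs]
      exact B.strictMono G M hm (by linarith)
    · obtain ⟨s, hs⟩ := uni φ W
      obtain ⟨s', hs'⟩ := uni ψ W'
      refine ⟨s' - s, fun t => ?_⟩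
      rw [hs', hs]; ring_nf
  · rintro ⟨φ, W⟩
    have S := sw_of_semi W
    rcases le_or_gt c 0 with hcn | hcp
    · exact sw_nonpos G hcn hh0 S
    · obtain ⟨μ, M, -⟩ := exists_mu hq hcp hh0 hqh
      have := csInf_le hbb (show c ∈ {c | InS g κ h c} from S.inS G M)
      linarith
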